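/- Let n ≥ 3 and p > (n−1)/2. There is a constant C > 0, depending only on n and p, such that for every measurable V : ℝ^n → ℂ with ‖V‖_{F^p} < ∞ and every function F : ℝ^n × ℝ → ℂ such that F(·,s) is a Schwartz function for each s and (x,s) ↦ F(x,s) is continuous, ‖ ∫_0^t (sin((t−s)√−Δ)/√−Δ) F(·,s) ds ‖_{L²_{x,t}(|V|)} ≤ C ‖V‖_{F^p} ‖F‖_{L²_{x,t}(|V|^{−1})}. -/

import Mathlib

noncomputable section

open MeasureTheory Metric Complex
open scoped ENNReal FourierTransform SchwartzMap

/-- The Fourier multiplier operator `m(√−Δ)` on `ℝⁿ`: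
`m(√−Δ)h = 𝓕⁻¹(m(|ξ|) 𝓕h(ξ))`. -/
def mOp (n : ℕ) (m : ℝ → ℂ) (h : EuclideanSpace ℝ (Fin n) → ℂ) :
    EuclideanSpace ℝ (Fin n) → ℂ :=
  fun x => 𝓕⁻ (fun ξ : EuclideanSpace ℝ (Fin n) => m ‖ξ‖ * 𝓕 h ξ) x

/-- The multiplier of `e^{it√−Δ}`, i.e. `ρ ↦ e^{itρ}`. -/
def expMult (t : ℝ) : ℝ → ℂ := fun ρ => Complex.exp (Complex.I * t * ρ)

/-- The multiplier of `cos(t√−Δ)`, i.e. `ρ ↦ cos (tρ)`. -/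
def cosMult (t : ℝ) : ℝ → ℂ := fun ρ => ((Real.cos (t * ρ) : ℝ) : ℂ)

/-- The multiplier of `sin(t√−Δ)/√−Δ`, i.e. `ρ ↦ sin (tρ)/ρ`. -/
def sincMult (t : ℝ) : ℝ → ℂ := fun ρ => ((Real.sin (t * ρ) / ρ : ℝ) : ℂ)

/-- The multiplier of `sin(t√−Δ)`, i.e. `ρ ↦ sin (tρ)`. -/
def sinMult (t : ℝ) : ℝ → ℂ := fun ρ => ((Real.sin (t * ρ) : ℝ) : ℂ)

/-- The multiplier of `(√−Δ)^γ`, i.e. `ρ ↦ ρ^γ`. -/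
def powMult (γ : ℝ) : ℝ → ℂ := fun ρ => ((ρ ^ γ : ℝ) : ℂ)

/-- A function is Schwartz if it agrees pointwise with some Schwartz map. -/
def IsSchwartz {n : ℕ} (h : EuclideanSpace ℝ (Fin n) → ℂ) : Prop :=
  ∃ φ : 𝓢(EuclideanSpace ℝ (Fin n), ℂ), ∀ x, h x = φ x

/-- The Fefferman–Phong norm
`‖V‖_{𝓕^p} = sup_{x, r>0} r^(2-n/p) (∫_{B_r(x)} |V|^p)^(1/p)`. -/
def fpNorm (n : ℕ) (p : ℝ) (V : EuclideanSpace ℝ (Fin n) → ℂ) : ℝ≥0∞ :=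
  ⨆ (x : EuclideanSpace ℝ (Fin n)) (r : ℝ) (_ : 0 < r),
    ENNReal.ofReal (r ^ (2 - n / p)) *
      (∫⁻ y in ball x r, ENNReal.ofReal (‖V y‖ ^ p)) ^ (1 / p)

/-- The weak `L^{n/2}` quasinorm `sup_{λ>0} λ · |{|V| > λ}|^{2/n}`. -/
def wkNorm (n : ℕ) (V : EuclideanSpace ℝ (Fin n) → ℂ) : ℝ≥0∞ :=
  ⨆ (l : ℝ) (_ : 0 < l),
    ENNReal.ofReal l * (volume {x : EuclideanSpace ℝ (Fin n) | l < ‖V x‖}) ^ ((2 : ℝ) / n)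

/-- The mixed norm `‖F‖_{L^q_t L^r_x}` for `F : ℝⁿ × ℝ → ℂ`, curried as `F x t`. -/
def mixedNorm (n : ℕ) (q r : ℝ) (F : EuclideanSpace ℝ (Fin n) → ℝ → ℂ) : ℝ≥0∞ :=
  (∫⁻ t : ℝ, (∫⁻ x : EuclideanSpace ℝ (Fin n), (‖F x t‖₊ : ℝ≥0∞) ^ r) ^ (q / r)) ^ (1 / q)

/-- The weighted norm `‖h‖_{L²_{x,t}(w)}` with weight `w : ℝⁿ → [0,∞]`. -/
def wtNorm (n : ℕ) (w : EuclideanSpace ℝ (Fin n) → ℝ≥0∞)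
    (h : EuclideanSpace ℝ (Fin n) → ℝ → ℂ) : ℝ≥0∞ :=
  (∫⁻ t : ℝ, ∫⁻ x : EuclideanSpace ℝ (Fin n), (‖h x t‖₊ : ℝ≥0∞) ^ (2 : ℝ) * w x) ^ ((1 : ℝ) / 2)

/-- The homogeneous Sobolev norm `‖h‖_{Ḣ^γ} = ‖(√−Δ)^γ h‖_{L²}`. -/
def sobNorm (n : ℕ) (γ : ℝ) (h : EuclideanSpace ℝ (Fin n) → ℂ) : ℝ≥0∞ :=
  eLpNorm (mOp n (powMult γ) h) 2 volume

/-- The point `x/|x|` of the unit sphere, for `x ≠ 0`. -/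
def sphMap (n : ℕ) (x : EuclideanSpace ℝ (Fin n)) (hx : x ≠ 0) :
    Metric.sphere (0 : EuclideanSpace ℝ (Fin n)) 1 :=
  ⟨‖x‖⁻¹ • x, by
    rw [mem_sphere_zero_iff_norm, norm_smul, norm_inv, norm_norm,
      inv_mul_cancel₀ (norm_ne_zero_iff.mpr hx)]⟩

set_option linter.unusedSectionVars false


section plancherel
variable {E : Type*} [NormedAddCommGroup E] [InnerProductSpace ℝ E] [FiniteDimensional ℝ E]
  [MeasurableSpace E] [BorelSpace E]

theorem wl_continuous_fourier {f : E → ℂ} (hf : Integrable f) : Continuous (𝓕 f) :=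
  VectorFourier.fourierIntegral_continuous Real.continuous_fourierChar
    (by exact continuous_inner) hf

theorem wl_fourier_swap {f g : E → ℂ} (hf : Integrable f) (hg : Integrable g) :
    ∫ x, 𝓕 f x * g x = ∫ x, f x * 𝓕 g x := by
  have := VectorFourier.integral_fourierIntegral_smul_eq_flip (L := innerₗ E)
      Real.continuous_fourierChar continuous_inner hf hg
  simpa using! this

theorem wl_plancherel {f : E → ℂ} (hf : Integrable f) (hf2 : MemLp f 2) :
    ∫⁻ ξ, ‖𝓕 f ξ‖ₑ ^ 2 = ∫⁻ x, ‖f x‖ₑ ^ 2 := by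
  have key : (𝓕 (hf2.toLp f) : Lp (α := E) ℂ 2 volume) =ᵐ[volume] 𝓕 f := by
    apply ae_eq_of_integral_contDiff_smul_eq
    · exact (Lp.memLp _).locallyIntegrable (by norm_num)
    · exact (wl_continuous_fourier hf).locallyIntegrable
    · intro g hg1 hg2
      set G : 𝓢(E, ℂ) := (hg2.comp_left (g := fun x : ℝ => (x : ℂ)) rfl).toSchwartzMap
        (Complex.ofRealCLM.contDiff.comp hg1) with hG
      have h1 := congrArg (fun T => T G) (Lp.fourier_toTemperedDistribution_eq (hf2.toLp f))
      simp only [Lp.toTemperedDistribution_apply, TemperedDistribution.fourier_apply] at h1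
      have h2 : ∀ x, G x = (g x : ℂ) := fun x => rfl
      have h3 : ∫ x, (𝓕 G) x • (hf2.toLp f) x = ∫ x, f x * 𝓕 (fun y => (g y : ℂ)) x := by
        apply integral_congr_ae
        filter_upwards [hf2.coeFn_toLp] with x hx
        rw [hx, smul_eq_mul, mul_comm]
        rfl
      rw [h3, ← wl_fourier_swap hf] at h1
      · simp only [h2, smul_eq_mul] at h1
        simp only [Complex.real_smul]
        rw [← h1]
        congr 1; ext x; ring
      · exact G.integrable
  have h1 := Lp.norm_fourier_eq (hf2.toLp f)
  rw [Lp.norm_def, Lp.norm_def, ENNReal.toReal_eq_toReal_iff' (Lp.eLpNorm_ne_top _) (Lp.eLpNorm_ne_top _),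
    eLpNorm_congr_ae key, eLpNorm_congr_ae hf2.coeFn_toLp] at h1
  rw [eLpNorm_eq_lintegral_rpow_enorm_toReal (by norm_num) (by norm_num),
    eLpNorm_eq_lintegral_rpow_enorm_toReal (by norm_num) (by norm_num)] at h1
  have := congrArg (fun z => z ^ (2:ℝ)) h1
  simp only [← ENNReal.rpow_mul] at this
  simpa using this

end plancherel


theorem wl_glasser_aux {m ρ : ℝ} (hm : 0 < m) (hρ : 0 < ρ) :
    IntegrableOn (fun t : ℝ => Real.exp (-(m * t - ρ / t) ^ 2)) (Set.Ioi 0) ∧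
    ∫ t in Set.Ioi (0:ℝ), Real.exp (-(m * t - ρ / t) ^ 2) = √Real.pi / (2 * m) := by
  have hd : ∀ t ∈ Set.Ioi (0:ℝ), HasDerivWithinAt (fun t => m * t - ρ / t) (m + ρ / t ^ 2) (Set.Ioi 0) t := by
    intro t ht
    have ht' : t ≠ 0 := ne_of_gt ht
    have h1 := ((hasDerivAt_id t).const_mul m).sub ((hasDerivAt_inv ht').const_mul ρ)
    have h2 : HasDerivAt (fun t => m * t - ρ / t) (m + ρ / t ^ 2) t := by
      convert! h1 using 1
      field_simp
      ring
    exact h2.hasDerivWithinAt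
  have hinj : Set.InjOn (fun t => m * t - ρ / t) (Set.Ioi 0) := by
    intro a ha b hb h
    simp only [Set.mem_Ioi] at ha hb
    have : (a - b) * (m + ρ / (a * b)) = 0 := by
      simp only at h
      field_simp at h ⊢
      linarith
    rcases mul_eq_zero.1 this with h | h
    · linarith
    · have : 0 < m + ρ / (a * b) := by positivity
      linarith
  have himg : (fun t => m * t - ρ / t) '' (Set.Ioi 0) = Set.univ := by
    ext u
    simp only [Set.mem_image, Set.mem_Ioi, Set.mem_univ, iff_true]
    have hs : 0 < √(u ^ 2 + 4 * m * ρ) := Real.sqrt_pos.2 (by positivity)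
    have hs2 : √(u ^ 2 + 4 * m * ρ) ^ 2 = u ^ 2 + 4 * m * ρ := Real.sq_sqrt (by positivity)
    have hgt : -u < √(u ^ 2 + 4 * m * ρ) := by
      apply lt_of_le_of_lt (neg_le_abs u)
      apply Real.lt_sqrt_of_sq_lt
      rw [sq_abs]
      have : 0 < m * ρ := by positivity
      linarith
    have hpos : 0 < (u + √(u ^ 2 + 4 * m * ρ)) / (2 * m) := by
      apply div_pos <;> linarith
    refine ⟨(u + √(u ^ 2 + 4 * m * ρ)) / (2 * m), hpos, ?_⟩
    set S := √(u ^ 2 + 4 * m * ρ)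
    have h3 : u + S ≠ 0 := by linarith
    have h4 : m * ((u + S) / (2 * m)) - ρ / ((u + S) / (2 * m)) = u + ((S ^ 2 - u ^ 2) - 4 * m * ρ) / (2 * (u + S)) := by
      field_simp
      ring
    rw [h4, hs2]
    ring
  have habs : ∀ t ∈ Set.Ioi (0:ℝ), |m + ρ / t ^ 2| = m + ρ / t ^ 2 := fun t ht => by
    simp only [Set.mem_Ioi] at ht
    exact abs_of_pos (by positivity)
  have e1 := integral_image_eq_integral_abs_deriv_smul measurableSet_Ioi hd hinj
    (fun u => Real.exp (-u ^ 2))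
  have i1 := (integrableOn_image_iff_integrableOn_abs_deriv_smul measurableSet_Ioi hd hinj
    (fun u => Real.exp (-u ^ 2))).1 (by
      rw [himg, integrableOn_univ]; simpa using integrable_exp_neg_mul_sq (b := 1) one_pos)
  rw [himg, setIntegral_univ] at e1
  have e1' : √Real.pi = ∫ t in Set.Ioi (0:ℝ), (m + ρ / t ^ 2) * Real.exp (-(m * t - ρ / t) ^ 2) := by
    have e1'' : ∫ (x : ℝ) in Set.Ioi 0, |m + ρ / x ^ 2| • Real.exp (-(m * x - ρ / x) ^ 2) =
      ∫ t in Set.Ioi (0:ℝ), (m + ρ / t ^ 2) * Real.exp (-(m * t - ρ / t) ^ 2) :=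
      setIntegral_congr_fun measurableSet_Ioi (fun t ht => by
        simp only [smul_eq_mul]; rw [habs t ht])
    rw [← e1'', ← e1]
    have := integral_gaussian 1
    simpa using this.symm
  have i1' : IntegrableOn (fun t => (m + ρ / t ^ 2) * Real.exp (-(m * t - ρ / t) ^ 2)) (Set.Ioi 0) := by
    refine i1.congr_fun (fun t ht => ?_) measurableSet_Ioi
    simp only [smul_eq_mul]; rw [habs t ht]
  have hmeas : Measurable (fun t : ℝ => Real.exp (-(m * t - ρ / t) ^ 2)) := by fun_prop
  have i2 : IntegrableOn (fun t => Real.exp (-(m * t - ρ / t) ^ 2)) (Set.Ioi 0) := by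
    refine Integrable.mono' (i1'.const_mul m⁻¹) hmeas.aestronglyMeasurable ?_
    refine (ae_restrict_iff' measurableSet_Ioi).2 (Filter.Eventually.of_forall fun t ht => ?_)
    simp only [Set.mem_Ioi] at ht
    rw [Real.norm_of_nonneg (by positivity), ← mul_assoc]
    apply le_mul_of_one_le_left (by positivity)
    rw [inv_mul_eq_div, le_div_iff₀ hm]
    have : 0 < ρ / t ^ 2 := by positivity
    linarith
  have i3 : IntegrableOn (fun t => (ρ / t ^ 2) * Real.exp (-(m * t - ρ / t) ^ 2)) (Set.Ioi 0) := by
    refine (i1'.sub (i2.const_mul m)).congr_fun (fun t ht => ?_) measurableSet_Ioi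
    simp only [Pi.sub_apply]
    ring
  -- second substitution
  have hd2 : ∀ t ∈ Set.Ioi (0:ℝ), HasDerivWithinAt (fun t => ρ / m / t) (-(ρ / m / t ^ 2)) (Set.Ioi 0) t := by
    intro t ht
    have ht' : t ≠ 0 := ne_of_gt ht
    have h1 := ((hasDerivAt_inv ht').const_mul (ρ / m))
    have h2 : HasDerivAt (fun t => ρ / m / t) (-(ρ / m / t ^ 2)) t := by
      convert! h1 using 1
      field_simp
    exact h2.hasDerivWithinAt
  have hinj2 : Set.InjOn (fun t => ρ / m / t) (Set.Ioi 0) := by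
    intro a ha b hb h
    simp only [Set.mem_Ioi] at ha hb
    simp only at h
    field_simp at h
    linarith
  have himg2 : (fun t => ρ / m / t) '' (Set.Ioi 0) = Set.Ioi 0 := by
    ext u
    simp only [Set.mem_image, Set.mem_Ioi]
    constructor
    · rintro ⟨t, ht, rfl⟩; positivity
    · intro hu
      refine ⟨ρ / m / u, by positivity, ?_⟩
      field_simp
  have e2 := integral_image_eq_integral_abs_deriv_smul measurableSet_Ioi hd2 hinj2
    (fun t : ℝ => Real.exp (-(m * t - ρ / t) ^ 2))
  rw [himg2] at e2
  have e2' : ∫ t in Set.Ioi (0:ℝ), Real.exp (-(m * t - ρ / t) ^ 2) =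
      m⁻¹ * ∫ t in Set.Ioi (0:ℝ), (ρ / t ^ 2) * Real.exp (-(m * t - ρ / t) ^ 2) := by
    rw [e2, ← integral_const_mul]
    refine setIntegral_congr_fun measurableSet_Ioi fun t ht => ?_
    simp only [Set.mem_Ioi] at ht
    simp only [smul_eq_mul, abs_neg]
    rw [abs_of_pos (by positivity)]
    have : m * (ρ / m / t) - ρ / (ρ / m / t) = -(m * t - ρ / t) := by
      field_simp
      ring
    rw [this, neg_sq]
    field_simp
  refine ⟨i2, ?_⟩
  have e3 : √Real.pi = m * (∫ t in Set.Ioi (0:ℝ), Real.exp (-(m * t - ρ / t) ^ 2)) +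
     ∫ t in Set.Ioi (0:ℝ), (ρ / t ^ 2) * Real.exp (-(m * t - ρ / t) ^ 2) := by
    rw [e1', ← integral_const_mul, ← integral_add (i2.const_mul m) i3]
    congr 1; ext t; ring
  set J := ∫ t in Set.Ioi (0:ℝ), Real.exp (-(m * t - ρ / t) ^ 2)
  set J' := ∫ t in Set.Ioi (0:ℝ), (ρ / t ^ 2) * Real.exp (-(m * t - ρ / t) ^ 2)
  have e4 : J' = m * J := by
    rw [e2']; field_simp
  rw [e4] at e3
  rw [e3]; field_simp; ring

theorem wl_glasser {m ρ : ℝ} (hm : 0 < m) (hρ : 0 ≤ ρ) :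
    ∫ s in Set.Ioi (0:ℝ), s ^ (-(1/2) : ℝ) * Real.exp (-(m ^ 2 * s) - ρ ^ 2 / s) =
      √Real.pi / m * Real.exp (-(2 * m * ρ)) := by
  rw [← integral_comp_rpow_Ioi (fun s => s ^ (-(1/2) : ℝ) * Real.exp (-(m ^ 2 * s) - ρ ^ 2 / s)) (p := 2) two_ne_zero]
  have h1 : ∀ t ∈ Set.Ioi (0:ℝ), (|(2:ℝ)| * t ^ ((2:ℝ) - 1)) • ((t ^ (2:ℝ)) ^ (-(1/2) : ℝ) *
      Real.exp (-(m ^ 2 * t ^ (2:ℝ)) - ρ ^ 2 / t ^ (2:ℝ))) =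
      2 * (Real.exp (-(m * t - ρ / t) ^ 2) * Real.exp (-(2 * m * ρ))) := by
    intro t ht
    simp only [Set.mem_Ioi] at ht
    rw [← Real.exp_add, ← Real.rpow_mul ht.le]
    have : (2:ℝ) * (-(1/2)) = -1 := by norm_num
    rw [this, Real.rpow_neg_one]
    have : (2:ℝ) - 1 = 1 := by norm_num
    rw [this, Real.rpow_one, Real.rpow_two, abs_of_pos two_pos, smul_eq_mul]
    have : -(m ^ 2 * t ^ 2) - ρ ^ 2 / t ^ 2 = -(m * t - ρ / t) ^ 2 + -(2 * m * ρ) := by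
      field_simp; ring
    rw [this]; field_simp
  rw [setIntegral_congr_fun measurableSet_Ioi h1, integral_const_mul, integral_mul_const]
  rcases hρ.eq_or_lt with rfl | hρ
  · have := integral_gaussian_Ioi (m ^ 2)
    simp only [mul_zero, neg_zero, Real.exp_zero, mul_one, zero_div, sub_zero, mul_pow]
    simp only [neg_mul] at this
    rw [this, Real.sqrt_div' _ (by positivity), Real.sqrt_sq hm.le]
    ring
  · rw [(wl_glasser_aux hm hρ).2]
    field_simp



section kernel
variable {E : Type*} [NormedAddCommGroup E] [InnerProductSpace ℝ E] [FiniteDimensional ℝ E]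
  [MeasurableSpace E] [BorelSpace E]

theorem wl_kernel_real_aux {m : ℝ} (hm : 0 < m) :
    Integrable (Function.uncurry (fun (ξ : E) (s : ℝ) =>
      s ^ (((Module.finrank ℝ E : ℝ) + 1) / 2 - 1) * Real.exp (-((m ^ 2 + ‖ξ‖ ^ 2) * s))))
      (volume.prod (volume.restrict (Set.Ioi (0:ℝ)))) := by
  set d : ℝ := (Module.finrank ℝ E : ℝ) with hd
  rw [integrable_prod_iff']
  · constructor
    · filter_upwards [ae_restrict_mem measurableSet_Ioi] with s hs
      simp only [Set.mem_Ioi] at hs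
      simp only [Function.uncurry]
      apply Integrable.const_mul
      have h := (GaussianFourier.integrable_cexp_neg_mul_sq_norm_add (V := E) (b := (s : ℂ))
        (by simpa using hs) 0 0).norm
      have h2 := h.const_mul (Real.exp (-(m ^ 2 * s)))
      refine h2.congr (Filter.Eventually.of_forall fun v => ?_)
      simp only [Complex.norm_exp]
      rw [← Real.exp_add]
      congr 1
      have : (-(s:ℂ) * (‖v‖ : ℂ) ^ 2 + 0 * ((inner ℝ (0:E) v : ℝ) : ℂ)) = ((-s * ‖v‖ ^ 2 : ℝ) : ℂ) := by
        push_cast; ring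
      rw [this, Complex.ofReal_re]; ring
    · have h1 : IntegrableOn (fun s : ℝ => Real.pi ^ (d / 2) * (s ^ (-(1/2):ℝ) * Real.exp (-(m ^ 2) * s ^ (1:ℝ)))) (Set.Ioi 0) :=
        (integrableOn_rpow_mul_exp_neg_mul_rpow (by norm_num) (by norm_num) (by positivity)).const_mul _
      refine h1.congr ?_
      filter_upwards [ae_restrict_mem measurableSet_Ioi] with s hs
      simp only [Set.mem_Ioi] at hs
      have : ∀ ξ : E, ‖Function.uncurry (fun (ξ : E) (s : ℝ) =>
        s ^ ((d + 1) / 2 - 1) * Real.exp (-((m ^ 2 + ‖ξ‖ ^ 2) * s))) (ξ, s)‖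
          = (s ^ ((d + 1) / 2 - 1) * Real.exp (-(m ^ 2 * s))) * Real.exp (-s * ‖ξ‖ ^ 2) := by
        intro ξ
        simp only [Function.uncurry]
        rw [Real.norm_of_nonneg (by positivity), mul_assoc, ← Real.exp_add]
        congr 2; ring
      simp_rw [this]
      rw [integral_const_mul, GaussianFourier.integral_rexp_neg_mul_sq_norm hs,
        Real.div_rpow Real.pi_pos.le hs.le, Real.rpow_one]
      have : s ^ (-(1/2):ℝ) = s ^ ((d + 1) / 2 - 1) / s ^ (d / 2) := by
        rw [← Real.rpow_sub hs]; congr 1; ring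
      rw [this, neg_mul]; ring
  · apply Measurable.aestronglyMeasurable
    fun_prop

theorem wl_kernel_real {m : ℝ} (hm : 0 < m) (x : E) :
    ∫ ξ : E, cexp (2 * Real.pi * inner ℝ ξ x * I) *
      (((m ^ 2 + ‖ξ‖ ^ 2) ^ (-(((Module.finrank ℝ E : ℝ) + 1) / 2)) : ℝ) : ℂ) =
      ((Real.pi ^ (((Module.finrank ℝ E : ℝ) + 1) / 2) / Real.Gamma (((Module.finrank ℝ E : ℝ) + 1) / 2) / m
        * Real.exp (-(2 * Real.pi * m * ‖x‖)) : ℝ) : ℂ) := by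
  have hintg := wl_kernel_real_aux (E := E) hm
  set d : ℝ := (Module.finrank ℝ E : ℝ) with hd
  have hd0 : 0 ≤ d := by positivity
  set q : ℝ := (d + 1) / 2 with hq
  have hq0 : 0 < q := by positivity
  have hG : 0 < Real.Gamma q := Real.Gamma_pos_of_pos hq0
  have h1 : ∀ ξ : E, cexp (2 * Real.pi * inner ℝ ξ x * I) * (((m ^ 2 + ‖ξ‖ ^ 2) ^ (-q) : ℝ) : ℂ)
      = (Real.Gamma q : ℂ)⁻¹ * ∫ s in Set.Ioi (0:ℝ), cexp (2 * Real.pi * inner ℝ ξ x * I) *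
        ((s ^ (q - 1) * Real.exp (-((m ^ 2 + ‖ξ‖ ^ 2) * s)) : ℝ) : ℂ) := by
    intro ξ
    rw [integral_const_mul, integral_complex_ofReal, Real.integral_rpow_mul_exp_neg_mul_Ioi hq0 (by positivity)]
    rw [one_div, Real.inv_rpow (by positivity), ← Real.rpow_neg (by positivity)]
    have : (Real.Gamma q : ℂ) ≠ 0 := by exact_mod_cast hG.ne'
    push_cast
    field_simp
  simp_rw [h1]
  rw [integral_const_mul, integral_integral_swap]
  · have h2 : ∀ s ∈ Set.Ioi (0:ℝ), ∫ ξ : E, cexp (2 * Real.pi * inner ℝ ξ x * I) *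
        ((s ^ (q - 1) * Real.exp (-((m ^ 2 + ‖ξ‖ ^ 2) * s)) : ℝ) : ℂ) =
        ((Real.pi ^ (d / 2) * (s ^ (-(1/2):ℝ) * Real.exp (-(m ^ 2 * s) - (Real.pi * ‖x‖) ^ 2 / s)) : ℝ) : ℂ) := by
      intro s hs
      simp only [Set.mem_Ioi] at hs
      have h3 := fourier_gaussian_innerProductSpace (V := E) (b := (s:ℂ)) (by simpa using hs) (-x)
      rw [← Real.fourierInv_eq_fourier_neg, Real.fourierInv_eq'] at h3
      have h4 : ∀ ξ : E, cexp (2 * Real.pi * inner ℝ ξ x * I) *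
        ((s ^ (q - 1) * Real.exp (-((m ^ 2 + ‖ξ‖ ^ 2) * s)) : ℝ) : ℂ) =
        ((s ^ (q - 1) * Real.exp (-(m ^ 2 * s)) : ℝ) : ℂ) * (cexp (↑(2 * Real.pi * inner ℝ ξ x) * I) • cexp (-s * (‖ξ‖:ℂ) ^ 2)) := by
        intro ξ
        have : Real.exp (-((m ^ 2 + ‖ξ‖ ^ 2) * s)) = Real.exp (-(m^2*s)) * Real.exp (-s * ‖ξ‖^2) := by
          rw [← Real.exp_add]; congr 1; ring
        rw [this]
        push_cast
        rw [smul_eq_mul]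
        ring
      simp_rw [h4]
      rw [integral_const_mul, h3]
      have h5 : ((Real.pi : ℂ) / s) ^ ((Module.finrank ℝ E : ℂ) / 2) = (((Real.pi / s) ^ (d / 2) : ℝ) : ℂ) := by
        rw [Complex.ofReal_cpow (by positivity)]; simp [hd]
      have h6 : cexp (-(Real.pi:ℂ) ^ 2 * (‖-x‖:ℂ) ^ 2 / s) = ((Real.exp (- ((Real.pi * ‖x‖) ^ 2 / s)) : ℝ) : ℂ) := by
        push_cast
        rw [norm_neg]
        congr 1; ring
      rw [h5, h6, ← Complex.ofReal_mul, ← Complex.ofReal_mul]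
      congr 1
      have : s ^ (-(1/2):ℝ) = s ^ (q - 1) / s ^ (d / 2) := by
        rw [← Real.rpow_sub hs]; congr 1; rw [hq]; ring
      rw [this, Real.div_rpow Real.pi_pos.le hs.le, sub_eq_add_neg (-(m ^ 2 * s)), Real.exp_add]
      ring
    rw [setIntegral_congr_fun measurableSet_Ioi h2, integral_complex_ofReal, integral_const_mul,
      wl_glasser hm (by positivity)]
    have : Real.pi ^ q = Real.pi ^ (d/2) * √Real.pi := by
      rw [Real.sqrt_eq_rpow, ← Real.rpow_add Real.pi_pos]; congr 1; rw [hq]; ring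
    rw [this, ← Complex.ofReal_inv, ← Complex.ofReal_mul]
    congr 1
    have : Real.exp (-(2 * m * (Real.pi * ‖x‖))) = Real.exp (-(2 * Real.pi * m * ‖x‖)) := by congr 1; ring
    rw [this]
    field_simp
  · have h7 := hintg.ofReal (𝕜 := ℂ)
    refine Integrable.mono h7 ?_ (Filter.Eventually.of_forall ?_)
    · apply Measurable.aestronglyMeasurable
      unfold Function.uncurry
      fun_prop
    · rintro ⟨ξ, s⟩
      simp only [Function.uncurry]
      rw [norm_mul]
      have : ‖cexp (2 * Real.pi * inner ℝ ξ x * I)‖ = 1 := by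
        have := Complex.norm_exp_ofReal_mul_I (2 * Real.pi * inner ℝ ξ x)
        push_cast at this; exact this
      rw [this, one_mul]
      exact le_rfl

end kernel


theorem wl_slit {μ : ℂ} (hμ : 0 < μ.re) (r : ℝ) : μ ^ 2 + (r:ℂ) ^ 2 ∈ slitPlane := by
  rw [mem_slitPlane_iff]
  by_cases h : μ.im = 0
  · left
    simp [pow_two, h]
    nlinarith [mul_self_nonneg r, mul_pos hμ hμ]
  · right
    simp [pow_two]
    intro h2
    have : μ.re * μ.im = 0 := by linarith
    rcases mul_eq_zero.1 this with h3 | h3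
    · exact hμ.ne' h3
    · exact h h3

theorem wl_lower {μ : ℂ} {c K r : ℝ} (hc : 0 < c) (hμ : c ≤ μ.re) (hK : ‖μ‖ ≤ K) (hr : 0 ≤ r) :
    1 + r ^ 2 ≤ ((1 + K) / c + 1) ^ 2 * ‖μ ^ 2 + (r:ℂ) ^ 2‖ := by
  have hK0 : 0 ≤ K := (norm_nonneg _).trans hK
  have hf : μ ^ 2 + (r:ℂ) ^ 2 = (μ + I * r) * (μ - I * r) := by
    ring_nf; simp
  have key : ∀ ν : ℂ, c ≤ ν.re → r - K ≤ ‖ν‖ → 1 + r ≤ ((1 + K) / c + 1) * ‖ν‖ := by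
    intro ν h1 h2
    have h3 : c ≤ ‖ν‖ := h1.trans (re_le_norm ν)
    have h4 : (1 + K) ≤ (1 + K) / c * ‖ν‖ := by
      rw [div_mul_eq_mul_div, le_div_iff₀ hc]
      exact mul_le_mul_of_nonneg_left h3 (by positivity)
    linarith
  have hir : ‖I * (r:ℂ)‖ = r := by simp [abs_of_nonneg hr]
  have k1 := key (μ + I * r) (by simpa using hμ) (by
    have := norm_sub_norm_le (I * (r:ℂ)) (-μ)
    rw [hir, norm_neg, sub_neg_eq_add, add_comm] at this
    linarith)
  have k2 := key (μ - I * r) (by simpa using hμ) (by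
    have := norm_sub_norm_le (I * (r:ℂ)) (μ)
    rw [hir, norm_sub_rev] at this
    linarith)
  rw [hf, norm_mul]
  have := mul_le_mul k1 k2 (by positivity) (by positivity)
  nlinarith

section kernel
variable {E : Type*} [NormedAddCommGroup E] [InnerProductSpace ℝ E] [FiniteDimensional ℝ E]
  [MeasurableSpace E] [BorelSpace E]

theorem wl_norm_h {μ : ℂ} {c K : ℝ} (hc : 0 < c) (hμ : c ≤ μ.re) (hK : ‖μ‖ ≤ K) {q : ℝ} (hq : 0 ≤ q) (ξ : E) :
    ‖(μ ^ 2 + (‖ξ‖:ℂ) ^ 2) ^ (-(q:ℂ))‖ ≤ (((1 + K) / c + 1) ^ 2) ^ q * (1 + ‖ξ‖ ^ 2) ^ (-q) := by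
  have hK0 : 0 ≤ K := (norm_nonneg _).trans hK
  have h1 := wl_lower hc hμ hK (norm_nonneg ξ)
  rw [← Complex.ofReal_neg, Complex.norm_cpow_real]
  have hpos : 0 < ‖μ ^ 2 + (‖ξ‖:ℂ) ^ 2‖ := norm_pos_iff.2 (slitPlane_ne_zero (wl_slit (hc.trans_le hμ) _))
  rw [Real.rpow_neg hpos.le, Real.rpow_neg (by positivity), ← div_eq_mul_inv, le_div_iff₀ (by positivity),
    mul_comm, ← div_eq_mul_inv, div_le_iff₀ (by positivity), ← Real.mul_rpow (by positivity) hpos.le]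
  exact Real.rpow_le_rpow (by positivity) h1 hq

theorem wl_measurable_h (μ : ℂ) (q : ℂ) : Measurable (fun ξ : E => (μ ^ 2 + (‖ξ‖:ℂ) ^ 2) ^ q) := by
  fun_prop

theorem wl_integrable_h {μ : ℂ} (hμ : 0 < μ.re) :
    Integrable (fun ξ : E => (μ ^ 2 + (‖ξ‖:ℂ) ^ 2) ^ (-((((Module.finrank ℝ E : ℝ) + 1) / 2 : ℝ) : ℂ))) := by
  have h := (integrable_rpow_neg_one_add_norm_sq (E := E) (μ := volume) (r := (Module.finrank ℝ E : ℝ) + 1) (by linarith)).const_mul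
    ((((1 + ‖μ‖) / μ.re + 1) ^ 2) ^ (((Module.finrank ℝ E : ℝ) + 1) / 2))
  refine h.mono' (wl_measurable_h _ _).aestronglyMeasurable (Filter.Eventually.of_forall fun ξ => ?_)
  have := wl_norm_h hμ le_rfl le_rfl (q := ((Module.finrank ℝ E : ℝ) + 1) / 2) (by positivity) ξ
  rwa [← neg_div] at this

theorem wl_kernel_diff (x : E) : DifferentiableOn ℂ (fun μ : ℂ => ∫ ξ : E, cexp (2 * Real.pi * inner ℝ ξ x * I) *
      (μ ^ 2 + (‖ξ‖:ℂ) ^ 2) ^ (-((((Module.finrank ℝ E : ℝ) + 1) / 2 : ℝ) : ℂ))) {μ | 0 < μ.re} := by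
  intro μ₀ hμ₀
  simp only [Set.mem_ofPred_eq] at hμ₀
  set q : ℝ := ((Module.finrank ℝ E : ℝ) + 1) / 2 with hq
  have hq0 : 0 ≤ q := by positivity
  set c := μ₀.re / 2 with hc
  have hc0 : 0 < c := by positivity
  set K := ‖μ₀‖ + c with hK
  have hnb : ∀ μ ∈ ball μ₀ c, c ≤ μ.re ∧ ‖μ‖ ≤ K := by
    intro μ hμ
    rw [mem_ball, dist_eq_norm] at hμ
    have h1 := (abs_re_le_norm (μ - μ₀)).trans hμ.le
    rw [sub_re, abs_le] at h1
    constructor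
    · linarith [h1.1]
    · have := norm_sub_norm_le μ μ₀
      linarith
  have hexp : ∀ ξ : E, ‖cexp (2 * Real.pi * inner ℝ ξ x * I)‖ = 1 := by
    intro ξ
    have := Complex.norm_exp_ofReal_mul_I (2 * Real.pi * inner ℝ ξ x)
    push_cast at this; exact this
  set B := (((1 + K) / c + 1) ^ 2) with hB
  have hintg := (integrable_rpow_neg_one_add_norm_sq (E := E) (μ := volume) (r := (Module.finrank ℝ E : ℝ) + 1) (by linarith))
  have hintg' : Integrable (fun ξ : E => (1 + ‖ξ‖ ^ 2) ^ (-q)) := by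
    simpa only [neg_div] using hintg
  have := hasDerivAt_integral_of_dominated_loc_of_deriv_le (μ := (volume : Measure E)) (𝕜 := ℂ)
    (F := fun μ ξ => cexp (2 * Real.pi * inner ℝ ξ x * I) * (μ ^ 2 + (‖ξ‖:ℂ) ^ 2) ^ (-(q : ℂ)))
    (F' := fun μ ξ => cexp (2 * Real.pi * inner ℝ ξ x * I) * ((-(q:ℂ)) * (μ ^ 2 + (‖ξ‖:ℂ) ^ 2) ^ (-((q + 1 : ℝ) : ℂ)) * (2 * μ)))
    (x₀ := μ₀) (s := ball μ₀ c) (bound := fun ξ => (q * B ^ (q+1) * (2 * K)) * (1 + ‖ξ‖ ^ 2) ^ (-q))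
    (ball_mem_nhds _ hc0) ?_ ?_ ?_ ?_ ?_ ?_
  · exact this.2.differentiableAt.differentiableWithinAt
  · refine Filter.Eventually.of_forall fun μ => ?_
    apply Measurable.aestronglyMeasurable
    fun_prop
  · have h := wl_integrable_h (E := E) hμ₀
    refine h.mono (Measurable.aestronglyMeasurable (by fun_prop)) (Filter.Eventually.of_forall fun ξ => ?_)
    rw [norm_mul, hexp, one_mul]
  · apply Measurable.aestronglyMeasurable
    fun_prop
  · refine Filter.Eventually.of_forall fun ξ μ hμ => ?_
    obtain ⟨h1, h2⟩ := hnb μ hμ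
    have h3 := wl_norm_h hc0 h1 h2 (q := q + 1) (by positivity) ξ
    have h4 : (1 + ‖ξ‖ ^ 2) ^ (-(q+1)) ≤ (1 + ‖ξ‖ ^ 2) ^ (-q) :=
      Real.rpow_le_rpow_of_exponent_le (by nlinarith [norm_nonneg ξ]) (by linarith)
    have hK0 : 0 ≤ K := by positivity
    rw [norm_mul, hexp, one_mul, norm_mul, norm_mul, norm_neg, norm_mul]
    simp only [Complex.norm_real, Real.norm_of_nonneg hq0, Complex.norm_ofNat]
    calc q * _ * (2 * ‖μ‖) ≤ q * (B ^ (q + 1) * (1 + ‖ξ‖ ^ 2) ^ (-q)) * (2 * K) := by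
          gcongr
          exact h3.trans (by gcongr)
      _ = _ := by ring
  · exact hintg'.const_mul _
  · refine Filter.Eventually.of_forall fun ξ μ hμ => ?_
    obtain ⟨h1, h2⟩ := hnb μ hμ
    apply HasDerivAt.const_mul
    have h3 : HasDerivAt (fun μ : ℂ => μ ^ 2 + (‖ξ‖:ℂ) ^ 2) (2 * μ) μ := by
      simpa using (hasDerivAt_pow 2 μ).add_const ((‖ξ‖:ℂ) ^ 2)
    have h4 := h3.cpow_const (c := -(q:ℂ)) (wl_slit (hc0.trans_le h1) _)
    convert! h4 using 3
    push_cast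
    ring_nf

theorem wl_kernel (x : E) {μ : ℂ} (hμ : 0 < μ.re) :
    ∫ ξ : E, cexp (2 * Real.pi * inner ℝ ξ x * I) *
      (μ ^ 2 + (‖ξ‖:ℂ) ^ 2) ^ (-((((Module.finrank ℝ E : ℝ) + 1) / 2 : ℝ) : ℂ)) =
      ((Real.pi ^ (((Module.finrank ℝ E : ℝ) + 1) / 2) / Real.Gamma (((Module.finrank ℝ E : ℝ) + 1) / 2) : ℝ) : ℂ) / μ
        * cexp (-(2 * Real.pi * μ * ‖x‖)) := by
  have hU : IsOpen {μ : ℂ | 0 < μ.re} := isOpen_lt continuous_const continuous_re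
  have h1 := (wl_kernel_diff x).analyticOnNhd hU
  set q : ℝ := ((Module.finrank ℝ E : ℝ) + 1) / 2 with hq
  have h2 : DifferentiableOn ℂ (fun μ : ℂ => ((Real.pi ^ q / Real.Gamma q : ℝ) : ℂ) / μ
        * cexp (-(2 * Real.pi * μ * ‖x‖))) {μ : ℂ | 0 < μ.re} := by
    intro μ hμ
    have : μ ≠ 0 := by rintro rfl; simp at hμ
    exact (((differentiableAt_const _).div differentiableAt_id this).mul (by fun_prop)).differentiableWithinAt
  have h3 := h2.analyticOnNhd hU
  have hconn : IsPreconnected {μ : ℂ | 0 < μ.re} := (convex_halfSpace_re_gt 0).isPreconnected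
  refine h1.eqOn_of_preconnected_of_frequently_eq h3 hconn (z₀ := 1) (by simp) ?_ hμ
  have hev : ∃ᶠ m : ℝ in nhdsWithin 1 {1}ᶜ, 0 < m := by
    apply Filter.Eventually.frequently
    exact (nhdsWithin_le_nhds) (lt_mem_nhds one_pos)
  have ht : Filter.Tendsto (fun m : ℝ => (m : ℂ)) (nhdsWithin 1 {1}ᶜ) (nhdsWithin 1 {1}ᶜ) := by
    apply tendsto_nhdsWithin_of_tendsto_nhds_of_eventually_within
    · exact (Complex.continuous_ofReal.tendsto' 1 1 (by simp)).mono_left nhdsWithin_le_nhds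
    · filter_upwards [self_mem_nhdsWithin] with m hm
      simpa using hm
  refine ht.frequently (hev.mono fun m hm => ?_)
  have h4 := wl_kernel_real hm x
  rw [← hq] at h4
  have h5 : ∀ ξ : E, ((m:ℂ) ^ 2 + (‖ξ‖:ℂ) ^ 2) ^ (-(q:ℂ)) = (((m ^ 2 + ‖ξ‖ ^ 2) ^ (-q) : ℝ) : ℂ) := by
    intro ξ
    rw [Complex.ofReal_cpow (by positivity)]
    push_cast; rfl
  simp_rw [h5]
  rw [h4]
  push_cast
  ring_nf

end kernel


section kernel
variable {E : Type*} [NormedAddCommGroup E] [InnerProductSpace ℝ E] [FiniteDimensional ℝ E]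
  [MeasurableSpace E] [BorelSpace E]

theorem wl_norm_e (t : ℝ) : ‖cexp (2 * Real.pi * t * I)‖ = 1 := by
  have := Complex.norm_exp_ofReal_mul_I (2 * Real.pi * t)
  push_cast at this; exact this

variable (E) in
def wlc : ℝ := Real.pi ^ (((Module.finrank ℝ E : ℝ) + 1) / 2) / Real.Gamma (((Module.finrank ℝ E : ℝ) + 1) / 2)

variable (E) in
theorem wlc_pos : 0 < wlc E := by
  unfold wlc
  have : 0 < Real.Gamma (((Module.finrank ℝ E : ℝ) + 1) / 2) := Real.Gamma_pos_of_pos (by positivity)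
  have := Real.pi_pos
  positivity

/-- the convolution kernel -/
def wlk (μ : ℂ) (x : E) : ℂ := (wlc E : ℂ) / μ * cexp (-(2 * Real.pi * μ * ‖x‖))

theorem wl_T_eq {μ : ℂ} (hμ : 0 < μ.re) {f : E → ℂ} (hf : Integrable f) (x : E) :
    ∫ ξ : E, cexp (2 * Real.pi * inner ℝ ξ x * I) *
      ((μ ^ 2 + (‖ξ‖:ℂ) ^ 2) ^ (-((((Module.finrank ℝ E : ℝ) + 1) / 2 : ℝ) : ℂ)) * 𝓕 f ξ) =
    ∫ y, wlk μ (x - y) * f y := by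
  have hh : Integrable (fun ξ : E => cexp (2 * Real.pi * inner ℝ ξ x * I) *
      (μ ^ 2 + (‖ξ‖:ℂ) ^ 2) ^ (-((((Module.finrank ℝ E : ℝ) + 1) / 2 : ℝ) : ℂ))) := by
    refine (wl_integrable_h (E := E) hμ).mono (Measurable.aestronglyMeasurable (by fun_prop)) (Filter.Eventually.of_forall fun ξ => ?_)
    rw [norm_mul, wl_norm_e, one_mul]
  have := wl_fourier_swap hf hh
  rw [show (∫ ξ : E, cexp (2 * Real.pi * inner ℝ ξ x * I) *
      ((μ ^ 2 + (‖ξ‖:ℂ) ^ 2) ^ (-((((Module.finrank ℝ E : ℝ) + 1) / 2 : ℝ) : ℂ)) * 𝓕 f ξ)) =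
      ∫ ξ : E, 𝓕 f ξ * (cexp (2 * Real.pi * inner ℝ ξ x * I) *
      (μ ^ 2 + (‖ξ‖:ℂ) ^ 2) ^ (-((((Module.finrank ℝ E : ℝ) + 1) / 2 : ℝ) : ℂ))) from by
      congr 1; ext ξ; ring]
  rw [this]
  congr 1
  ext y
  rw [mul_comm]
  congr 1
  rw [Real.fourier_eq']
  have hk := wl_kernel (x - y) hμ
  unfold wlk wlc
  rw [← hk]
  congr 1
  ext ξ
  rw [smul_eq_mul, ← mul_assoc, ← Complex.exp_add]
  congr 2
  rw [inner_sub_right]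
  push_cast
  ring

theorem wl_real_beta {M b : ℝ} (hM : 1 ≤ M) (hb : 0 < b) :
    IntegrableOn (fun y : ℝ => y ^ (M - 1) * (b + y) ^ (-(M + 1))) (Set.Ioi 0) := by
  refine integrableOn_Ioi_deriv_of_nonneg (a := 0) (l := 1 / (M * b))
    (g := fun y => (y ^ M * (b + y) ^ (-M)) / (M * b)) ?_ ?_ ?_ ?_
  · apply ContinuousAt.continuousWithinAt
    apply ContinuousAt.div_const
    apply ContinuousAt.mul
    · exact Real.continuousAt_rpow_const _ _ (Or.inr (by linarith))
    · exact (continuousAt_const.add continuousAt_id).rpow_const (Or.inl (by simp; exact hb.ne'))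
  · intro y hy
    simp only [Set.mem_Ioi] at hy
    have hby : 0 < b + y := by linarith
    have h1 := Real.hasDerivAt_rpow_const (x := y) (p := M) (Or.inl hy.ne')
    have h2 := ((hasDerivAt_id y).const_add b).rpow_const (p := -M) (Or.inl (by simpa using hby.ne'))
    have h3 := (h1.mul h2).div_const (M * b)
    simp only [id] at h3
    convert! h3 using 1
    have e1 : y ^ M = y * y ^ (M - 1) := by
      rw [← Real.rpow_one_add' hy.le (by linarith)]; congr 1; ring
    have e2 : (b + y) ^ (-M) = (b + y) * (b + y) ^ (-(M+1)) := by
      rw [← Real.rpow_one_add' hby.le (by linarith)]; congr 1; ring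
    have e3 : (-M - 1) = -(M + 1) := by ring
    rw [e1, e2, e3]
    field_simp
    ring
  · intro y hy
    simp only [Set.mem_Ioi] at hy
    positivity
  · apply Filter.Tendsto.div_const
    have h1 : Filter.Tendsto (fun y : ℝ => (1 - b / (b + y)) ^ M) Filter.atTop (nhds 1) := by
      have : Filter.Tendsto (fun y : ℝ => 1 - b / (b + y)) Filter.atTop (nhds (1 - 0)) :=
        (tendsto_const_nhds).sub (Filter.Tendsto.div_atTop tendsto_const_nhds (Filter.tendsto_atTop_add_const_left _ _ Filter.tendsto_id))
      have := this.rpow_const (p := M) (Or.inl (by norm_num))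
      simpa using this
    refine h1.congr' ?_
    filter_upwards [Filter.eventually_gt_atTop 0] with y hy
    have hby : 0 < b + y := by linarith
    rw [Real.rpow_neg hby.le, ← div_eq_mul_inv, ← Real.div_rpow hy.le hby.le]
    congr 1
    field_simp
    ring

theorem wl_abs_im_le {A : ℂ} {b : ℝ} (hA : A.im = -b) (hb : 0 < b) {y : ℝ} (hy : 0 ≤ y) :
    b + y ≤ ‖A - I * y‖ := by
  have := abs_im_le_norm (A - I * y)
  simp [hA] at this
  rw [abs_of_nonpos (by linarith)] at this
  linarith

theorem wl_norm_beta {A : ℂ} {b M : ℝ} (hA : A.im = -b) (hb : 0 < b) (hM : 1 ≤ M) {y : ℝ} (hy : 0 < y) :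
    ‖((y ^ (M - 1) : ℝ) : ℂ) * (A - I * y) ^ (-((M + 1 : ℝ) : ℂ))‖ ≤ y ^ (M - 1) * (b + y) ^ (-(M + 1)) := by
  rw [norm_mul, ← Complex.ofReal_neg, Complex.norm_cpow_real, Complex.norm_real, Real.norm_of_nonneg (by positivity)]
  exact mul_le_mul_of_nonneg_left
    (Real.rpow_le_rpow_of_nonpos (by linarith : 0 < b + y) (wl_abs_im_le hA hb hy.le) (by linarith)) (by positivity)

theorem wl_complex_beta {A : ℂ} {b M : ℝ} (hA : A.im = -b) (hb : 0 < b) (hM : 1 ≤ M) :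
    ∫ y in Set.Ioi (0:ℝ), ((y ^ (M - 1) : ℝ) : ℂ) * (A - I * y) ^ (-((M + 1 : ℝ) : ℂ)) =
      (-I) ^ (-(M:ℂ)) / (M * A) := by
  have hA0 : A ≠ 0 := by rintro rfl; simp at hA; linarith
  have hM0 : (M:ℂ) ≠ 0 := by exact_mod_cast (by linarith : M ≠ 0)
  have hslit : ∀ y : ℝ, 0 ≤ y → A - I * y ∈ slitPlane := by
    intro y hy
    rw [mem_slitPlane_iff]; right
    simp [hA]; linarith
  have key := integral_Ioi_of_hasDerivAt_of_tendsto (a := 0) (m := (-I) ^ (-(M:ℂ)) / (M * A))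
    (f := fun y : ℝ => ((y ^ M : ℝ) : ℂ) * (A - I * y) ^ (-(M : ℂ)) / (M * A))
    (f' := fun y : ℝ => ((y ^ (M - 1) : ℝ) : ℂ) * (A - I * y) ^ (-((M + 1 : ℝ) : ℂ))) ?_ ?_ ?_ ?_
  · rw [key]
    have : (0:ℝ) ^ M = 0 := Real.zero_rpow (by linarith)
    simp [this]
  · apply ContinuousAt.continuousWithinAt
    apply ContinuousAt.div_const
    apply ContinuousAt.mul
    · exact Complex.continuous_ofReal.continuousAt.comp (Real.continuousAt_rpow_const _ _ (Or.inr (by linarith)))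
    · apply ContinuousAt.cpow
      · fun_prop
      · fun_prop
      · exact hslit 0 le_rfl
  · intro y hy
    simp only [Set.mem_Ioi] at hy
    have h1 := (Real.hasDerivAt_rpow_const (x := y) (p := M) (Or.inl hy.ne')).ofReal_comp
    have h2 : HasDerivAt (fun y : ℝ => A - I * (y:ℂ)) (-I) y := by
      have := (((hasDerivAt_id y).ofReal_comp).const_mul I).const_sub A
      simpa using this
    have h3 : HasDerivAt (fun y : ℝ => (A - I * (y:ℂ)) ^ (-(M:ℂ))) (-(M:ℂ) * (A - I * y) ^ (-(M:ℂ) - 1) * (-I)) y := by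
      have h4 := (((hasDerivAt_id (A - I * (y:ℂ))).cpow_const (c := -(M:ℂ)) (hslit y hy.le)))
      have := h4.comp y h2
      simpa [Function.comp_def] using this
    have h4 := (h1.mul h3).div_const (M * A)
    convert! h4 using 1
    have hne := slitPlane_ne_zero (hslit y hy.le)
    have e1 : ((y ^ M : ℝ) : ℂ) = y * ((y ^ (M - 1) : ℝ) : ℂ) := by
      rw [← Complex.ofReal_mul, ← Real.rpow_one_add' hy.le (by linarith)]; congr 2; ring
    have e2 : (A - I * y) ^ (-(M:ℂ)) = (A - I * y) * (A - I * y) ^ (-((M + 1 : ℝ) : ℂ)) := by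
      conv_rhs => rw [← Complex.cpow_one (A - I * y), Complex.cpow_one (A - I * y)]
      rw [show -(M:ℂ) = 1 + -((M + 1 : ℝ) : ℂ) by push_cast; ring, Complex.cpow_add _ _ hne, Complex.cpow_one]
    have e3 : (-(M:ℂ) - 1) = -((M + 1 : ℝ) : ℂ) := by push_cast; ring
    rw [e1, e2, e3]
    push_cast
    field_simp
    ring
  · refine (wl_real_beta hM hb).mono' ?_ ?_
    · apply Measurable.aestronglyMeasurable
      fun_prop
    · filter_upwards [ae_restrict_mem measurableSet_Ioi] with y hy
      exact wl_norm_beta hA hb hM hy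
  · apply Filter.Tendsto.div_const
    have h1 : Filter.Tendsto (fun y : ℝ => (A / y - I) ^ (-(M:ℂ))) Filter.atTop (nhds ((-I) ^ (-(M:ℂ)))) := by
      have h0 : Filter.Tendsto (fun y : ℝ => A / (y:ℂ) - I) Filter.atTop (nhds (0 - I)) := by
        apply Filter.Tendsto.sub_const
        have : Filter.Tendsto (fun y : ℝ => A * ((y⁻¹ : ℝ) : ℂ)) Filter.atTop (nhds (A * ((0:ℝ) : ℂ))) :=
          ((Complex.continuous_ofReal.tendsto 0).comp tendsto_inv_atTop_zero).const_mul A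
        simpa [div_eq_mul_inv] using this
      rw [zero_sub] at h0
      refine Filter.Tendsto.cpow h0 tendsto_const_nhds ?_
      rw [mem_slitPlane_iff]; right; simp
    refine h1.congr' ?_
    filter_upwards [Filter.eventually_gt_atTop 0] with y hy
    have e1 : ((y ^ M : ℝ) : ℂ) = ((y⁻¹ : ℝ):ℂ) ^ (-(M:ℂ)) := by
      rw [← Complex.ofReal_neg, ← Complex.ofReal_cpow (by positivity), Real.inv_rpow hy.le, Real.rpow_neg hy.le, inv_inv]
    rw [e1]
    have hyc : (y:ℂ) ≠ 0 := by exact_mod_cast hy.ne'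
    have e2 : A / y - I = ((y⁻¹ : ℝ):ℂ) * (A - I * y) := by
      push_cast; field_simp
    rw [e2]
    have hne := slitPlane_ne_zero (hslit y hy.le)
    have hyi : 0 < y⁻¹ := by positivity
    have hyi' : ((y⁻¹ : ℝ):ℂ) ≠ 0 := by exact_mod_cast hyi.ne'
    rw [Complex.cpow_def_of_ne_zero hyi', Complex.cpow_def_of_ne_zero hne,
      Complex.cpow_def_of_ne_zero (mul_ne_zero hyi' hne), Complex.log_ofReal_mul hyi hne, ← Complex.exp_add,
      Complex.ofReal_log hyi.le]
    ring_nf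
end kernel


def wlmu (a Y : ℝ) : ℂ := (-(a:ℂ) - I * Y) ^ ((1 / 2 : ℂ))

theorem wlmu_sq (a Y : ℝ) : wlmu a Y ^ 2 = -(a:ℂ) - I * Y := by
  unfold wlmu
  rw [one_div]
  exact Complex.cpow_ofNat_inv_pow _ 2

theorem wlmu_re_pos {a Y : ℝ} (hY : 0 < Y) : 0 < (wlmu a Y).re := by
  unfold wlmu
  have hne : (-(a:ℂ) - I * Y) ≠ 0 := by
    intro h
    have := congrArg Complex.im h
    simp at this
    linarith
  rw [Complex.cpow_def_of_ne_zero hne, Complex.exp_re]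
  apply mul_pos (Real.exp_pos _)
  have him : (Complex.log (-(a:ℂ) - I * Y) * (1 / 2)).im = arg (-(a:ℂ) - I * Y) / 2 := by
    rw [show Complex.log (-(a:ℂ) - I * Y) * (1 / 2) = ((1/2 : ℝ) : ℂ) * Complex.log (-(a:ℂ) - I * Y) by push_cast; ring,
      Complex.im_ofReal_mul, Complex.log_im]
    ring
  rw [him]
  apply Real.cos_pos_of_mem_Ioo
  have h1 := Complex.neg_pi_lt_arg (-(a:ℂ) - I * Y)
  have h2 : arg (-(a:ℂ) - I * Y) < 0 := by
    rw [Complex.arg_neg_iff]; simpa using hY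
  constructor <;> linarith [Real.pi_pos]

theorem wlmu_norm_sq (a Y : ℝ) : ‖wlmu a Y‖ ^ 2 = √(a ^ 2 + Y ^ 2) := by
  rw [← norm_pow, wlmu_sq, Complex.norm_def, Complex.normSq_apply]
  congr 1; simp; ring

theorem wlmu_re_sq (a Y : ℝ) : (wlmu a Y).re ^ 2 = (√(a ^ 2 + Y ^ 2) - a) / 2 := by
  have h1 := congrArg Complex.re (wlmu_sq a Y)
  have h2 := wlmu_norm_sq a Y
  rw [← Complex.normSq_eq_norm_sq, Complex.normSq_apply] at h2
  simp [pow_two] at h1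
  rw [← h2]
  nlinarith

theorem wlmu_re_ge {a Y : ℝ} (hY : 0 < Y) : Y / (2 * √(|a| + Y)) ≤ (wlmu a Y).re := by
  have hσ : 0 < |a| + Y := by positivity
  have hs : √(|a| + Y) ^ 2 = |a| + Y := Real.sq_sqrt hσ.le
  have hsp : 0 < √(|a| + Y) := Real.sqrt_pos.2 hσ
  refine le_of_sq_le_sq ?_ (wlmu_re_pos hY).le
  rw [wlmu_re_sq, div_pow, mul_pow, hs]
  set S := √(a ^ 2 + Y ^ 2) with hS
  have hS2 : S ^ 2 = a ^ 2 + Y ^ 2 := Real.sq_sqrt (by positivity)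
  have hS0 : 0 ≤ S := Real.sqrt_nonneg _
  have hS1 : S ≤ |a| + Y := by
    apply Real.sqrt_le_iff.2 ⟨hσ.le, ?_⟩
    nlinarith [sq_abs a, abs_nonneg a]
  have haS : |a| ≤ S := Real.abs_le_sqrt (by nlinarith)
  rw [div_le_div_iff₀ (by positivity) (by norm_num)]
  have h3 : (S - a) * (S + a) = Y ^ 2 := by nlinarith
  have h4 : S + a ≤ 2 * (|a| + Y) := by linarith [le_abs_self a]
  have h5 : 0 ≤ S - a := by linarith [le_abs_self a]
  nlinarith [mul_le_mul_of_nonneg_left h4 h5]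

theorem wlmu_inv_le {a Y : ℝ} (hY : 0 < Y) : ‖wlmu a Y‖⁻¹ ≤ 2 / √(|a| + Y) := by
  have hσ : 0 < |a| + Y := by positivity
  have hs : √(|a| + Y) ^ 2 = |a| + Y := Real.sq_sqrt hσ.le
  have hsp : 0 < √(|a| + Y) := Real.sqrt_pos.2 hσ
  have hpos : 0 < ‖wlmu a Y‖ := (wlmu_re_pos hY).trans_le (re_le_norm _)
  rw [inv_eq_one_div, div_le_div_iff₀ hpos hsp, one_mul]
  refine le_of_sq_le_sq ?_ (by positivity)
  rw [hs, mul_pow, wlmu_norm_sq]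
  have : (|a| + Y) / 2 ≤ √(a ^ 2 + Y ^ 2) := by
    apply Real.le_sqrt_of_sq_le
    nlinarith [sq_abs a, sq_nonneg (|a| - Y)]
  linarith

section kernel
variable {E : Type*} [NormedAddCommGroup E] [InnerProductSpace ℝ E] [FiniteDimensional ℝ E]
  [MeasurableSpace E] [BorelSpace E]

theorem wlk_norm_le {a Y : ℝ} (hY : 0 < Y) (x : E) :
    ‖wlk (wlmu a Y) x‖ ≤ 2 * wlc E / √(|a| + Y) * Real.exp (-(Y / √(|a| + Y) * ‖x‖)) := by
  unfold wlk
  rw [norm_mul, norm_div, Complex.norm_real, Real.norm_of_nonneg (wlc_pos E).le, Complex.norm_exp]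
  have h1 := wlmu_re_ge (a := a) hY
  have h2 := wlmu_inv_le (a := a) hY
  have hc := wlc_pos E
  have e : (-(2 * (Real.pi:ℂ) * wlmu a Y * ‖x‖)).re = -(2 * Real.pi * (wlmu a Y).re * ‖x‖) := by
    rw [show -(2 * (Real.pi:ℂ) * wlmu a Y * ‖x‖) = ((-(2 * Real.pi * ‖x‖) : ℝ) : ℂ) * wlmu a Y by push_cast; ring,
      Complex.re_ofReal_mul]
    ring
  rw [e]
  apply mul_le_mul _ _ (Real.exp_pos _).le (by positivity)
  · rw [div_eq_mul_inv]
    calc wlc E * ‖wlmu a Y‖⁻¹ ≤ wlc E * (2 / √(|a| + Y)) := by gcongr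
      _ = _ := by ring
  · apply Real.exp_le_exp.2
    apply neg_le_neg
    apply mul_le_mul_of_nonneg_right _ (norm_nonneg _)
    have h3 : Y / √(|a| + Y) = 2 * (Y / (2 * √(|a| + Y))) := by field_simp
    rw [h3]
    have := Real.pi_gt_three
    have : 0 ≤ (wlmu a Y).re := (wlmu_re_pos hY).le
    nlinarith

theorem wl_resolvent {a b : ℝ} (hb : 0 < b) (hd : 3 ≤ Module.finrank ℝ E) {f : E → ℂ} (hf : Integrable f)
    (hf' : Integrable (𝓕 f)) (x : E) :
    ‖∫ ξ : E, cexp (2 * Real.pi * inner ℝ ξ x * I) * (𝓕 f ξ / ((‖ξ‖:ℂ) ^ 2 - (a + b * I)))‖ₑ ≤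
      ENNReal.ofReal (((Module.finrank ℝ E : ℝ) - 1) / 2) * ∫⁻ Y in Set.Ioi (0:ℝ),
        ENNReal.ofReal (Y ^ (((Module.finrank ℝ E : ℝ) - 1) / 2 - 1)) * ‖∫ y, wlk (wlmu a Y) (x - y) * f y‖ₑ := by
  set M : ℝ := ((Module.finrank ℝ E : ℝ) - 1) / 2 with hMdef
  have hM : 1 ≤ M := by
    have : (3:ℝ) ≤ Module.finrank ℝ E := by exact_mod_cast hd
    rw [hMdef]; linarith
  have hq : ((Module.finrank ℝ E : ℝ) + 1) / 2 = M + 1 := by rw [hMdef]; ring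
  have hM0 : (M:ℂ) ≠ 0 := by exact_mod_cast (by linarith : M ≠ 0)
  set A : E → ℂ := fun ξ => (‖ξ‖:ℂ) ^ 2 - (a + b * I) with hAdef
  have hA : ∀ ξ, (A ξ).im = -b := by
    intro ξ; simp [hAdef, pow_two]
  have hA0 : ∀ ξ, A ξ ≠ 0 := by
    intro ξ h; have := hA ξ; rw [h] at this; simp at this; linarith
  have hIne : (-I) ^ (-(M:ℂ)) ≠ 0 := by
    rw [Ne, Complex.cpow_eq_zero_iff]; simp
  have hInorm : ‖(-I) ^ (-(M:ℂ))‖ = 1 := by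
    rw [← Complex.ofReal_neg, Complex.norm_cpow_real]; simp
  have e1 : ∀ ξ : E, cexp (2 * Real.pi * inner ℝ ξ x * I) * (𝓕 f ξ / ((‖ξ‖:ℂ) ^ 2 - (a + b * I))) =
      (M / (-I) ^ (-(M:ℂ))) * ∫ y in Set.Ioi (0:ℝ), cexp (2 * Real.pi * inner ℝ ξ x * I) * 𝓕 f ξ *
        (((y ^ (M - 1) : ℝ) : ℂ) * (A ξ - I * y) ^ (-((M + 1 : ℝ) : ℂ))) := by
    intro ξ
    rw [integral_const_mul, wl_complex_beta (hA ξ) hb hM]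
    have := hA0 ξ
    change _ * (_ / A ξ) = _
    field_simp
  simp_rw [e1]
  rw [integral_const_mul, integral_integral_swap]
  · have e2 : ∀ y ∈ Set.Ioi (0:ℝ), ∫ ξ : E, cexp (2 * Real.pi * inner ℝ ξ x * I) * 𝓕 f ξ *
        (((y ^ (M - 1) : ℝ) : ℂ) * (A ξ - I * y) ^ (-((M + 1 : ℝ) : ℂ))) =
        ((y ^ (M - 1) : ℝ) : ℂ) * ∫ v, wlk (wlmu a (b + y)) (x - v) * f v := by
      intro y hy
      simp only [Set.mem_Ioi] at hy
      rw [← wl_T_eq (wlmu_re_pos (by linarith)) hf, ← integral_const_mul, hq]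
      congr 1
      ext ξ
      have : A ξ - I * y = wlmu a (b + y) ^ 2 + (‖ξ‖:ℂ) ^ 2 := by
        rw [wlmu_sq]; simp only [hAdef]; push_cast; ring
      rw [this]; ring
    rw [setIntegral_congr_fun measurableSet_Ioi e2, enorm_mul]
    have e3 : ‖(M:ℂ) / (-I) ^ (-(M:ℂ))‖ₑ = ENNReal.ofReal M := by
      rw [← ofReal_norm, norm_div, hInorm, div_one, Complex.norm_real, Real.norm_of_nonneg (by linarith)]
    rw [e3]
    gcongr
    refine (enorm_integral_le_lintegral_enorm _).trans ?_
    set G : ℝ → ℝ≥0∞ := fun Y => ENNReal.ofReal (Y ^ (M - 1)) * ‖∫ y, wlk (wlmu a Y) (x - y) * f y‖ₑ with hG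
    calc ∫⁻ y in Set.Ioi (0:ℝ), ‖((y ^ (M - 1) : ℝ) : ℂ) * ∫ v, wlk (wlmu a (b + y)) (x - v) * f v‖ₑ
        ≤ ∫⁻ y in Set.Ioi (0:ℝ), G (b + y) := by
          apply setLIntegral_mono' measurableSet_Ioi
          intro y hy
          simp only [Set.mem_Ioi] at hy
          rw [enorm_mul]
          simp only [hG]
          gcongr
          rw [← ofReal_norm, Complex.norm_real, Real.norm_of_nonneg (by positivity)]
          apply ENNReal.ofReal_le_ofReal
          exact Real.rpow_le_rpow hy.le (by linarith) (by linarith)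
      _ = ∫⁻ y, (Set.Ioi (0:ℝ)).indicator (fun y => G (b + y)) y := by
          rw [lintegral_indicator measurableSet_Ioi]
      _ ≤ ∫⁻ y, (Set.Ioi (0:ℝ)).indicator G (b + y) := by
          apply lintegral_mono
          intro y
          by_cases hy : 0 < y
          · have : 0 < b + y := by linarith
            simp [Set.indicator, hy, this]
          · simp [Set.indicator, hy]
      _ = ∫⁻ y, (Set.Ioi (0:ℝ)).indicator G y := lintegral_add_left_eq_self _ b
      _ = _ := by rw [lintegral_indicator measurableSet_Ioi]
  · have hrb : Integrable (fun y : ℝ => y ^ (M - 1) * (b + y) ^ (-(M + 1))) (volume.restrict (Set.Ioi 0)) :=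
      wl_real_beta hM hb
    have h1 := hf'.norm.mul_prod hrb
    refine h1.mono ?_ ?_
    · have hc := wl_continuous_fourier hf
      apply Measurable.aestronglyMeasurable
      simp only [Function.uncurry, hAdef]
      have := hc.measurable
      fun_prop
    · have : ∀ᵐ z : E × ℝ ∂(volume.prod (volume.restrict (Set.Ioi (0:ℝ)))), 0 < z.2 := by
        have h2 : ∀ᵐ y ∂(volume.restrict (Set.Ioi (0:ℝ))), 0 < y := ae_restrict_mem measurableSet_Ioi
        exact Measure.quasiMeasurePreserving_snd.ae h2
      filter_upwards [this] with z hz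
      simp only [Function.uncurry]
      have := wl_norm_beta (hA z.1) hb hM hz
      rw [norm_mul, norm_mul, wl_norm_e, one_mul, norm_mul ‖𝓕 f z.1‖, norm_norm]
      apply mul_le_mul_of_nonneg_left (this.trans (le_abs_self _)) (norm_nonneg _)

end kernel


theorem wl_cs0 {α : Type*} [MeasurableSpace α] {ν : Measure α} {f g : α → ℝ≥0∞} (hf : AEMeasurable f ν) (hg : AEMeasurable g ν) :
    (∫⁻ x, f x * g x ∂ν) ^ 2 ≤ (∫⁻ x, f x ^ 2 ∂ν) * (∫⁻ x, g x ^ 2 ∂ν) := by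
  have h := ENNReal.lintegral_mul_le_Lp_mul_Lq ν Real.HolderConjugate.two_two hf hg
  have h2 := pow_le_pow_left' h 2
  simp only [Pi.mul_apply] at h2
  refine h2.trans ?_
  rw [mul_pow, ← ENNReal.rpow_natCast, ← ENNReal.rpow_natCast, ← ENNReal.rpow_mul, ← ENNReal.rpow_mul]
  norm_num

theorem wl_cs {α : Type*} [MeasurableSpace α] {ν : Measure α} {K F θ : α → ℝ≥0∞} (hK : AEMeasurable K ν) (hF : AEMeasurable F ν)
    (hθ : AEMeasurable θ ν) (h0 : ∀ᵐ x ∂ν, θ x ≠ 0) (h1 : ∀ᵐ x ∂ν, θ x ≠ ⊤) :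
    (∫⁻ x, K x * F x ∂ν) ^ 2 ≤ (∫⁻ x, K x * (F x ^ 2 * (θ x)⁻¹) ∂ν) * (∫⁻ x, K x * θ x ∂ν) := by
  have hs : ∀ u : ℝ≥0∞, (u ^ (1/2 : ℝ)) ^ 2 = u := by
    intro u
    rw [← ENNReal.rpow_natCast, ← ENNReal.rpow_mul]; norm_num
  have hss : ∀ u : ℝ≥0∞, (u ^ (1/2 : ℝ)) * (u ^ (1/2 : ℝ)) = u := by
    intro u; rw [← pow_two, hs]
  have h := wl_cs0 (ν := ν) (f := fun x => K x ^ (1/2:ℝ) * (F x * (θ x ^ (1/2:ℝ))⁻¹)) (g := fun x => K x ^ (1/2:ℝ) * θ x ^ (1/2:ℝ))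
    (by fun_prop) (by fun_prop)
  have e1 : ∫⁻ x, K x * F x ∂ν = ∫⁻ x, (K x ^ (1/2:ℝ) * (F x * (θ x ^ (1/2:ℝ))⁻¹)) * (K x ^ (1/2:ℝ) * θ x ^ (1/2:ℝ)) ∂ν := by
    apply lintegral_congr_ae
    filter_upwards [h0, h1] with x h0 h1
    have e : (θ x ^ (1/2:ℝ))⁻¹ * θ x ^ (1/2:ℝ) = 1 := by
      apply ENNReal.inv_mul_cancel
      · simp [h0]
      · simp [h1]
    calc K x * F x = (K x ^ (1/2:ℝ) * K x ^ (1/2:ℝ)) * F x * 1 := by rw [hss, mul_one]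
      _ = _ := by rw [← e]; ring
  rw [e1]
  refine h.trans (le_of_eq ?_)
  congr 1
  · congr 1
    ext x
    rw [mul_pow, hs, mul_pow, ← ENNReal.inv_pow, hs]
  · congr 1
    ext x
    rw [mul_pow, hs, hs]

section layer
variable {E : Type*} [NormedAddCommGroup E] [InnerProductSpace ℝ E] [FiniteDimensional ℝ E]
  [MeasurableSpace E] [BorelSpace E]

def wlG (s : ℝ) : ℝ≥0∞ := ∑' k : ℕ, ENNReal.ofReal (Real.exp (-k) * ((k:ℝ) + 1) ^ s)

theorem wlG_ne_top (s : ℝ) : wlG s ≠ ⊤ := by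
  unfold wlG
  obtain ⟨m, hm⟩ := exists_nat_ge s
  have h1 : Summable (fun k : ℕ => Real.exp (-k) * ((k:ℝ) + 1) ^ s) := by
    have h0 := Real.summable_pow_mul_exp_neg_nat_mul m (r := 1) one_pos
    have h2 := ((summable_nat_add_iff 1).2 h0).mul_left (Real.exp 1)
    refine Summable.of_nonneg_of_le (fun k => by positivity) (fun k => ?_) h2
    have h3 : ((k:ℝ) + 1) ^ s ≤ ((k:ℝ) + 1) ^ m := by
      rw [← Real.rpow_natCast]
      exact Real.rpow_le_rpow_of_exponent_le (by linarith [(k.cast_nonneg : (0:ℝ) ≤ k)]) hm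
    have h4 : Real.exp 1 * (((k + 1 : ℕ) : ℝ) ^ m * Real.exp (-1 * ((k + 1 : ℕ):ℝ))) = Real.exp (-k) * ((k:ℝ) + 1) ^ m := by
      have : Real.exp (-k) = Real.exp 1 * Real.exp (-1 * ((k + 1 : ℕ):ℝ)) := by
        rw [← Real.exp_add]; congr 1; push_cast; ring
      rw [this]; push_cast; ring
    rw [h4]
    gcongr
  exact h1.tsum_ofReal_ne_top

theorem wl_layer (ν : Measure E) {A : ℝ≥0∞} {s κ : ℝ} (hκ : 0 < κ) (x : E)
    (h : ∀ r > 0, ν (ball x r) ≤ A * ENNReal.ofReal (r ^ s)) :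
    ∫⁻ y, ENNReal.ofReal (Real.exp (-(κ * ‖x - y‖))) ∂ν ≤ A * ENNReal.ofReal (κ ^ (-s)) * wlG s := by
  calc ∫⁻ y, ENNReal.ofReal (Real.exp (-(κ * ‖x - y‖))) ∂ν
      ≤ ∫⁻ y, ∑' k : ℕ, (ball x ((k + 1) / κ)).indicator (fun _ => ENNReal.ofReal (Real.exp (-k))) y ∂ν := by
        apply lintegral_mono
        intro y
        set k := ⌊κ * ‖x - y‖⌋₊ with hk
        refine le_trans ?_ (ENNReal.le_tsum k)
        have h1 : (k:ℝ) ≤ κ * ‖x - y‖ := Nat.floor_le (by positivity)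
        have h2 : κ * ‖x - y‖ < k + 1 := Nat.lt_floor_add_one _
        have h3 : y ∈ ball x ((k + 1) / κ) := by
          rw [mem_ball, dist_comm, dist_eq_norm, lt_div_iff₀ hκ]; linarith
        rw [Set.indicator_of_mem h3]
        exact ENNReal.ofReal_le_ofReal (Real.exp_le_exp.2 (by linarith))
    _ = ∑' k : ℕ, ENNReal.ofReal (Real.exp (-k)) * ν (ball x ((k + 1) / κ)) := by
        rw [lintegral_tsum]
        · congr 1; ext k
          rw [lintegral_indicator measurableSet_ball, setLIntegral_const]
        · intro k
          exact (measurable_const.indicator measurableSet_ball).aemeasurable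
    _ ≤ ∑' k : ℕ, A * ENNReal.ofReal (κ ^ (-s)) * ENNReal.ofReal (Real.exp (-k) * ((k:ℝ) + 1) ^ s) := by
        apply ENNReal.tsum_le_tsum
        intro k
        have hk : (0:ℝ) < (k + 1) / κ := by positivity
        calc _ ≤ ENNReal.ofReal (Real.exp (-k)) * (A * ENNReal.ofReal (((k + 1) / κ) ^ s)) := by
              gcongr; exact h _ hk
          _ = _ := by
              rw [Real.div_rpow (by positivity) hκ.le, div_eq_mul_inv, ← Real.rpow_neg hκ.le,
                ENNReal.ofReal_mul (by positivity), ENNReal.ofReal_mul (by positivity)]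
              ring
    _ = _ := by rw [ENNReal.tsum_mul_left]; rfl

end layer

theorem wl_phi_int {p : ℝ} (hp : 1 < p) (w : ℝ≥0∞) (hw : w ≠ ⊤) :
    ∫⁻ Y in Set.Ioi (0:ℝ), ENNReal.ofReal (Y ^ (-2:ℝ)) * (1 + (w * ENNReal.ofReal Y⁻¹) ^ p)⁻¹ ≤
      ENNReal.ofReal (1 / (p - 1) + 1) * w⁻¹ := by
  have hc : 0 < 1 / (p - 1) + 1 := by
    have : 0 < p - 1 := by linarith
    positivity
  by_cases h0 : w = 0
  · rw [h0, ENNReal.inv_zero, ENNReal.mul_top]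
    · exact le_top
    · simpa using hc
  obtain ⟨v, hv⟩ : ∃ v : ℝ, w = ENNReal.ofReal v := ⟨w.toReal, (ENNReal.ofReal_toReal hw).symm⟩
  have hv0 : 0 < v := by
    by_contra h
    exact h0 (by rw [hv]; exact ENNReal.ofReal_of_nonpos (not_lt.1 h))
  have hp1 : 0 < p - 1 := by linarith
  rw [← Set.Ioc_union_Ioi_eq_Ioi hv0.le]
  refine (lintegral_union_le _ _ _).trans ?_
  have i1 : ∫⁻ Y in Set.Ioc 0 v, ENNReal.ofReal (Y ^ (-2:ℝ)) * (1 + (w * ENNReal.ofReal Y⁻¹) ^ p)⁻¹ ≤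
      ENNReal.ofReal (1 / (p - 1) * v⁻¹) := by
    calc _ ≤ ∫⁻ Y in Set.Ioc 0 v, ENNReal.ofReal (v ^ (-p) * Y ^ (p - 2)) := by
          apply setLIntegral_mono' measurableSet_Ioc
          intro Y hY
          have hY0 : 0 < Y := hY.1
          have : (1 + (w * ENNReal.ofReal Y⁻¹) ^ p)⁻¹ ≤ ENNReal.ofReal (v ^ (-p) * Y ^ p) := by
            have e : ENNReal.ofReal (v ^ (-p) * Y ^ p) = (ENNReal.ofReal ((v * Y⁻¹) ^ p))⁻¹ := by
              rw [← ENNReal.ofReal_inv_of_pos (by positivity), Real.mul_rpow hv0.le (by positivity),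
                Real.inv_rpow hY0.le, Real.rpow_neg hv0.le, mul_inv, inv_inv]
            rw [e, ENNReal.inv_le_inv, hv, ← ENNReal.ofReal_mul hv0.le, ENNReal.ofReal_rpow_of_pos (by positivity)]
            exact le_add_self
          calc _ ≤ ENNReal.ofReal (Y ^ (-2:ℝ)) * ENNReal.ofReal (v ^ (-p) * Y ^ p) := by gcongr
            _ = _ := by
              rw [← ENNReal.ofReal_mul (by positivity)]
              congr 1
              rw [sub_eq_add_neg, Real.rpow_add hY0]; ring
      _ = ENNReal.ofReal (∫ Y in Set.Ioc 0 v, v ^ (-p) * Y ^ (p - 2)) := by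
          rw [ofReal_integral_eq_lintegral_ofReal]
          · apply Integrable.const_mul
            have := (intervalIntegral.intervalIntegrable_rpow' (a := 0) (b := v) (r := p - 2) (by linarith))
            rw [intervalIntegrable_iff_integrableOn_Ioc_of_le hv0.le] at this
            exact this
          · filter_upwards [ae_restrict_mem measurableSet_Ioc] with Y hY
            have hY0 : 0 < Y := hY.1
            simp only [Pi.zero_apply]
            positivity
      _ ≤ _ := by
          apply ENNReal.ofReal_le_ofReal
          rw [integral_const_mul, ← intervalIntegral.integral_of_le hv0.le, integral_rpow (Or.inl (by linarith))]
          rw [Real.zero_rpow (by linarith), show p - 2 + 1 = p - 1 by ring]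
          have : v ^ (-p) * v ^ (p - 1) = v⁻¹ := by
            rw [← Real.rpow_add hv0, ← Real.rpow_neg_one]; congr 1; ring
          rw [sub_zero, mul_div_assoc', this]
          apply le_of_eq; ring
  have i2 : ∫⁻ Y in Set.Ioi v, ENNReal.ofReal (Y ^ (-2:ℝ)) * (1 + (w * ENNReal.ofReal Y⁻¹) ^ p)⁻¹ ≤
      ENNReal.ofReal (v⁻¹) := by
    calc _ ≤ ∫⁻ Y in Set.Ioi v, ENNReal.ofReal (Y ^ (-2:ℝ)) := by
          apply lintegral_mono
          intro Y
          refine mul_le_of_le_one_right' ?_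
          rw [ENNReal.inv_le_one]
          exact le_self_add
      _ = ENNReal.ofReal (∫ Y in Set.Ioi v, Y ^ (-2:ℝ)) := by
          rw [ofReal_integral_eq_lintegral_ofReal]
          · exact integrableOn_Ioi_rpow_of_lt (by norm_num) hv0
          · filter_upwards [ae_restrict_mem measurableSet_Ioi] with Y hY
            have hY0 : 0 < Y := hv0.trans hY
            simp only [Pi.zero_apply]
            positivity
      _ = _ := by
          rw [integral_Ioi_rpow_of_lt (by norm_num) hv0]
          congr 1
          rw [show (-2:ℝ) + 1 = -1 by norm_num, Real.rpow_neg_one]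
          ring
  refine (add_le_add i1 i2).trans ?_
  rw [hv, ← ENNReal.ofReal_inv_of_pos hv0, ← ENNReal.ofReal_add (by positivity) (by positivity), ← ENNReal.ofReal_mul hc.le]
  apply le_of_eq; congr 1; ring



section layer
variable {E : Type*} [NormedAddCommGroup E] [InnerProductSpace ℝ E] [FiniteDimensional ℝ E]
  [MeasurableSpace E] [BorelSpace E]

def wlH (p : ℝ) (w : E → ℝ≥0∞) : Prop := ∀ (x : E) (r : ℝ), 0 < r →
  ∫⁻ y in ball x r, w y ^ p ≤ ENNReal.ofReal (r ^ ((Module.finrank ℝ E : ℝ) - 2 * p))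

theorem wl_layer_w {p : ℝ} {w : E → ℝ≥0∞} (hw : Measurable w) (h : wlH p w) {κ : ℝ} (hκ : 0 < κ) (x : E) :
    ∫⁻ y, ENNReal.ofReal (Real.exp (-(κ * ‖x - y‖))) * w y ^ p ≤
      ENNReal.ofReal (κ ^ (-((Module.finrank ℝ E : ℝ) - 2 * p))) * wlG ((Module.finrank ℝ E : ℝ) - 2 * p) := by
  have h1 := wl_layer ((volume : Measure E).withDensity (fun y => w y ^ p)) (A := 1)
    (s := (Module.finrank ℝ E : ℝ) - 2 * p) hκ x (by
      intro r hr
      rw [withDensity_apply _ measurableSet_ball, one_mul]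
      exact h x r hr)
  rw [lintegral_withDensity_eq_lintegral_mul _ (by fun_prop) (by fun_prop), one_mul] at h1
  refine le_trans (le_of_eq ?_) h1
  congr 1; ext y; simp [mul_comm]

theorem wl_layer_vol {κ : ℝ} (hκ : 0 < κ) (x : E) :
    ∫⁻ y, ENNReal.ofReal (Real.exp (-(κ * ‖x - y‖))) ≤
      volume (ball (0:E) 1) * ENNReal.ofReal (κ ^ (-(Module.finrank ℝ E : ℝ))) * wlG (Module.finrank ℝ E : ℝ) := by
  refine wl_layer (volume : Measure E) hκ x ?_
  intro r hr
  rw [Measure.addHaar_ball_of_pos _ _ hr, mul_comm, Real.rpow_natCast]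

theorem wl_schurA (p : ℝ) (hp : 0 ≤ p) : ∃ C : ℝ≥0∞, C ≠ ⊤ ∧ ∀ w : E → ℝ≥0∞, Measurable w → wlH p w → ∀ Y : ℝ, 0 < Y → ∀ x : E,
    ∫⁻ y, ENNReal.ofReal (Y ^ ((Module.finrank ℝ E : ℝ) / 2 - 2) * Real.exp (-(√Y / 2 * ‖x - y‖))) *
      (1 + (w y * ENNReal.ofReal Y⁻¹) ^ p) ≤ C * ENNReal.ofReal (Y ^ (-2:ℝ)) := by
  set d : ℝ := (Module.finrank ℝ E : ℝ) with hd
  refine ⟨volume (ball (0:E) 1) * ENNReal.ofReal ((1/2) ^ (-d)) * wlG d + ENNReal.ofReal ((1/2) ^ (-(d - 2 * p))) * wlG (d - 2 * p), ?_, ?_⟩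
  · have := wlG_ne_top d
    have := wlG_ne_top (d - 2 * p)
    have : volume (ball (0:E) 1) ≠ ⊤ := measure_ball_lt_top.ne
    finiteness
  intro w hw h Y hY x
  have hκ : 0 < √Y / 2 := by positivity
  have e : ∀ s : ℝ, (√Y / 2) ^ (-s) = (1 / 2) ^ (-s) * Y ^ (-s / 2) := by
    intro s
    rw [div_eq_mul_one_div, Real.mul_rpow (by positivity) (by positivity), Real.sqrt_eq_rpow, ← Real.rpow_mul hY.le]
    rw [mul_comm]; congr 2; ring
  have h1 := wl_layer_vol hκ x
  have h2 := wl_layer_w hw h hκ x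
  rw [← hd, e] at h1 h2
  have hsplit : ∀ y, ENNReal.ofReal (Y ^ (d / 2 - 2) * Real.exp (-(√Y / 2 * ‖x - y‖))) * (1 + (w y * ENNReal.ofReal Y⁻¹) ^ p)
    = ENNReal.ofReal (Y ^ (d / 2 - 2)) * ENNReal.ofReal (Real.exp (-(√Y / 2 * ‖x - y‖))) +
      ENNReal.ofReal (Y ^ (d / 2 - 2)) * ENNReal.ofReal (Y ^ (-p)) * (ENNReal.ofReal (Real.exp (-(√Y / 2 * ‖x - y‖))) * w y ^ p) := by
    intro y
    have : (w y * ENNReal.ofReal Y⁻¹) ^ p = w y ^ p * ENNReal.ofReal (Y ^ (-p)) := by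
      rw [ENNReal.mul_rpow_of_nonneg _ _ hp, ENNReal.ofReal_rpow_of_pos (by positivity), Real.inv_rpow hY.le, Real.rpow_neg hY.le]
    rw [ENNReal.ofReal_mul (by positivity), this]
    ring
  simp_rw [hsplit]
  rw [lintegral_add_left (by fun_prop), lintegral_const_mul _ (by fun_prop), lintegral_const_mul _ (by fun_prop), add_mul]
  apply add_le_add
  · refine (mul_le_mul_right h1 _).trans (le_of_eq ?_)
    rw [ENNReal.ofReal_mul (by positivity)]
    have : ENNReal.ofReal (Y ^ (-2:ℝ)) = ENNReal.ofReal (Y ^ (d / 2 - 2)) * ENNReal.ofReal (Y ^ (-d / 2)) := by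
      rw [← ENNReal.ofReal_mul (by positivity), ← Real.rpow_add hY]; congr 2; ring
    rw [this]; ring
  · refine (mul_le_mul_right h2 _).trans (le_of_eq ?_)
    rw [ENNReal.ofReal_mul (by positivity)]
    have : ENNReal.ofReal (Y ^ (-2:ℝ)) = ENNReal.ofReal (Y ^ (d / 2 - 2)) * ENNReal.ofReal (Y ^ (-p)) * ENNReal.ofReal (Y ^ (-(d - 2 * p) / 2)) := by
      rw [← ENNReal.ofReal_mul (by positivity), ← ENNReal.ofReal_mul (by positivity), ← Real.rpow_add hY, ← Real.rpow_add hY]; congr 2; ring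
    rw [this]; ring

theorem wl_partA (p : ℝ) (hp : 1 < p) : ∃ C : ℝ≥0∞, C ≠ ⊤ ∧ ∀ w : E → ℝ≥0∞, Measurable w → (∀ x, w x ≠ ⊤) → wlH p w →
    ∀ F : E → ℝ≥0∞, Measurable F →
    ∫⁻ x, w x * (∫⁻ Y in Set.Ioi (0:ℝ), ∫⁻ y, ENNReal.ofReal (Y ^ ((Module.finrank ℝ E : ℝ) / 2 - 2) * Real.exp (-(√Y / 2 * ‖x - y‖))) * F y) ^ 2
      ≤ C * ∫⁻ y, F y ^ 2 * (w y)⁻¹ := by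
  obtain ⟨C, hC, hS⟩ := wl_schurA (E := E) p (by linarith)
  set D := ENNReal.ofReal (1 / (p - 1) + 1) with hD
  refine ⟨C * D * (C * D), by finiteness, ?_⟩
  intro w hw hwt hH F hF
  set d : ℝ := (Module.finrank ℝ E : ℝ) with hd
  set K : ℝ → E → E → ℝ≥0∞ := fun Y x y => ENNReal.ofReal (Y ^ (d / 2 - 2) * Real.exp (-(√Y / 2 * ‖x - y‖))) with hK
  set φ : ℝ → E → ℝ≥0∞ := fun Y y => 1 + (w y * ENNReal.ofReal Y⁻¹) ^ p with hφ
  have hφ0 : ∀ Y y, φ Y y ≠ 0 := by intro Y y; simp [hφ]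
  have hφt : ∀ Y y, φ Y y ≠ ⊤ := by
    intro Y y
    have := hwt y
    have : (w y * ENNReal.ofReal Y⁻¹) ^ p ≠ ⊤ := ENNReal.rpow_ne_top_of_nonneg (by linarith) (by finiteness)
    simp only [hφ]; finiteness
  have hKm : Measurable (fun z : (ℝ × E) × E => K z.1.1 z.1.2 z.2) := by
    simp only [hK]; fun_prop
  have hφm : Measurable (fun z : ℝ × E => φ z.1 z.2) := by
    simp only [hφ]; fun_prop
  have hKsymm : ∀ Y x y, K Y x y = K Y y x := by
    intro Y x y; simp only [hK]; rw [norm_sub_rev]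
  -- pointwise Cauchy-Schwarz
  have hcs : ∀ x, (∫⁻ Y in Set.Ioi (0:ℝ), ∫⁻ y, K Y x y * F y) ^ 2 ≤
      (∫⁻ Y in Set.Ioi (0:ℝ), ∫⁻ y, K Y x y * (F y ^ 2 * (φ Y y * (φ Y x)⁻¹)⁻¹)) * (C * D * (w x)⁻¹) := by
    intro x
    have hKx : Measurable (fun z : ℝ × E => K z.1 x z.2) :=
      hKm.comp ((measurable_fst.prodMk measurable_const).prodMk measurable_snd)
    have hφx : Measurable (fun z : ℝ × E => φ z.1 x) :=
      hφm.comp (measurable_fst.prodMk measurable_const)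
    have h := wl_cs (ν := (volume.restrict (Set.Ioi (0:ℝ))).prod (volume : Measure E)) (K := fun z => K z.1 x z.2)
      (F := fun z => F z.2) (θ := fun z => φ z.1 z.2 * (φ z.1 x)⁻¹) hKx.aemeasurable (by fun_prop)
      (by fun_prop) (Filter.Eventually.of_forall fun z => mul_ne_zero (hφ0 _ _) (ENNReal.inv_ne_zero.2 (hφt _ _)))
      (Filter.Eventually.of_forall fun z => ENNReal.mul_ne_top (hφt _ _) (ENNReal.inv_ne_top.2 (hφ0 _ _)))
    rw [lintegral_prod _ (by fun_prop), lintegral_prod _ (by fun_prop), lintegral_prod _ (by fun_prop)] at h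
    refine h.trans ?_
    gcongr
    calc ∫⁻ Y in Set.Ioi (0:ℝ), ∫⁻ y, K Y x y * (φ Y y * (φ Y x)⁻¹)
        ≤ ∫⁻ Y in Set.Ioi (0:ℝ), C * (ENNReal.ofReal (Y ^ (-2:ℝ)) * (φ Y x)⁻¹) := by
          apply setLIntegral_mono' measurableSet_Ioi
          intro Y hY
          have hm : Measurable (fun y => K Y x y * φ Y y) := by
            have : Measurable (fun y => K Y x y) := hKx.comp (measurable_const.prodMk measurable_id)
            have : Measurable (fun y => φ Y y) := hφm.comp (measurable_const.prodMk measurable_id)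
            fun_prop
          simp_rw [← mul_assoc]
          rw [lintegral_mul_const _ hm]
          gcongr
          exact hS w hw hH Y hY x
      _ = C * ∫⁻ Y in Set.Ioi (0:ℝ), (ENNReal.ofReal (Y ^ (-2:ℝ)) * (φ Y x)⁻¹) := by
          rw [lintegral_const_mul' _ _ hC]
      _ ≤ C * (D * (w x)⁻¹) := by
          gcongr
          exact wl_phi_int hp (w x) (hwt x)
      _ = _ := by ring
  calc _ ≤ ∫⁻ x, (∫⁻ Y in Set.Ioi (0:ℝ), ∫⁻ y, K Y x y * (F y ^ 2 * (φ Y y * (φ Y x)⁻¹)⁻¹)) * (C * D) := by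
        apply lintegral_mono
        intro x
        calc _ ≤ w x * ((∫⁻ Y in Set.Ioi (0:ℝ), ∫⁻ y, K Y x y * (F y ^ 2 * (φ Y y * (φ Y x)⁻¹)⁻¹)) * (C * D * (w x)⁻¹)) := by
              exact mul_le_mul_right (hcs x) _
          _ = (∫⁻ Y in Set.Ioi (0:ℝ), ∫⁻ y, K Y x y * (F y ^ 2 * (φ Y y * (φ Y x)⁻¹)⁻¹)) * (C * D) * (w x * (w x)⁻¹) := by ring
          _ ≤ _ := mul_le_of_le_one_right' (ENNReal.mul_inv_le_one _)
    _ = (C * D) * ∫⁻ x, ∫⁻ Y in Set.Ioi (0:ℝ), ∫⁻ y, K Y x y * (F y ^ 2 * (φ Y y * (φ Y x)⁻¹)⁻¹) := by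
        rw [lintegral_mul_const' _ _ (by finiteness), mul_comm]
    _ ≤ (C * D) * ((C * D) * ∫⁻ y, F y ^ 2 * (w y)⁻¹) := by
        gcongr
        have hm3 : Measurable (fun z : (ℝ × E) × E => K z.1.1 z.1.2 z.2 * (F z.2 ^ 2 * (φ z.1.1 z.2 * (φ z.1.1 z.1.2)⁻¹)⁻¹)) := by
          have a1 : Measurable (fun z : (ℝ × E) × E => φ z.1.1 z.2) := hφm.comp (by fun_prop : Measurable (fun z : (ℝ × E) × E => (z.1.1, z.2)))
          have a2 : Measurable (fun z : (ℝ × E) × E => φ z.1.1 z.1.2) := hφm.comp (by fun_prop : Measurable (fun z : (ℝ × E) × E => (z.1.1, z.1.2)))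
          fun_prop
        have hm2 : Measurable (fun z : ℝ × E => ∫⁻ y, K z.1 z.2 y * (F y ^ 2 * (φ z.1 y * (φ z.1 z.2)⁻¹)⁻¹)) :=
          hm3.lintegral_prod_right'
        have hsw : AEMeasurable (Function.uncurry (fun (x : E) (Y : ℝ) => ∫⁻ y, K Y x y * (F y ^ 2 * (φ Y y * (φ Y x)⁻¹)⁻¹)))
            (volume.prod (volume.restrict (Set.Ioi (0:ℝ)))) := (hm2.comp measurable_swap).aemeasurable
        rw [lintegral_lintegral_swap hsw]
        calc _ ≤ ∫⁻ Y in Set.Ioi (0:ℝ), ∫⁻ y, F y ^ 2 * (C * (ENNReal.ofReal (Y ^ (-2:ℝ)) * (φ Y y)⁻¹)) := by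
              apply setLIntegral_mono' measurableSet_Ioi
              intro Y hY
              rw [lintegral_lintegral_swap]
              · apply lintegral_mono
                intro y
                have hm : Measurable (fun x => K Y y x * φ Y x) := by
                  have : Measurable (fun x => K Y y x) := hKm.comp (by fun_prop : Measurable (fun x : E => ((Y, y), x)))
                  have : Measurable (fun y => φ Y y) := hφm.comp (measurable_const.prodMk measurable_id)
                  fun_prop
                calc ∫⁻ x, K Y x y * (F y ^ 2 * (φ Y y * (φ Y x)⁻¹)⁻¹)
                    = ∫⁻ x, (K Y y x * φ Y x) * (F y ^ 2 * (φ Y y)⁻¹) := by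
                      congr 1; ext x
                      rw [ENNReal.mul_inv (Or.inl (hφ0 _ _)) (Or.inl (hφt _ _)), inv_inv, hKsymm]
                      ring
                  _ = (∫⁻ x, (K Y y x * φ Y x)) * (F y ^ 2 * (φ Y y)⁻¹) := lintegral_mul_const _ hm
                  _ ≤ (C * ENNReal.ofReal (Y ^ (-2:ℝ))) * (F y ^ 2 * (φ Y y)⁻¹) := by
                      gcongr
                      exact hS w hw hH Y hY y
                  _ = _ := by ring
              · exact (hm3.comp (by fun_prop : Measurable (fun z : E × E => ((Y, z.1), z.2)))).aemeasurable
          _ = ∫⁻ y, ∫⁻ Y in Set.Ioi (0:ℝ), F y ^ 2 * (C * (ENNReal.ofReal (Y ^ (-2:ℝ)) * (φ Y y)⁻¹)) := by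
              rw [lintegral_lintegral_swap]
              apply Measurable.aemeasurable
              unfold Function.uncurry
              fun_prop
          _ ≤ ∫⁻ y, (C * D) * (F y ^ 2 * (w y)⁻¹) := by
              apply lintegral_mono
              intro y
              have hm : Measurable (fun Y => ENNReal.ofReal (Y ^ (-2:ℝ)) * (φ Y y)⁻¹) := by
                have : Measurable (fun Y => φ Y y) := hφm.comp (measurable_id.prodMk measurable_const)
                fun_prop
              simp only
              rw [lintegral_const_mul _ (by fun_prop), lintegral_const_mul _ hm]
              calc _ ≤ F y ^ 2 * (C * (D * (w y)⁻¹)) := by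
                    gcongr; exact wl_phi_int hp (w y) (hwt y)
                _ = _ := by ring
          _ = _ := by rw [lintegral_const_mul' _ _ (by finiteness)]
    _ = _ := by ring
end layer


section blk
variable {E : Type*} [NormedAddCommGroup E] [InnerProductSpace ℝ E] [FiniteDimensional ℝ E]
  [MeasurableSpace E] [BorelSpace E]

theorem wl_plancherel_inv {f : E → ℂ} (hf : Integrable f) (hf2 : MemLp f 2) :
    ∫⁻ x, ‖𝓕⁻ f x‖ₑ ^ 2 = ∫⁻ x, ‖f x‖ₑ ^ 2 := by
  rw [← wl_plancherel hf hf2]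
  simp_rw [Real.fourierInv_eq_fourier_neg]
  exact lintegral_neg_eq_self (fun x => ‖𝓕 f x‖ₑ ^ 2)

theorem wl_memLp_two {α : Type*} [MeasurableSpace α] {ν : Measure α} {g : α → ℂ} (hg : AEStronglyMeasurable g ν)
    (h : ∫⁻ x, ‖g x‖ₑ ^ 2 ∂ν ≠ ⊤) : MemLp g 2 ν := by
  refine ⟨hg, ?_⟩
  rw [eLpNorm_lt_top_iff_lintegral_rpow_enorm_lt_top (by norm_num) (by norm_num)]
  simpa using h.lt_top

theorem wl_T_L2 {a Y : ℝ} (hY : 0 < Y) {g : E → ℂ} (hg : Integrable g) :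
    ∫⁻ x, ‖∫ y, wlk (wlmu a Y) (x - y) * g y‖ₑ ^ 2 ≤
      ENNReal.ofReal (Y ^ (-(((Module.finrank ℝ E : ℝ) + 1) / 2))) ^ 2 * ∫⁻ x, ‖g x‖ₑ ^ 2 := by
  by_cases htop : ∫⁻ x, ‖g x‖ₑ ^ 2 = ⊤
  · rw [htop, ENNReal.mul_top]
    · exact le_top
    · have : 0 < Y ^ (-(((Module.finrank ℝ E : ℝ) + 1) / 2)) := by positivity
      simpa using this
  have hg2 := wl_memLp_two hg.aestronglyMeasurable htop
  set q : ℝ := ((Module.finrank ℝ E : ℝ) + 1) / 2 with hq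
  set h : E → ℂ := fun ξ => (wlmu a Y ^ 2 + (‖ξ‖:ℂ) ^ 2) ^ (-(q:ℂ)) with hh
  have hre := wlmu_re_pos (a := a) hY
  have hintg : Integrable h := wl_integrable_h hre
  have hc := wl_continuous_fourier hg
  have hhm : Measurable h := wl_measurable_h _ _
  have hbound : ∀ ξ, ‖h ξ‖ₑ ≤ ENNReal.ofReal (Y ^ (-q)) := by
    intro ξ
    rw [← ofReal_norm]
    apply ENNReal.ofReal_le_ofReal
    simp only [hh]
    rw [← Complex.ofReal_neg, Complex.norm_cpow_real]
    apply Real.rpow_le_rpow_of_nonpos hY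
    · have := abs_im_le_norm (wlmu a Y ^ 2 + (‖ξ‖:ℂ) ^ 2)
      rw [wlmu_sq] at this ⊢
      simp [pow_two] at this
      rw [abs_of_pos hY] at this
      simpa [pow_two] using this
    · have : 0 ≤ q := by positivity
      linarith
  have hG1 : Integrable (fun ξ => h ξ * 𝓕 g ξ) := by
    obtain ⟨B, hB⟩ : ∃ B, ∀ ξ, ‖𝓕 g ξ‖ ≤ B := by
      refine ⟨∫ x, ‖g x‖, fun ξ => ?_⟩
      rw [Real.fourier_eq]
      refine (norm_integral_le_integral_norm _).trans (le_of_eq ?_)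
      congr 1; ext v; simp
    exact hintg.mul_bdd (c := B) hc.aestronglyMeasurable (Filter.Eventually.of_forall hB)
  have hle : ∫⁻ ξ, ‖h ξ * 𝓕 g ξ‖ₑ ^ 2 ≤ ENNReal.ofReal (Y ^ (-q)) ^ 2 * ∫⁻ x, ‖g x‖ₑ ^ 2 := by
    rw [← wl_plancherel hg hg2, ← lintegral_const_mul' _ _ (by finiteness)]
    apply lintegral_mono
    intro ξ
    simp only
    rw [enorm_mul, mul_pow]
    gcongr
    exact hbound ξ
  have hG2 : MemLp (fun ξ => h ξ * 𝓕 g ξ) 2 := by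
    apply wl_memLp_two hG1.aestronglyMeasurable
    exact (lt_of_le_of_lt hle (by finiteness)).ne
  have e : ∀ x, ∫ y, wlk (wlmu a Y) (x - y) * g y = 𝓕⁻ (fun ξ => h ξ * 𝓕 g ξ) x := by
    intro x
    rw [← wl_T_eq hre hg, Real.fourierInv_eq', ← hq]
    congr 1; ext ξ
    rw [smul_eq_mul]; push_cast; rfl
  simp_rw [e]
  rw [wl_plancherel_inv hG1 hG2]
  exact hle

/-- block estimate (i) -/
theorem wl_block_i {a Y : ℝ} (hY : 0 < Y) {w : E → ℝ≥0∞} (hw : Measurable w) {f : E → ℂ} (hf : Integrable f)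
    {u v : ℝ≥0∞} (hv0 : v ≠ ⊤) (S R : Set E) (hS : MeasurableSet S) (hR : MeasurableSet R) (hSu : ∀ x ∈ S, w x ≤ u)
    (hRv : ∀ x ∈ R, w x ≤ v) (hR0 : ∀ x ∈ R, w x ≠ 0) :
    ∫⁻ x in S, w x * ‖∫ y in R, wlk (wlmu a Y) (x - y) * f y‖ₑ ^ 2 ≤
      u * (ENNReal.ofReal (Y ^ (-(((Module.finrank ℝ E : ℝ) + 1) / 2))) ^ 2 * (v * ∫⁻ y in R, ‖f y‖ₑ ^ 2 * (w y)⁻¹)) := by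
  have e : ∀ x, ∫ y in R, wlk (wlmu a Y) (x - y) * f y = ∫ y, wlk (wlmu a Y) (x - y) * R.indicator f y := by
    intro x
    rw [← integral_indicator hR]
    congr 1; ext y
    by_cases hy : y ∈ R <;> simp [hy]
  simp_rw [e]
  calc _ ≤ ∫⁻ x in S, u * ‖∫ y, wlk (wlmu a Y) (x - y) * R.indicator f y‖ₑ ^ 2 := by
        apply setLIntegral_mono' hS
        intro x hx
        gcongr
        exact hSu x hx
    _ ≤ ∫⁻ x, u * ‖∫ y, wlk (wlmu a Y) (x - y) * R.indicator f y‖ₑ ^ 2 := setLIntegral_le_lintegral _ _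
    _ = u * ∫⁻ x, ‖∫ y, wlk (wlmu a Y) (x - y) * R.indicator f y‖ₑ ^ 2 := by
        apply lintegral_const_mul''
        have h1 : AEStronglyMeasurable (fun x => ∫ y, wlk (wlmu a Y) (x - y) * R.indicator f y) := by
          refine AEStronglyMeasurable.integral_prod_right' (f := fun z : E × E => wlk (wlmu a Y) (z.1 - z.2) * R.indicator f z.2) ?_
          apply AEStronglyMeasurable.mul
          · apply Measurable.aestronglyMeasurable
            unfold wlk
            fun_prop
          · exact ((hf.indicator hR).aestronglyMeasurable).comp_snd
        exact h1.enorm.pow_const 2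
    _ ≤ _ := by
        gcongr
        refine (wl_T_L2 hY (hf.indicator hR)).trans ?_
        gcongr
        rw [← lintegral_const_mul' _ _ hv0, ← lintegral_indicator hR]
        apply lintegral_mono
        intro y
        by_cases hy : y ∈ R
        · simp only [Set.indicator_of_mem hy]
          have h0 := hR0 y hy
          calc ‖f y‖ₑ ^ 2 = ‖f y‖ₑ ^ 2 * (w y * (w y)⁻¹) := by
                rw [ENNReal.mul_inv_cancel h0 (lt_of_le_of_lt (hRv y hy) hv0.lt_top).ne, mul_one]
            _ ≤ ‖f y‖ₑ ^ 2 * (v * (w y)⁻¹) := by gcongr; exact hRv y hy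
            _ = _ := by ring
        · simp [hy]

theorem wlk_symm (μ : ℂ) (x y : E) : wlk μ (x - y) = wlk μ (y - x) := by
  unfold wlk; rw [norm_sub_rev]

theorem wlk_measurable (μ : ℂ) : Measurable (fun z : E × E => wlk μ (z.1 - z.2)) := by
  unfold wlk; fun_prop

/-- block estimate (ii) -/
theorem wl_block_ii {μ : ℂ} {p : ℝ} (hp : 1 < p) {w : E → ℝ≥0∞} (hw : Measurable w) (hwt : ∀ x, w x ≠ ⊤)
    {f : E → ℂ} (hf : Measurable f) {B : ℝ≥0∞} (hBt : B ≠ ⊤)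
    (hB : ∀ x : E, ∫⁻ y, ‖wlk μ (x - y)‖ₑ * w y ^ p ≤ B)
    {s t : ℝ≥0∞} (hs : s ≠ 0) (ht : t ≠ 0) (hs' : s ≠ ⊤) (ht' : t ≠ ⊤) (S R : Set E) (hS : MeasurableSet S) (hR : MeasurableSet R)
    (hSs : ∀ x ∈ S, s ≤ w x) (hRt : ∀ x ∈ R, t ≤ w x) :
    ∫⁻ x in S, w x * ‖∫ y in R, wlk μ (x - y) * f y‖ₑ ^ 2 ≤
      B ^ 2 * (s ^ (1 - p) * t ^ (1 - p)) * ∫⁻ y in R, ‖f y‖ₑ ^ 2 * (w y)⁻¹ := by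
  have hkm := wlk_measurable (E := E) μ
  have hw0 : ∀ {x : E} {s : ℝ≥0∞}, s ≠ 0 → s ≤ w x → w x ≠ 0 := by
    intro x s hs h h0
    rw [h0] at h; exact hs (le_antisymm h bot_le)
  -- `w = w^p * w^(1-p) ≤ w^p s^(1-p)`
  have hpow : ∀ {x : E} {s : ℝ≥0∞}, s ≠ 0 → s ≤ w x → w x ^ (1 - p) ≤ s ^ (1 - p) := by
    intro x s hs h
    rw [show 1 - p = -(p - 1) by ring, ENNReal.rpow_neg, ENNReal.rpow_neg, ENNReal.inv_le_inv]
    exact ENNReal.rpow_le_rpow h (by linarith)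
  have hwS : ∀ x ∈ S, w x ≤ w x ^ p * s ^ (1 - p) := by
    intro x hx
    have h0 := hw0 hs (hSs x hx)
    calc w x = w x ^ (p + (1 - p)) := by rw [show p + (1 - p) = 1 by ring, ENNReal.rpow_one]
      _ = w x ^ p * w x ^ (1 - p) := ENNReal.rpow_add _ _ h0 (hwt x)
      _ ≤ _ := by exact mul_le_mul' le_rfl (hpow hs (hSs x hx))
  have hwR : ∀ y ∈ R, (w y ^ p)⁻¹ ≤ t ^ (1 - p) * (w y)⁻¹ := by
    intro y hy
    have h0 := hw0 ht (hRt y hy)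
    calc (w y ^ p)⁻¹ = w y ^ ((1 - p) + (-1)) := by rw [← ENNReal.rpow_neg]; congr 1; ring
      _ = w y ^ (1 - p) * (w y)⁻¹ := by rw [ENNReal.rpow_add _ _ h0 (hwt y), ENNReal.rpow_neg_one]
      _ ≤ _ := by exact mul_le_mul' (hpow ht (hRt y hy)) le_rfl
  have hkx : ∀ x : E, Measurable (fun y : E => wlk μ (x - y)) := by
    intro x; unfold wlk; fun_prop
  have hcs : ∀ x, ‖∫ y in R, wlk μ (x - y) * f y‖ₑ ^ 2 ≤ B * ∫⁻ y in R, ‖wlk μ (x - y)‖ₑ * (‖f y‖ₑ ^ 2 * (t ^ (1 - p) * (w y)⁻¹)) := by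
    intro x
    have h1 : ‖∫ y in R, wlk μ (x - y) * f y‖ₑ ≤ ∫⁻ y in R, ‖wlk μ (x - y)‖ₑ * ‖f y‖ₑ := by
      refine (enorm_integral_le_lintegral_enorm _).trans (le_of_eq ?_)
      simp_rw [enorm_mul]
    have hkx' := hkx x
    refine (pow_le_pow_left' h1 2).trans ?_
    refine (wl_cs (K := fun y => ‖wlk μ (x - y)‖ₑ) (F := fun y => ‖f y‖ₑ) (θ := fun y => w y ^ p) hkx'.enorm.aemeasurable hf.enorm.aemeasurable (hw.pow_const p).aemeasurable ?_ ?_).trans ?_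
    · filter_upwards [ae_restrict_mem hR] with y hy
      have h0 := hw0 ht (hRt y hy)
      simp [h0, hwt y]
    · refine Filter.Eventually.of_forall fun y => ?_
      exact ENNReal.rpow_ne_top_of_nonneg (by linarith) (hwt y)
    · rw [mul_comm]
      apply mul_le_mul'
      · exact (setLIntegral_le_lintegral _ _).trans (hB x)
      · apply setLIntegral_mono' hR
        intro y hy
        gcongr
        exact hwR y hy
  have hfin : s ^ (1 - p) ≠ ⊤ := by simp [hs, hs']
  have hfin' : t ^ (1 - p) ≠ ⊤ := by simp [ht, ht']
  calc _ ≤ ∫⁻ x in S, (B * s ^ (1 - p)) * ∫⁻ y in R, w x ^ p * (‖wlk μ (x - y)‖ₑ * (‖f y‖ₑ ^ 2 * (t ^ (1 - p) * (w y)⁻¹))) := by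
        apply setLIntegral_mono' hS
        intro x hx
        rw [lintegral_const_mul' _ _ (ENNReal.rpow_ne_top_of_nonneg (by linarith) (hwt x))]
        calc _ ≤ (w x ^ p * s ^ (1 - p)) * (B * ∫⁻ y in R, ‖wlk μ (x - y)‖ₑ * (‖f y‖ₑ ^ 2 * (t ^ (1 - p) * (w y)⁻¹))) :=
              mul_le_mul' (hwS x hx) (hcs x)
          _ = _ := by ring
    _ ≤ ∫⁻ x, (B * s ^ (1 - p)) * ∫⁻ y in R, w x ^ p * (‖wlk μ (x - y)‖ₑ * (‖f y‖ₑ ^ 2 * (t ^ (1 - p) * (w y)⁻¹))) :=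
        setLIntegral_le_lintegral _ _
    _ = (B * s ^ (1 - p)) * ∫⁻ x, ∫⁻ y in R, w x ^ p * (‖wlk μ (x - y)‖ₑ * (‖f y‖ₑ ^ 2 * (t ^ (1 - p) * (w y)⁻¹))) :=
        lintegral_const_mul' _ _ (by finiteness)
    _ = (B * s ^ (1 - p)) * ∫⁻ y in R, ∫⁻ x, w x ^ p * (‖wlk μ (x - y)‖ₑ * (‖f y‖ₑ ^ 2 * (t ^ (1 - p) * (w y)⁻¹))) := by
        congr 1
        apply lintegral_lintegral_swap
        apply Measurable.aemeasurable
        exact ((hw.pow_const p).comp measurable_fst).mul (hkm.enorm.mul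
          (((hf.enorm.pow_const 2).comp measurable_snd).mul ((hw.inv.comp measurable_snd).const_mul _)))
    _ ≤ (B * s ^ (1 - p)) * ∫⁻ y in R, (B * t ^ (1 - p)) * (‖f y‖ₑ ^ 2 * (w y)⁻¹) := by
        gcongr with y
        calc ∫⁻ x, w x ^ p * (‖wlk μ (x - y)‖ₑ * (‖f y‖ₑ ^ 2 * (t ^ (1 - p) * (w y)⁻¹)))
            = ∫⁻ x, (‖wlk μ (y - x)‖ₑ * w x ^ p) * (‖f y‖ₑ ^ 2 * (t ^ (1 - p) * (w y)⁻¹)) := by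
              congr 1; ext x; rw [wlk_symm]; ring
          _ = (∫⁻ x, (‖wlk μ (y - x)‖ₑ * w x ^ p)) * (‖f y‖ₑ ^ 2 * (t ^ (1 - p) * (w y)⁻¹)) := by
              apply lintegral_mul_const
              exact (hkx y).enorm.mul (hw.pow_const p)
          _ ≤ B * (‖f y‖ₑ ^ 2 * (t ^ (1 - p) * (w y)⁻¹)) := by gcongr; exact hB y
          _ = _ := by ring
    _ = _ := by
        rw [lintegral_const_mul' _ _ (by finiteness)]; ring
end blk


section geo

theorem wl_geo (p : ℝ) (hp : 1 < p) : ∃ C : ℝ≥0∞, C ≠ ⊤ ∧ ∀ l : ℝ, 0 < l →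
    ∑' m : ℤ, ENNReal.ofReal (min ((2:ℝ) ^ ((m:ℝ) / 2)) (l ^ p * (2:ℝ) ^ (-((m:ℝ) * (p - 1) / 2)))) ≤ C * ENNReal.ofReal l := by
  set g : ℤ → ℝ := fun i => (2:ℝ) ^ ((p - 1) / 2) * (min ((2:ℝ) ^ ((i:ℝ) / 2)) ((2:ℝ) ^ (-((i:ℝ) * (p - 1) / 2)))) with hg
  have h2 : (1:ℝ) ≤ (2:ℝ) ^ ((p - 1) / 2) := Real.one_le_rpow (by norm_num) (by linarith)
  refine ⟨∑' i : ℤ, ENNReal.ofReal (g i), ?_, ?_⟩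
  · apply Summable.tsum_ofReal_ne_top
    apply Summable.mul_left
    have hr1 : ∀ c : ℝ, 0 < c → Summable (fun n : ℕ => (2:ℝ) ^ (-((n:ℝ) * c))) := by
      intro c hc
      have : (2:ℝ) ^ (-c) < 1 := Real.rpow_lt_one_of_one_lt_of_neg (by norm_num) (by linarith)
      convert! summable_geometric_of_lt_one (by positivity) this using 2 with n
      rw [← Real.rpow_natCast, ← Real.rpow_mul (by norm_num)]
      congr 1; ring
    apply Summable.of_nat_of_neg
    · refine Summable.of_nonneg_of_le (fun n => by positivity) (fun n => min_le_right _ _) ?_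
      convert! hr1 ((p - 1) / 2) (by linarith) using 4 with n
      push_cast; ring
    · refine Summable.of_nonneg_of_le (fun n => by positivity) (fun n => min_le_left _ _) ?_
      convert! hr1 (1 / 2) (by norm_num) using 3 with n
      push_cast; ring
  · intro l hl
    set L : ℝ := 2 * Real.logb 2 l with hL
    have hl2 : l = (2:ℝ) ^ (L / 2) := by
      rw [hL, mul_div_cancel_left₀ _ (by norm_num)]
      exact (Real.rpow_logb (by norm_num) (by norm_num) hl).symm
    set m0 : ℤ := ⌊L⌋ with hm0
    rw [← ENNReal.tsum_mul_right, ← (Equiv.addLeft m0).tsum_eq]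
    apply ENNReal.tsum_le_tsum
    intro i
    have f1 : (m0:ℝ) ≤ L := Int.floor_le L
    have f2 : L < m0 + 1 := Int.lt_floor_add_one L
    rw [← ENNReal.ofReal_mul (by positivity)]
    apply ENNReal.ofReal_le_ofReal
    simp only [Equiv.coe_addLeft, hg]
    push_cast
    rw [mul_right_comm, mul_min_of_nonneg _ _ (by positivity), hl2, ← Real.rpow_mul (by norm_num), ← Real.rpow_add (by norm_num),
      ← Real.rpow_add (by norm_num), ← Real.rpow_add (by norm_num), ← Real.rpow_add (by norm_num)]
    apply min_le_min
    · apply Real.rpow_le_rpow_of_exponent_le (by norm_num)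
      linarith
    · apply Real.rpow_le_rpow_of_exponent_le (by norm_num)
      nlinarith

/-- Cauchy-Schwarz summation over dyadic blocks. -/
theorem wl_blocks {E : Type*} [MeasurableSpace E] {μ : Measure E} [SFinite μ] {ν : Measure ℝ} [SFinite ν]
    {w : E → ℝ≥0∞} (hw : Measurable w)
    (Ω : ℤ → Set E) (hΩ : ∀ k, MeasurableSet (Ω k)) (hdis : Pairwise (Function.onFun Disjoint Ω))
    {T : ℝ → ℤ → E → ℝ≥0∞} (hT : ∀ k, Measurable (fun z : ℝ × E => T z.1 k z.2))
    {c : ℝ → ℤ → ℝ≥0∞} (hc : ∀ k, Measurable (fun Y => c Y k)) (hc0 : ∀ᵐ Y ∂ν, ∀ k, c Y k ≠ 0) (hct : ∀ᵐ Y ∂ν, ∀ k, c Y k ≠ ⊤)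
    (A : ℤ → ℝ≥0∞) {S : ℝ≥0∞} (hSt : S ≠ ⊤)
    (h : ∀ᵐ Y ∂ν, ∀ j k, ∫⁻ x in Ω j, w x * T Y k x ^ 2 ∂μ ≤ c Y (j + k) ^ 2 * A k)
    (hS : ∫⁻ Y, ∑' m, c Y m ∂ν ≤ S) :
    ∫⁻ x in ⋃ j, Ω j, w x * (∫⁻ Y, ∑' k, T Y k x ∂ν) ^ 2 ∂μ ≤ S ^ 2 * ∑' k, A k := by
  have hshift : ∀ (j : ℤ) (Y : ℝ), ∑' k, c Y (j + k) = ∑' m, c Y m := fun j Y => (Equiv.addLeft j).tsum_eq (fun m => c Y m)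
  have hshift' : ∀ (k : ℤ) (Y : ℝ), ∑' j, c Y (j + k) = ∑' m, c Y m := fun j Y => (Equiv.addRight j).tsum_eq (fun m => c Y m)
  have hcs : ∀ (j : ℤ) (x : E), (∫⁻ Y, ∑' k, T Y k x ∂ν) ^ 2 ≤ S * ∫⁻ Y, ∑' k, T Y k x ^ 2 * (c Y (j + k))⁻¹ ∂ν := by
    intro j x
    have hTx : ∀ k, Measurable (fun Y => T Y k x) := fun k => (hT k).comp (measurable_id.prodMk measurable_const)
    have hTm : Measurable (fun z : ℝ × ℤ => T z.1 z.2 x) := measurable_from_prod_countable_left hTx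
    have hcm : Measurable (fun z : ℝ × ℤ => c z.1 (j + z.2)) := measurable_from_prod_countable_left (fun k => hc (j + k))
    have h0 := wl_cs (ν := ν.prod (Measure.count : Measure ℤ)) (K := fun _ => 1) (F := fun z => T z.1 z.2 x)
      (θ := fun z => c z.1 (j + z.2)) (by fun_prop) hTm.aemeasurable hcm.aemeasurable
      (by
        have := Measure.ae_prod_mem_iff_ae_ae_mem (μ := ν) (ν := (Measure.count : Measure ℤ)) (s := {z | c z.1 (j + z.2) ≠ 0}) (hcm (measurableSet_singleton 0).compl)
        refine this.2 ?_
        filter_upwards [hc0] with Y hY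
        exact Filter.Eventually.of_forall (fun k => hY _))
      (by
        have := Measure.ae_prod_mem_iff_ae_ae_mem (μ := ν) (ν := (Measure.count : Measure ℤ)) (s := {z | c z.1 (j + z.2) ≠ ⊤}) (hcm (measurableSet_singleton ⊤).compl)
        refine this.2 ?_
        filter_upwards [hct] with Y hY
        exact Filter.Eventually.of_forall (fun k => hY _))
    simp only [one_mul] at h0
    rw [lintegral_prod _ hTm.aemeasurable, lintegral_prod _ hcm.aemeasurable, lintegral_prod (fun z : ℝ × ℤ => T z.1 z.2 x ^ 2 * (c z.1 (j + z.2))⁻¹) ((hTm.pow_const 2).mul hcm.inv).aemeasurable] at h0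
    simp only [lintegral_count, hshift] at h0
    refine h0.trans ?_
    rw [mul_comm]
    gcongr
  rw [lintegral_iUnion hΩ hdis]
  calc _ ≤ ∑' j, ∫⁻ x in Ω j, S * ∫⁻ Y, ∑' k, (w x * T Y k x ^ 2) * (c Y (j + k))⁻¹ ∂ν ∂μ := by
        apply ENNReal.tsum_le_tsum
        intro j
        apply lintegral_mono
        intro x
        have hTx : ∀ k, Measurable (fun Y => T Y k x) := fun k => (hT k).comp (measurable_id.prodMk measurable_const)
        calc w x * (∫⁻ Y, ∑' k, T Y k x ∂ν) ^ 2 ≤ w x * (S * ∫⁻ Y, ∑' k, T Y k x ^ 2 * (c Y (j + k))⁻¹ ∂ν) := by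
              gcongr; exact hcs j x
          _ = S * (w x * ∫⁻ Y, ∑' k, T Y k x ^ 2 * (c Y (j + k))⁻¹ ∂ν) := by ring
          _ = S * ∫⁻ Y, w x * ∑' k, T Y k x ^ 2 * (c Y (j + k))⁻¹ ∂ν := by
              rw [lintegral_const_mul]
              exact Measurable.ennreal_tsum (fun k => ((hTx k).pow_const 2).mul (hc _).inv)
          _ = _ := by simp only [← ENNReal.tsum_mul_left, mul_assoc]
    _ = ∑' j, S * ∫⁻ Y, ∑' k, (c Y (j + k))⁻¹ * ∫⁻ x in Ω j, (w x * T Y k x ^ 2) ∂μ ∂ν := by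
        congr 1; ext j
        rw [lintegral_const_mul' _ _ hSt]
        congr 1
        have hm : ∀ k, Measurable (fun z : ℝ × E => (w z.2 * T z.1 k z.2 ^ 2) * (c z.1 (j + k))⁻¹) := fun k =>
          ((hw.comp measurable_snd).mul ((hT k).pow_const 2)).mul ((hc _).inv.comp measurable_fst)
        rw [lintegral_lintegral_swap]
        · congr 1; ext Y
          have hTY : ∀ k, Measurable (fun x => T Y k x) := fun k => (hT k).comp (measurable_const.prodMk measurable_id)
          rw [lintegral_tsum]
          · congr 1; ext k
            rw [mul_comm]
            exact lintegral_mul_const _ (hw.mul ((hTY k).pow_const 2))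
          · intro k
            exact ((hw.mul ((hTY k).pow_const 2)).mul_const _).aemeasurable
        · exact ((Measurable.ennreal_tsum hm).comp measurable_swap).aemeasurable
    _ ≤ ∑' j, S * ∫⁻ Y, ∑' k, c Y (j + k) * A k ∂ν := by
        apply ENNReal.tsum_le_tsum
        intro j
        apply mul_le_mul' le_rfl
        apply lintegral_mono_ae
        filter_upwards [h, hc0, hct] with Y hY h0 ht
        apply ENNReal.tsum_le_tsum
        intro k
        calc _ ≤ (c Y (j + k))⁻¹ * (c Y (j + k) ^ 2 * A k) := mul_le_mul' le_rfl (hY j k)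
          _ = ((c Y (j + k))⁻¹ * c Y (j + k)) * c Y (j + k) * A k := by ring
          _ = _ := by rw [ENNReal.inv_mul_cancel (h0 _) (ht _), one_mul]
    _ = S * ∫⁻ Y, ∑' j, ∑' k, c Y (j + k) * A k ∂ν := by
        rw [ENNReal.tsum_mul_left, lintegral_tsum]
        intro j
        exact (Measurable.ennreal_tsum (fun k => (hc _).mul_const _)).aemeasurable
    _ = S * ∫⁻ Y, (∑' m, c Y m) * ∑' k, A k ∂ν := by
        congr 2; ext Y
        rw [ENNReal.tsum_comm]
        simp_rw [ENNReal.tsum_mul_right, hshift']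
        rw [ENNReal.tsum_mul_left]
    _ = S * ((∫⁻ Y, ∑' m, c Y m ∂ν) * ∑' k, A k) := by
        rw [lintegral_mul_const]
        exact Measurable.ennreal_tsum (fun k => hc _)
    _ ≤ S * (S * ∑' k, A k) := by gcongr
    _ = _ := by ring

end geo


def wlOm {E : Type*} (w : E → ℝ≥0∞) (k : ℤ) : Set E :=
  {y | ENNReal.ofReal ((2:ℝ) ^ (k:ℝ)) ≤ w y ∧ w y < ENNReal.ofReal ((2:ℝ) ^ ((k:ℝ) + 1))}

theorem wlOm_meas {E : Type*} [MeasurableSpace E] {w : E → ℝ≥0∞} (hw : Measurable w) (k : ℤ) : MeasurableSet (wlOm w k) :=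
  (measurableSet_le measurable_const hw).inter (measurableSet_lt hw measurable_const)

theorem wlOm_disj {E : Type*} (w : E → ℝ≥0∞) : Pairwise (Function.onFun Disjoint (wlOm w)) := by
  have key : ∀ k l : ℤ, k < l → Disjoint (wlOm w k) (wlOm w l) := by
    intro k l hkl
    rw [Set.disjoint_left]
    rintro y ⟨_, h1⟩ ⟨h2, _⟩
    have h3 : (2:ℝ) ^ ((k:ℝ) + 1) ≤ (2:ℝ) ^ (l:ℝ) := by
      apply Real.rpow_le_rpow_of_exponent_le (by norm_num)
      exact_mod_cast hkl
    exact absurd (h1.trans_le ((ENNReal.ofReal_le_ofReal h3).trans h2)) (lt_irrefl _)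
  intro k l hkl
  rcases lt_or_gt_of_ne hkl with h | h
  · exact key k l h
  · exact (key l k h).symm

theorem wlOm_iUnion {E : Type*} {w : E → ℝ≥0∞} (hwt : ∀ x, w x ≠ ⊤) : ⋃ k, wlOm w k = {x | w x ≠ 0} := by
  ext x
  simp only [Set.mem_iUnion, Set.mem_ofPred_eq]
  constructor
  · rintro ⟨k, hk, _⟩ h0
    rw [h0] at hk
    have : (0:ℝ) < (2:ℝ) ^ (k:ℝ) := by positivity
    exact absurd hk (by simpa using this)
  · intro h0
    set r := (w x).toReal with hr
    have hr0 : 0 < r := ENNReal.toReal_pos h0 (hwt x)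
    have hwr : w x = ENNReal.ofReal r := (ENNReal.ofReal_toReal (hwt x)).symm
    have e : r = (2:ℝ) ^ (Real.logb 2 r) := (Real.rpow_logb (by norm_num) (by norm_num) hr0).symm
    refine ⟨⌊Real.logb 2 r⌋, ?_, ?_⟩
    · rw [hwr]
      apply ENNReal.ofReal_le_ofReal
      conv_rhs => rw [e]
      exact Real.rpow_le_rpow_of_exponent_le (by norm_num) (Int.floor_le _)
    · rw [hwr, ENNReal.ofReal_lt_ofReal_iff (by positivity)]
      conv_lhs => rw [e]
      exact Real.rpow_lt_rpow_of_exponent_lt (by norm_num) (Int.lt_floor_add_one _)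

section pb
variable {E : Type*} [NormedAddCommGroup E] [InnerProductSpace ℝ E] [FiniteDimensional ℝ E]
  [MeasurableSpace E] [BorelSpace E]

theorem wl_schurB {p : ℝ} {w : E → ℝ≥0∞} (hw : Measurable w) (h : wlH p w) {a Y : ℝ} (hY : 0 < Y) (hYa : Y < |a|) (x : E) :
    ∫⁻ y, ‖wlk (wlmu a Y) (x - y)‖ₑ * w y ^ p ≤
      ENNReal.ofReal (2 * wlc E / √|a| * (Y / (2 * √|a|)) ^ (-((Module.finrank ℝ E : ℝ) - 2 * p))) * wlG ((Module.finrank ℝ E : ℝ) - 2 * p) := by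
  have ha : 0 < |a| := hY.trans hYa
  have hc := wlc_pos E
  have hκ : 0 < Y / (2 * √|a|) := by positivity
  have hs1 : √|a| ≤ √(|a| + Y) := Real.sqrt_le_sqrt (by linarith)
  have hs2 : √(|a| + Y) ≤ 2 * √|a| := by
    rw [show 2 * √|a| = √(4 * |a|) by rw [Real.sqrt_mul (by norm_num), show (4:ℝ) = 2 ^ 2 by norm_num, Real.sqrt_sq (by norm_num)]]
    exact Real.sqrt_le_sqrt (by linarith)
  have hs0 : 0 < √|a| := by positivity
  calc _ ≤ ∫⁻ y, ENNReal.ofReal (2 * wlc E / √|a|) * (ENNReal.ofReal (Real.exp (-(Y / (2 * √|a|) * ‖x - y‖))) * w y ^ p) := by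
        apply lintegral_mono
        intro y
        simp only
        rw [← mul_assoc, ← ENNReal.ofReal_mul (by positivity), ← ofReal_norm]
        gcongr
        refine (wlk_norm_le hY _).trans ?_
        gcongr
    _ = ENNReal.ofReal (2 * wlc E / √|a|) * ∫⁻ y, (ENNReal.ofReal (Real.exp (-(Y / (2 * √|a|) * ‖x - y‖))) * w y ^ p) :=
        lintegral_const_mul' _ _ (by finiteness)
    _ ≤ _ := by
        rw [ENNReal.ofReal_mul (by positivity), mul_assoc]
        exact mul_le_mul' le_rfl (wl_layer_w hw h hκ x)

/-- the weights `c(Y,m)` -/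
def wlcc (p δ α Y : ℝ) (m : ℤ) : ℝ :=
  Y ^ (-2:ℝ) * min ((2:ℝ) ^ ((m:ℝ) / 2)) ((Y * (Y / α) ^ (δ / p)) ^ p * (2:ℝ) ^ (-((m:ℝ) * (p - 1) / 2)))

theorem wlcc_pos {p δ α Y : ℝ} (hY : 0 < Y) (hα : 0 < α) (m : ℤ) : 0 < wlcc p δ α Y m := by
  unfold wlcc
  positivity

theorem wl_blockB {p δ : ℝ} (hδ : δ = p - ((Module.finrank ℝ E : ℝ) - 1) / 2) (hp : 1 < p) {K0 : ℝ} (hK2 : 2 ≤ K0)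
    (hK : 2 * wlc E * (2:ℝ) ^ ((Module.finrank ℝ E : ℝ) - 2 * p) * (wlG ((Module.finrank ℝ E : ℝ) - 2 * p)).toReal ≤ K0)
    {w : E → ℝ≥0∞} (hw : Measurable w) (hwt : ∀ x, w x ≠ ⊤) (h : wlH p w)
    {a Y : ℝ} (hY : 0 < Y) (hYa : Y < |a|) {f : E → ℂ} (hf : Measurable f) (hfi : Integrable f) (j k : ℤ) :
    ∫⁻ x in wlOm w j, w x * (ENNReal.ofReal (Y ^ (((Module.finrank ℝ E : ℝ) - 1) / 2 - 1)) * ‖∫ y in wlOm w k, wlk (wlmu a Y) (x - y) * f y‖ₑ) ^ 2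
      ≤ ENNReal.ofReal (K0 * wlcc p δ |a| Y (j + k)) ^ 2 * ∫⁻ y in wlOm w k, ‖f y‖ₑ ^ 2 * (w y)⁻¹ := by
  set d : ℝ := (Module.finrank ℝ E : ℝ) with hd
  set A := ∫⁻ y in wlOm w k, ‖f y‖ₑ ^ 2 * (w y)⁻¹ with hA
  have hα : 0 < |a| := hY.trans hYa
  set α := |a| with hαd
  have hc := wlc_pos E
  have e0 : ∫⁻ x in wlOm w j, w x * (ENNReal.ofReal (Y ^ ((d - 1) / 2 - 1)) * ‖∫ y in wlOm w k, wlk (wlmu a Y) (x - y) * f y‖ₑ) ^ 2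
     = ENNReal.ofReal (Y ^ ((d - 1) / 2 - 1)) ^ 2 * ∫⁻ x in wlOm w j, w x * ‖∫ y in wlOm w k, wlk (wlmu a Y) (x - y) * f y‖ₑ ^ 2 := by
    rw [← lintegral_const_mul' _ _ (by finiteness)]
    congr 1; ext x; ring
  rw [e0]
  have hi := wl_block_i (a := a) hY hw hfi (u := ENNReal.ofReal ((2:ℝ) ^ ((j:ℝ) + 1))) (v := ENNReal.ofReal ((2:ℝ) ^ ((k:ℝ) + 1)))
    (by finiteness) (wlOm w j) (wlOm w k) (wlOm_meas hw j) (wlOm_meas hw k) (fun x hx => hx.2.le) (fun x hx => hx.2.le)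
    (fun x hx => by
      intro h0
      have := hx.1
      rw [h0] at this
      have h2 : (0:ℝ) < (2:ℝ) ^ (k:ℝ) := by positivity
      exact absurd this (by simpa using h2))
  have hpos2 : ∀ m : ℤ, ENNReal.ofReal ((2:ℝ) ^ (m:ℝ)) ≠ 0 := by
    intro m
    have h2 : (0:ℝ) < (2:ℝ) ^ (m:ℝ) := by positivity
    simpa using h2
  have hGt := wlG_ne_top (d - 2 * p)
  have hii := wl_block_ii (μ := wlmu a Y) hp hw hwt hf (by finiteness) (wl_schurB hw h hY hYa) (hpos2 j) (hpos2 k) (by finiteness) (by finiteness)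
    (wlOm w j) (wlOm w k) (wlOm_meas hw j) (wlOm_meas hw k) (fun x hx => hx.1) (fun x hx => hx.1)
  rw [← hA, ← hd] at hi hii
  unfold wlcc
  rcases min_choice ((2:ℝ) ^ (((j + k : ℤ):ℝ) / 2)) ((Y * (Y / α) ^ (δ / p)) ^ p * (2:ℝ) ^ (-(((j + k : ℤ):ℝ) * (p - 1) / 2))) with hm | hm
  · rw [hm]
    refine (mul_le_mul' le_rfl hi).trans ?_
    have : ENNReal.ofReal (Y ^ ((d - 1) / 2 - 1)) ^ 2 * (ENNReal.ofReal ((2:ℝ) ^ ((j:ℝ) + 1)) * (ENNReal.ofReal (Y ^ (-((d + 1) / 2))) ^ 2 * (ENNReal.ofReal ((2:ℝ) ^ ((k:ℝ) + 1)) * A)))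
      = ENNReal.ofReal (2 * (Y ^ (-2:ℝ) * (2:ℝ) ^ (((j + k : ℤ):ℝ) / 2))) ^ 2 * A := by
      rw [← ENNReal.ofReal_pow (by positivity), ← ENNReal.ofReal_pow (by positivity), ← ENNReal.ofReal_pow (by positivity)]
      simp only [← mul_assoc]
      rw [← ENNReal.ofReal_mul (by positivity), ← ENNReal.ofReal_mul (by positivity), ← ENNReal.ofReal_mul (by positivity)]
      congr 2
      have e1 : Y ^ (-2:ℝ) = Y ^ ((d - 1) / 2 - 1) * Y ^ (-((d + 1) / 2)) := by
        rw [← Real.rpow_add hY]; congr 1; ring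
      have e2 : (2:ℝ) ^ (((j + k : ℤ):ℝ) / 2) * (2:ℝ) ^ (((j + k : ℤ):ℝ) / 2) = 2 ^ (j:ℝ) * 2 ^ (k:ℝ) := by
        rw [← Real.rpow_add (by norm_num), ← Real.rpow_add (by norm_num)]; congr 1; push_cast; ring
      rw [e1, Real.rpow_add (by norm_num), Real.rpow_add (by norm_num), Real.rpow_one]
      linear_combination (-4 * (Y ^ ((d - 1) / 2 - 1)) ^ 2 * (Y ^ (-((d + 1) / 2))) ^ 2) * e2
    rw [this]
    gcongr
  · rw [hm]
    refine (mul_le_mul' le_rfl hii).trans ?_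
    have eG : wlG (d - 2 * p) = ENNReal.ofReal (wlG (d - 2 * p)).toReal := (ENNReal.ofReal_toReal hGt).symm
    set G := (wlG (d - 2 * p)).toReal
    have hG0 : 0 ≤ G := ENNReal.toReal_nonneg
    rw [eG, ENNReal.ofReal_rpow_of_pos (by positivity), ENNReal.ofReal_rpow_of_pos (by positivity)]
    have : ENNReal.ofReal (Y ^ ((d - 1) / 2 - 1)) ^ 2 * ((ENNReal.ofReal (2 * wlc E / √α * (Y / (2 * √α)) ^ (-(d - 2 * p))) * ENNReal.ofReal G) ^ 2 *
        (ENNReal.ofReal (((2:ℝ) ^ (j:ℝ)) ^ (1 - p)) * ENNReal.ofReal (((2:ℝ) ^ (k:ℝ)) ^ (1 - p))) * A)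
      = ENNReal.ofReal ((2 * wlc E * (2:ℝ) ^ (d - 2 * p) * G) * (Y ^ (-2:ℝ) * ((Y * (Y / α) ^ (δ / p)) ^ p * (2:ℝ) ^ (-(((j + k : ℤ):ℝ) * (p - 1) / 2))))) ^ 2 * A := by
      rw [← ENNReal.ofReal_mul (by positivity), ← ENNReal.ofReal_mul (by positivity)]
      rw [← ENNReal.ofReal_pow (by positivity), ← ENNReal.ofReal_pow (by positivity), ← ENNReal.ofReal_pow (by positivity)]
      simp only [← mul_assoc]
      rw [← ENNReal.ofReal_mul (by positivity), ← ENNReal.ofReal_mul (by positivity)]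
      congr 2
      have e1 : (Y / (2 * √α)) ^ (-(d - 2 * p)) = Y ^ (-(d - 2 * p)) * 2 ^ (d - 2 * p) * α ^ ((d - 2 * p) / 2) := by
        rw [Real.div_rpow hY.le (by positivity), Real.mul_rpow (by norm_num) (by positivity), Real.sqrt_eq_rpow, ← Real.rpow_mul hα.le,
          Real.rpow_neg (by norm_num : (0:ℝ) ≤ 2), show 1 / 2 * -(d - 2 * p) = -((d - 2 * p) / 2) by ring, Real.rpow_neg hα.le]
        field_simp
      have e2 : (Y * (Y / α) ^ (δ / p)) ^ p = Y ^ p * Y ^ δ * α ^ (-δ) := by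
        rw [Real.mul_rpow hY.le (by positivity), ← Real.rpow_mul (by positivity), div_mul_cancel₀ _ (by linarith),
          Real.div_rpow hY.le hα.le, Real.rpow_neg hα.le]
        field_simp
      have e3 : 1 / √α = α ^ (-(1/2:ℝ)) := by
        rw [Real.rpow_neg hα.le, Real.sqrt_eq_rpow, one_div]
      have e4 : Y ^ (-2:ℝ) * (Y ^ p * Y ^ δ) = Y ^ ((d - 1) / 2 - 1) * Y ^ (-(d - 2 * p)) := by
        rw [← Real.rpow_add hY, ← Real.rpow_add hY, ← Real.rpow_add hY]; congr 1; rw [hδ]; ring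
      have e5 : α ^ (-δ) = α ^ (-(1/2:ℝ)) * α ^ ((d - 2 * p) / 2) := by
        rw [← Real.rpow_add hα]; congr 1; rw [hδ]; ring
      have e6 : ((2:ℝ) ^ (-(((j + k : ℤ):ℝ) * (p - 1) / 2))) ^ 2 = ((2:ℝ) ^ (j:ℝ)) ^ (1 - p) * ((2:ℝ) ^ (k:ℝ)) ^ (1 - p) := by
        rw [← Real.rpow_natCast, ← Real.rpow_mul (by norm_num), ← Real.rpow_mul (by norm_num), ← Real.rpow_mul (by norm_num), ← Real.rpow_add (by norm_num)]
        congr 1; push_cast; ring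
      have e7 : (2 * wlc E * (2:ℝ) ^ (d - 2 * p) * G) * Y ^ (-2:ℝ) * (Y * (Y / α) ^ (δ / p)) ^ p =
          Y ^ ((d - 1) / 2 - 1) * (2 * wlc E / √α * (Y / (2 * √α)) ^ (-(d - 2 * p)) * G) := by
        rw [e1, e2, e5, show 2 * wlc E / √α = 2 * wlc E * (1 / √α) by ring, e3]
        linear_combination (2 * wlc E * (2:ℝ) ^ (d - 2 * p) * G * α ^ (-(1/2:ℝ)) * α ^ ((d - 2 * p) / 2)) * e4
      rw [e7, ← e6]; ring
    rw [this]
    gcongr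

theorem wl_sumB {p δ : ℝ} (hp : 1 < p) (hδ : 0 < δ) : ∃ S : ℝ≥0∞, S ≠ ⊤ ∧ ∀ α : ℝ, 0 < α →
    ∫⁻ Y in Set.Ioo (0:ℝ) α, ∑' m : ℤ, ENNReal.ofReal (wlcc p δ α Y m) ≤ S := by
  obtain ⟨C, hC, h⟩ := wl_geo p hp
  refine ⟨C * ENNReal.ofReal (p / δ), by finiteness, fun α hα => ?_⟩
  have hq : 0 < δ / p := by positivity
  calc _ ≤ ∫⁻ Y in Set.Ioo (0:ℝ) α, C * ENNReal.ofReal (Y ^ (δ / p - 1) * α ^ (-(δ / p))) := by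
        apply setLIntegral_mono' measurableSet_Ioo
        intro Y hY
        have hY0 : 0 < Y := hY.1
        have hl : 0 < Y * (Y / α) ^ (δ / p) := by positivity
        unfold wlcc
        simp_rw [ENNReal.ofReal_mul (show (0:ℝ) ≤ Y ^ (-2:ℝ) by positivity)]
        rw [ENNReal.tsum_mul_left]
        refine (mul_le_mul' le_rfl (h _ hl)).trans (le_of_eq ?_)
        rw [mul_left_comm, ← ENNReal.ofReal_mul (by positivity)]
        congr 2
        rw [Real.div_rpow hY0.le hα.le, Real.rpow_neg hα.le, Real.rpow_sub hY0, Real.rpow_one, Real.rpow_neg hY0.le]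
        norm_num
        field_simp
    _ = C * ∫⁻ Y in Set.Ioo (0:ℝ) α, ENNReal.ofReal (Y ^ (δ / p - 1) * α ^ (-(δ / p))) := lintegral_const_mul' _ _ hC
    _ = _ := by
        congr 1
        have hintg : IntervalIntegrable (fun Y : ℝ => Y ^ (δ / p - 1)) volume 0 α := intervalIntegral.intervalIntegrable_rpow' (by linarith)
        rw [← Measure.restrict_congr_set Ioo_ae_eq_Ioc.symm] 
        rw [← ofReal_integral_eq_lintegral_ofReal]
        · rw [← intervalIntegral.integral_of_le hα.le, intervalIntegral.integral_mul_const, integral_rpow (Or.inl (by linarith))]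
          congr 1
          rw [sub_add_cancel, Real.zero_rpow hq.ne', sub_zero, Real.rpow_neg hα.le]
          field_simp
        · exact (hintg.mul_const _).1
        · filter_upwards [ae_restrict_mem measurableSet_Ioc] with Y hY
          have := hY.1
          simp only [Pi.zero_apply]; positivity
end pb


section pb
variable {E : Type*} [NormedAddCommGroup E] [InnerProductSpace ℝ E] [FiniteDimensional ℝ E]
  [MeasurableSpace E] [BorelSpace E]

theorem wlk_meas3 (a : ℝ) {f : E → ℂ} (hf : Measurable f) :
    Measurable (fun z : (ℝ × E) × E => wlk (wlmu a z.1.1) (z.1.2 - z.2) * f z.2) := by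
  have h1 : Measurable (fun z : (ℝ × E) × E => wlmu a z.1.1) := by
    unfold wlmu; fun_prop
  have h2 : Measurable (fun z : (ℝ × E) × E => ((‖z.1.2 - z.2‖ : ℝ) : ℂ)) := by fun_prop
  have h3 : Measurable (fun z : (ℝ × E) × E => f z.2) := hf.comp measurable_snd
  unfold wlk
  exact ((h1.const_div _).mul (((h1.const_mul _).mul h2).neg.cexp)).mul h3

theorem wlk_integrable {a Y : ℝ} (hY : 0 < Y) {f : E → ℂ} (hf : Integrable f) (x : E) :
    Integrable (fun y => wlk (wlmu a Y) (x - y) * f y) := by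
  refine hf.bdd_mul (c := 2 * wlc E / √(|a| + Y)) ?_ ?_
  · apply Measurable.aestronglyMeasurable
    unfold wlk; fun_prop
  · refine Filter.Eventually.of_forall fun y => ?_
    refine (wlk_norm_le hY _).trans ?_
    have hc := wlc_pos E
    apply mul_le_of_le_one_right (by positivity)
    rw [Real.exp_le_one_iff]
    have : 0 ≤ Y / √(|a| + Y) * ‖x - y‖ := by positivity
    linarith

theorem wl_partB (p : ℝ) (hp : 1 < p) (hp1 : ((Module.finrank ℝ E : ℝ) - 1) / 2 < p) :
    ∃ C : ℝ≥0∞, C ≠ ⊤ ∧ ∀ w : E → ℝ≥0∞, Measurable w → (∀ x, w x ≠ ⊤) → wlH p w →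
    ∀ (a : ℝ) (f : E → ℂ), Measurable f → Integrable f → (∀ᵐ y, w y = 0 → f y = 0) →
    ∫⁻ x, w x * (∫⁻ Y in Set.Ioo (0:ℝ) |a|, ENNReal.ofReal (Y ^ (((Module.finrank ℝ E : ℝ) - 1) / 2 - 1)) *
        ‖∫ y, wlk (wlmu a Y) (x - y) * f y‖ₑ) ^ 2
      ≤ C * ∫⁻ y, ‖f y‖ₑ ^ 2 * (w y)⁻¹ := by
  set d : ℝ := (Module.finrank ℝ E : ℝ) with hd
  set δ := p - (d - 1) / 2 with hδ
  have hδ0 : 0 < δ := by linarith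
  obtain ⟨S, hSt, hS⟩ := wl_sumB hp hδ0
  set K0 := max 2 (2 * wlc E * (2:ℝ) ^ (d - 2 * p) * (wlG (d - 2 * p)).toReal) with hK0
  have hK0p : 0 < K0 := lt_of_lt_of_le (by norm_num) (le_max_left _ _)
  refine ⟨(ENNReal.ofReal K0 * S) ^ 2, by finiteness, ?_⟩
  intro w hw hwt hH a f hf hfi hf0
  by_cases ha : |a| = 0
  · simp [ha]
  have hα : 0 < |a| := lt_of_le_of_ne (abs_nonneg _) (Ne.symm ha)
  set T : ℝ → ℤ → E → ℝ≥0∞ := fun Y k x => ENNReal.ofReal (Y ^ ((d - 1) / 2 - 1)) * ‖∫ y in wlOm w k, wlk (wlmu a Y) (x - y) * f y‖ₑ with hT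
  have hTm : ∀ k, Measurable (fun z : ℝ × E => T z.1 k z.2) := by
    intro k
    have h1 := (wlk_meas3 a hf).stronglyMeasurable.integral_prod_right' (ν := volume.restrict (wlOm w k))
    have h2 : Measurable (fun z : ℝ × E => ENNReal.ofReal (z.1 ^ ((d - 1) / 2 - 1))) := by fun_prop
    exact h2.mul h1.measurable.enorm
  have hcm : ∀ k : ℤ, Measurable (fun Y => ENNReal.ofReal (K0 * wlcc p δ |a| Y k)) := by
    intro k; unfold wlcc; fun_prop
  have hmain := wl_blocks (μ := (volume : Measure E)) (ν := volume.restrict (Set.Ioo (0:ℝ) |a|)) hw (wlOm w) (wlOm_meas hw) (wlOm_disj w)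
    hTm hcm (by
      filter_upwards [ae_restrict_mem measurableSet_Ioo] with Y hY k
      have := wlcc_pos (p := p) (δ := δ) hY.1 hα k
      have : 0 < K0 * wlcc p δ |a| Y k := by positivity
      simpa using this)
    (Filter.Eventually.of_forall fun Y k => by finiteness)
    (fun k => ∫⁻ y in wlOm w k, ‖f y‖ₑ ^ 2 * (w y)⁻¹) (S := ENNReal.ofReal K0 * S) (by finiteness)
    (by
      filter_upwards [ae_restrict_mem measurableSet_Ioo] with Y hY j k
      exact wl_blockB hδ hp (le_max_left _ _) (le_max_right _ _) hw hwt hH hY.1 hY.2 hf hfi j k)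
    (by
      simp_rw [ENNReal.ofReal_mul hK0p.le, ENNReal.tsum_mul_left]
      rw [lintegral_const_mul' _ _ (by finiteness)]
      exact mul_le_mul' le_rfl (hS _ hα))
  rw [wlOm_iUnion hwt] at hmain
  have hmeas0 : MeasurableSet {x | w x ≠ 0} := hw (measurableSet_singleton 0).compl
  have hA : ∑' k, ∫⁻ y in wlOm w k, ‖f y‖ₑ ^ 2 * (w y)⁻¹ ≤ ∫⁻ y, ‖f y‖ₑ ^ 2 * (w y)⁻¹ := by
    rw [← lintegral_iUnion (wlOm_meas hw) (wlOm_disj w)]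
    exact setLIntegral_le_lintegral _ _
  refine le_trans ?_ (hmain.trans (mul_le_mul' le_rfl hA))
  calc _ ≤ ∫⁻ x, w x * (∫⁻ Y in Set.Ioo (0:ℝ) |a|, ∑' k, T Y k x) ^ 2 := by
        apply lintegral_mono
        intro x
        apply mul_le_mul' le_rfl
        apply pow_le_pow_left'
        apply setLIntegral_mono' measurableSet_Ioo
        intro Y hY
        simp only [hT]
        rw [ENNReal.tsum_mul_left]
        apply mul_le_mul' le_rfl
        have e : ∫ y, wlk (wlmu a Y) (x - y) * f y = ∫ y in ⋃ k, wlOm w k, wlk (wlmu a Y) (x - y) * f y := by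
          rw [wlOm_iUnion hwt]
          symm
          apply setIntegral_eq_integral_of_ae_compl_eq_zero
          filter_upwards [hf0] with y hy hy2
          rw [hy (by simpa using hy2), mul_zero]
        rw [e, integral_iUnion (wlOm_meas hw) (wlOm_disj w) (wlk_integrable hY.1 hfi x).integrableOn]
        exact enorm_tsum_le_tsum_enorm
    _ = _ := by
        rw [← lintegral_indicator hmeas0]
        congr 1; ext x
        by_cases hx : w x = 0 <;> simp [hx]

theorem wl_resA {a Y : ℝ} (hY : 0 < Y) (hYa : |a| ≤ Y) (f : E → ℂ) (x : E) :
    ENNReal.ofReal (Y ^ (((Module.finrank ℝ E : ℝ) - 1) / 2 - 1)) * ‖∫ y, wlk (wlmu a Y) (x - y) * f y‖ₑ ≤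
      ENNReal.ofReal (2 * wlc E) * ∫⁻ y, ENNReal.ofReal (Y ^ ((Module.finrank ℝ E : ℝ) / 2 - 2) * Real.exp (-(√Y / 2 * ‖x - y‖))) * ‖f y‖ₑ := by
  have hc := wlc_pos E
  set d : ℝ := (Module.finrank ℝ E : ℝ)
  have ha := abs_nonneg a
  have hs1 : √Y ≤ √(|a| + Y) := Real.sqrt_le_sqrt (by linarith)
  have hs2 : √(|a| + Y) ≤ 2 * √Y := by
    rw [show 2 * √Y = √(4 * Y) by rw [Real.sqrt_mul (by norm_num), show (4:ℝ) = 2 ^ 2 by norm_num, Real.sqrt_sq (by norm_num)]]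
    exact Real.sqrt_le_sqrt (by linarith)
  have hs0 : 0 < √Y := by positivity
  rw [← lintegral_const_mul' _ _ (by finiteness)]
  refine (mul_le_mul' le_rfl (enorm_integral_le_lintegral_enorm _)).trans ?_
  rw [← lintegral_const_mul' _ _ (by finiteness)]
  apply lintegral_mono
  intro y
  simp only
  rw [enorm_mul, ← mul_assoc, ← mul_assoc, ← ofReal_norm (wlk _ _), ← ENNReal.ofReal_mul (by positivity), ← ENNReal.ofReal_mul (by positivity)]
  refine mul_le_mul' (ENNReal.ofReal_le_ofReal ?_) le_rfl
  calc Y ^ ((d - 1) / 2 - 1) * ‖wlk (wlmu a Y) (x - y)‖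
      ≤ Y ^ ((d - 1) / 2 - 1) * (2 * wlc E / √(|a| + Y) * Real.exp (-(Y / √(|a| + Y) * ‖x - y‖))) := by
        gcongr; exact wlk_norm_le hY _
    _ ≤ Y ^ ((d - 1) / 2 - 1) * (2 * wlc E / √Y * Real.exp (-(√Y / 2 * ‖x - y‖))) := by
        have : √Y / 2 ≤ Y / √(|a| + Y) := by
          rw [div_le_div_iff₀ (by norm_num) (by positivity)]
          nlinarith [Real.mul_self_sqrt hY.le]
        gcongr
    _ = _ := by
        have : Y ^ ((d - 1) / 2 - 1) = Y ^ (d / 2 - 2) * √Y := by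
          rw [Real.sqrt_eq_rpow, ← Real.rpow_add hY]; congr 1; ring
        rw [this]
        field_simp

theorem wl_sq_add (A B : ℝ≥0∞) : (A + B) ^ 2 ≤ 2 * (A ^ 2 + B ^ 2) := by
  have := ENNReal.rpow_add_le_mul_rpow_add_rpow A B (p := 2) (by norm_num)
  norm_num at this
  simpa using this

theorem wl_thmR_pos (hd3 : 3 ≤ Module.finrank ℝ E) (p : ℝ) (hp : 1 < p) (hp1 : ((Module.finrank ℝ E : ℝ) - 1) / 2 < p) :
    ∃ C : ℝ≥0∞, C ≠ ⊤ ∧ ∀ w : E → ℝ≥0∞, Measurable w → (∀ x, w x ≠ ⊤) → wlH p w →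
    ∀ (a b : ℝ), 0 < b → ∀ (f : E → ℂ), Measurable f → Integrable f → Integrable (𝓕 f) →
    ∫⁻ x, w x * ‖∫ ξ, cexp (2 * Real.pi * (inner ℝ ξ x : ℝ) * I) * (𝓕 f ξ / ((‖ξ‖:ℂ) ^ 2 - (a + b * I)))‖ₑ ^ 2
      ≤ C * ∫⁻ y, ‖f y‖ₑ ^ 2 * (w y)⁻¹ := by
  obtain ⟨CA, hCA, hA⟩ := wl_partA (E := E) p hp
  obtain ⟨CB, hCB, hB⟩ := wl_partB (E := E) p hp hp1
  set d : ℝ := (Module.finrank ℝ E : ℝ) with hd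
  have hdp : 0 < (d - 1) / 2 := by
    have : (3:ℝ) ≤ d := by rw [hd]; exact_mod_cast hd3
    linarith
  set D := ENNReal.ofReal ((d - 1) / 2) with hD
  have hD0 : D ≠ 0 := by simpa [hD] using hdp
  refine ⟨D ^ 2 * (2 * (CB + ENNReal.ofReal (2 * wlc E) ^ 2 * CA)) + 1, by finiteness, ?_⟩
  intro w hw hwt hH a b hb f hf hfi hffi
  set N := ∫⁻ y, ‖f y‖ₑ ^ 2 * (w y)⁻¹ with hN
  by_cases hNt : N = ⊤
  · rw [hNt, ENNReal.mul_top (by simp)]; exact le_top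
  have hf0 : ∀ᵐ y, w y = 0 → f y = 0 := by
    have := ae_lt_top (by fun_prop) hNt
    filter_upwards [this] with y hy h0
    by_contra hfy
    rw [h0, ENNReal.inv_zero, ENNReal.mul_top (by simpa using hfy)] at hy
    exact absurd hy (lt_irrefl _)
  have hB' := hB w hw hwt hH a f hf hfi hf0
  have hA' := hA w hw hwt hH (fun y => ‖f y‖ₑ) hf.enorm
  set P : E → ℝ≥0∞ := fun x => ∫⁻ Y in Set.Ioo (0:ℝ) |a|, ENNReal.ofReal (Y ^ ((d - 1) / 2 - 1)) * ‖∫ y, wlk (wlmu a Y) (x - y) * f y‖ₑ with hP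
  set Q : E → ℝ≥0∞ := fun x => ∫⁻ Y in Set.Ioi (0:ℝ), ∫⁻ y, ENNReal.ofReal (Y ^ (d / 2 - 2) * Real.exp (-(√Y / 2 * ‖x - y‖))) * ‖f y‖ₑ with hQ
  have hPm : Measurable P := by
    have h1 := (wlk_meas3 a hf).stronglyMeasurable.integral_prod_right' (ν := (volume : Measure E))
    have h2 : Measurable (fun z : ℝ × E => ENNReal.ofReal (z.1 ^ ((d - 1) / 2 - 1))) := by fun_prop
    exact (h2.mul h1.measurable.enorm).lintegral_prod_left'
  have hpt : ∀ x, ‖∫ ξ, cexp (2 * Real.pi * (inner ℝ ξ x : ℝ) * I) * (𝓕 f ξ / ((‖ξ‖:ℂ) ^ 2 - (a + b * I)))‖ₑ ≤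
      D * (P x + ENNReal.ofReal (2 * wlc E) * Q x) := by
    intro x
    refine (wl_resolvent hb hd3 hfi hffi x).trans ?_
    apply mul_le_mul' le_rfl
    calc _ ≤ ∫⁻ Y in Set.Ioo (0:ℝ) |a| ∪ (Set.Ioi 0 ∩ Set.Ici |a|), ENNReal.ofReal (Y ^ ((d - 1) / 2 - 1)) * ‖∫ y, wlk (wlmu a Y) (x - y) * f y‖ₑ := by
          apply lintegral_mono_set
          intro Y hY
          rcases lt_or_ge Y |a| with h | h
          · exact Or.inl ⟨hY, h⟩
          · exact Or.inr ⟨hY, h⟩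
      _ ≤ _ := lintegral_union_le _ _ _
      _ ≤ P x + ∫⁻ Y in Set.Ioi 0 ∩ Set.Ici |a|, ENNReal.ofReal (2 * wlc E) * ∫⁻ y, ENNReal.ofReal (Y ^ (d / 2 - 2) * Real.exp (-(√Y / 2 * ‖x - y‖))) * ‖f y‖ₑ := by
          apply add_le_add le_rfl
          apply setLIntegral_mono' (measurableSet_Ioi.inter measurableSet_Ici)
          intro Y hY
          exact wl_resA hY.1 hY.2 f x
      _ ≤ _ := by
          apply add_le_add le_rfl
          rw [lintegral_const_mul' _ _ (by finiteness)]
          apply mul_le_mul' le_rfl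
          exact lintegral_mono_set Set.inter_subset_left
  calc _ ≤ ∫⁻ x, D ^ 2 * (2 * (w x * P x ^ 2 + ENNReal.ofReal (2 * wlc E) ^ 2 * (w x * Q x ^ 2))) := by
        apply lintegral_mono
        intro x
        calc _ ≤ w x * (D * (P x + ENNReal.ofReal (2 * wlc E) * Q x)) ^ 2 := by
              exact mul_le_mul' le_rfl (pow_le_pow_left' (hpt x) 2)
          _ = w x * D ^ 2 * (P x + ENNReal.ofReal (2 * wlc E) * Q x) ^ 2 := by ring
          _ ≤ w x * D ^ 2 * (2 * (P x ^ 2 + (ENNReal.ofReal (2 * wlc E) * Q x) ^ 2)) := mul_le_mul' le_rfl (wl_sq_add _ _)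
          _ = _ := by ring
    _ = D ^ 2 * (2 * ((∫⁻ x, w x * P x ^ 2) + ENNReal.ofReal (2 * wlc E) ^ 2 * ∫⁻ x, w x * Q x ^ 2)) := by
        rw [lintegral_const_mul' _ _ (by finiteness), lintegral_const_mul' _ _ (by finiteness), lintegral_add_left (by fun_prop),
          lintegral_const_mul' _ _ (by finiteness)]
    _ ≤ D ^ 2 * (2 * (CB * N + ENNReal.ofReal (2 * wlc E) ^ 2 * (CA * N))) := by
        apply mul_le_mul' le_rfl
        apply mul_le_mul' le_rfl
        apply add_le_add hB'
        exact mul_le_mul' le_rfl hA'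
    _ = D ^ 2 * (2 * (CB + ENNReal.ofReal (2 * wlc E) ^ 2 * CA)) * N := by ring
    _ ≤ _ := by
        gcongr
        exact le_self_add

theorem wl_fourier_conj (f : E → ℂ) (ξ : E) : 𝓕 (fun x => (starRingEnd ℂ) (f x)) ξ = (starRingEnd ℂ) (𝓕 f (-ξ)) := by
  rw [Real.fourier_eq', Real.fourier_eq', ← integral_conj]
  congr 1; ext v
  simp only [smul_eq_mul, map_mul, ← Complex.exp_conj]
  congr 2
  simp [map_ofNat]

theorem wl_enorm_conj (z : ℂ) : ‖(starRingEnd ℂ) z‖ₑ = ‖z‖ₑ := by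
  rw [← ofReal_norm, ← ofReal_norm, Complex.norm_conj]

theorem wl_int_conj {f : E → ℂ} (hf : Integrable f) : Integrable (fun x => (starRingEnd ℂ) (f x)) :=
  Complex.conjCLE.toContinuousLinearMap.integrable_comp hf

theorem wl_thmR (hd3 : 3 ≤ Module.finrank ℝ E) (p : ℝ) (hp : 1 < p) (hp1 : ((Module.finrank ℝ E : ℝ) - 1) / 2 < p) :
    ∃ C : ℝ≥0∞, C ≠ ⊤ ∧ ∀ w : E → ℝ≥0∞, Measurable w → (∀ x, w x ≠ ⊤) → wlH p w →
    ∀ z : ℂ, z.im ≠ 0 → ∀ (f : E → ℂ), Measurable f → Integrable f → Integrable (𝓕 f) →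
    ∫⁻ x, w x * ‖∫ ξ, cexp (2 * Real.pi * (inner ℝ ξ x : ℝ) * I) * (𝓕 f ξ / ((‖ξ‖:ℂ) ^ 2 - z))‖ₑ ^ 2
      ≤ C * ∫⁻ y, ‖f y‖ₑ ^ 2 * (w y)⁻¹ := by
  obtain ⟨C, hC, h⟩ := wl_thmR_pos hd3 p hp hp1
  refine ⟨C, hC, ?_⟩
  intro w hw hwt hH z hz f hf hfi hffi
  rcases lt_or_gt_of_ne hz with hneg | hpos
  · have hc : Measurable (fun x => (starRingEnd ℂ) (f x)) := by fun_prop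
    have hci : Integrable (fun x => (starRingEnd ℂ) (f x)) := wl_int_conj hfi
    have hcf : 𝓕 (fun x => (starRingEnd ℂ) (f x)) = fun ξ => (starRingEnd ℂ) (𝓕 f (-ξ)) := funext (wl_fourier_conj f)
    have h1 := h w hw hwt hH z.re (-z.im) (by linarith) _ hc hci (by rw [hcf]; exact wl_int_conj hffi.comp_neg)
    rw [hcf] at h1
    refine le_trans (le_of_eq ?_) (h1.trans (le_of_eq ?_))
    · congr 1; ext x
      congr 2
      rw [← wl_enorm_conj, ← integral_conj, ← integral_neg_eq_self]
      congr 2; ext ξ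
      simp only [map_mul, map_div₀, ← Complex.exp_conj, map_sub, map_pow, conj_ofReal, norm_neg, conj_I, map_ofNat]
      congr 2
      · simp
      · congr 1
        apply Complex.ext <;> simp
    · congr 2; ext y; rw [wl_enorm_conj]
  · have h1 := h w hw hwt hH z.re z.im hpos f hf hfi hffi
    rwa [Complex.re_add_im] at h1

end pb


/-- causal propagator -/
def wlq (r ρ : ℝ) : ℂ := if 0 < r then ((Real.sin (r * ρ) / ρ : ℝ) : ℂ) else 0

theorem wlq_meas : Measurable (fun z : ℝ × ℝ => wlq z.1 z.2) := by
  unfold wlq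
  refine Measurable.ite (measurableSet_lt measurable_const measurable_fst) ?_ measurable_const
  fun_prop

theorem wlq_norm {r : ℝ} (hr : 0 < r) (ρ : ℝ) : ‖wlq r ρ‖ ≤ r := by
  unfold wlq
  rw [if_pos hr, Complex.norm_real, Real.norm_eq_abs, abs_div]
  by_cases h : ρ = 0
  · simp [h, hr.le]
  · rw [div_le_iff₀ (abs_pos.2 h)]
    refine (Real.abs_sin_le_abs).trans ?_
    rw [abs_mul, abs_of_pos hr]

theorem wlq_nonpos {r : ℝ} (hr : r ≤ 0) (ρ : ℝ) : wlq r ρ = 0 := if_neg (not_lt.2 hr)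

theorem wlq_laplace {η : ℂ} (hη : 0 < η.re) {ρ : ℝ} (hρ : ρ ≠ 0) :
    ∫ r in Set.Ioi (0:ℝ), cexp (-η * r) * wlq r ρ = 1 / ((ρ:ℂ) ^ 2 + η ^ 2) := by
  have h1 : (-η + I * ρ).re < 0 := by simp; linarith
  have h2 : (-η - I * ρ).re < 0 := by simp; linarith
  have e : ∀ r ∈ Set.Ioi (0:ℝ), cexp (-η * r) * wlq r ρ = (1 / (2 * I * ρ)) * (cexp ((-η + I * ρ) * r) - cexp ((-η - I * ρ) * r)) := by
    intro r hr
    have hr' : 0 < r := hr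
    unfold wlq
    rw [if_pos hr']
    push_cast
    rw [Complex.sin, show (-η + I * ρ) * r = -η * r + (r * ρ) * I by ring, show (-η - I * ρ) * r = -η * r + (-(r * ρ)) * I by ring,
      Complex.exp_add, Complex.exp_add]
    have hρ' : (ρ:ℂ) ≠ 0 := by exact_mod_cast hρ
    field_simp
    rw [I_sq]; ring
  rw [setIntegral_congr_fun measurableSet_Ioi e, integral_const_mul, integral_sub, integral_exp_mul_complex_Ioi h1, integral_exp_mul_complex_Ioi h2]
  · have hn1 : -η + I * ρ ≠ 0 := by intro h; rw [h] at h1; simp at h1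
    have hn2 : -η - I * ρ ≠ 0 := by intro h; rw [h] at h2; simp at h2
    have hρ' : (ρ:ℂ) ≠ 0 := by exact_mod_cast hρ
    have hm : (ρ:ℂ) ^ 2 + η ^ 2 = (-η + I * ρ) * (-η - I * ρ) := by
      linear_combination (ρ:ℂ) ^ 2 * I_sq 
    rw [hm]
    simp only [ofReal_zero, mul_zero, Complex.exp_zero]
    field_simp
    ring_nf
    
  · exact integrableOn_exp_mul_complex_Ioi h1 0
  · exact integrableOn_exp_mul_complex_Ioi h2 0

def wlDD (ε : ℝ) : ℝ≥0∞ := ∫⁻ r in Set.Ioi (0:ℝ), ENNReal.ofReal (r * Real.exp (-ε * r))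

theorem wlDD_ne_top {ε : ℝ} (hε : 0 < ε) : wlDD ε ≠ ⊤ := by
  unfold wlDD
  have h := integrableOn_rpow_mul_exp_neg_mul_rpow (p := 1) (s := 1) (b := ε) (by norm_num) (by norm_num) hε
  simp only [Real.rpow_one] at h
  exact h.lintegral_lt_top.ne

theorem wlq_lint {ε : ℝ} {η : ℂ} (hη : η.re = ε) {s : ℝ} (hs : 0 ≤ s) (hε : 0 < ε) (ρ : ℝ) :
    ∫⁻ t : ℝ, ‖cexp (-η * t) * wlq (t - s) ρ‖ₑ ≤ wlDD ε := by
  rw [← lintegral_add_right_eq_self _ s]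
  unfold wlDD
  rw [← lintegral_indicator measurableSet_Ioi]
  apply lintegral_mono
  intro r
  simp only [add_sub_cancel_right]
  by_cases hr : 0 < r
  · rw [Set.indicator_of_mem (by exact hr), ← ofReal_norm, norm_mul, Complex.norm_exp]
    apply ENNReal.ofReal_le_ofReal
    rw [mul_comm]
    have := wlq_norm hr ρ
    have h2 : (-η * ((r + s : ℝ):ℂ)).re ≤ -ε * r := by
      simp [hη]; nlinarith
    gcongr
  · rw [wlq_nonpos (not_lt.1 hr)]; simp

theorem wlq_int_shift {η : ℂ} (hη : 0 < η.re) (s : ℝ) {ρ : ℝ} (hρ : ρ ≠ 0) :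
    ∫ t : ℝ, cexp (-η * t) * wlq (t - s) ρ = cexp (-η * s) * (1 / ((ρ:ℂ) ^ 2 + η ^ 2)) := by
  rw [← integral_add_right_eq_self _ s, ← wlq_laplace hη hρ, ← integral_const_mul, ← integral_indicator measurableSet_Ioi]
  congr 1; ext r
  by_cases hr : 0 < r
  · rw [Set.indicator_of_mem (by exact hr), add_sub_cancel_right, ← mul_assoc, ← Complex.exp_add]
    congr 2; push_cast; ring
  · rw [Set.indicator_of_notMem (by exact hr), add_sub_cancel_right, wlq_nonpos (not_lt.1 hr), mul_zero]

theorem wl_fatou2 {X : Type*} [MeasurableSpace X] {μ : Measure X} {ν : Measure ℝ} [SFinite μ] {H : ℕ → ℝ → X → ℝ≥0∞} {h : ℝ → X → ℝ≥0∞}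
    (hm : ∀ m, Measurable (fun z : ℝ × X => H m z.1 z.2)) {B : ℝ≥0∞} {T : Set ℝ} (hT : MeasurableSet T)
    (hB : ∀ m, ∫⁻ t in T, ∫⁻ x, H m t x ∂μ ∂ν ≤ B)
    (hle : ∀ t ∈ T, ∀ x, h t x ≤ Filter.liminf (fun m => H m t x) Filter.atTop) :
    ∫⁻ t in T, ∫⁻ x, h t x ∂μ ∂ν ≤ B := by
  calc _ ≤ ∫⁻ t in T, Filter.liminf (fun m => ∫⁻ x, H m t x ∂μ) Filter.atTop ∂ν := by
        apply setLIntegral_mono' hT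
        intro t ht
        refine (lintegral_mono (hle t ht)).trans ?_
        exact lintegral_liminf_le (fun m => (hm m).comp (measurable_const.prodMk measurable_id))
    _ ≤ Filter.liminf (fun m => ∫⁻ t in T, ∫⁻ x, H m t x ∂μ ∂ν) Filter.atTop :=
        lintegral_liminf_le (fun m => (hm m).lintegral_prod_right')
    _ ≤ B := by
        refine (Filter.liminf_le_liminf (Filter.Eventually.of_forall hB)).trans ?_
        simp


section
variable {E : Type*} [NormedAddCommGroup E] [InnerProductSpace ℝ E] [FiniteDimensional ℝ E]
  [MeasurableSpace E] [BorelSpace E]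

/-- spatial Fourier transform of a space-time function -/
def wlFh (g : E → ℝ → ℂ) (ξ : E) (s : ℝ) : ℂ := 𝓕 (fun x => g x s) ξ

/-- admissible truncated source terms -/
structure wlAdm (g : E → ℝ → ℂ) (κ : ℝ) : Prop where
  meas : Measurable (fun z : E × ℝ => g z.1 z.2)
  supp : ∀ s ∉ Set.Ioc 0 κ, ∀ x, g x s = 0
  h1 : ∀ s, ∫⁻ x, ‖g x s‖ₑ ≤ ENNReal.ofReal κ
  h2 : ∀ s, ∫⁻ ξ, ‖wlFh g ξ s‖ₑ ≤ ENNReal.ofReal κ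
  h3 : ∀ x, ∃ M : ℝ, ∀ s, ‖g x s‖ ≤ M

/-- the phase -/
def wle (x ξ : E) : ℂ := cexp (2 * Real.pi * (inner ℝ ξ x : ℝ) * I)

theorem wle_meas : Measurable (fun z : E × E => wle z.1 z.2) := by
  unfold wle
  have : Continuous (fun z : E × E => cexp (2 * Real.pi * (inner ℝ z.2 z.1 : ℝ) * I)) := by fun_prop
  exact this.measurable

theorem wle_enorm (x ξ : E) : ‖wle x ξ‖ₑ = 1 := by
  unfold wle
  rw [← ofReal_norm, show (2 * Real.pi * (inner ℝ ξ x : ℝ) * I : ℂ) = ((2 * Real.pi * (inner ℝ ξ x : ℝ) : ℝ) : ℂ) * I by push_cast; ring, Complex.norm_exp_ofReal_mul_I]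
  simp

theorem wlFh_meas {g : E → ℝ → ℂ} (hg : Measurable (fun z : E × ℝ => g z.1 z.2)) :
    Measurable (fun z : E × ℝ => wlFh g z.1 z.2) := by
  have h : StronglyMeasurable (fun q : (E × ℝ) × E => ((Real.fourierChar (-(inner ℝ q.2 q.1.1 : ℝ)) : Circle) : ℂ) * g q.2 q.1.2) := by
    apply Measurable.stronglyMeasurable
    apply Measurable.mul
    · have : Continuous (fun q : (E × ℝ) × E => ((Real.fourierChar (-(inner ℝ q.2 q.1.1 : ℝ)) : Circle) : ℂ)) := by
        have h1 := Real.continuous_fourierChar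
        fun_prop
      exact this.measurable
    · exact hg.comp (by fun_prop : Measurable (fun q : (E × ℝ) × E => (q.2, q.1.2)))
  have h2 := h.integral_prod_right' (ν := (volume : Measure E))
  convert! h2.measurable using 1

theorem wlFh_supp {g : E → ℝ → ℂ} {κ : ℝ} (hg : wlAdm g κ) {s : ℝ} (hs : s ∉ Set.Ioc 0 κ) (ξ : E) : wlFh g ξ s = 0 := by
  unfold wlFh
  rw [show (fun x => g x s) = fun _ => 0 from funext (hg.supp s hs)]
  simp [Real.fourier_eq]

theorem wl_suppint {κ : ℝ} {Φ : ℝ → ℝ≥0∞} (h0 : ∀ s ∉ Set.Ioc 0 κ, Φ s = 0) (hb : ∀ s, Φ s ≤ ENNReal.ofReal κ) :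
    ∫⁻ s, Φ s ≤ ENNReal.ofReal κ * ENNReal.ofReal κ := by
  calc ∫⁻ s, Φ s ≤ ∫⁻ s, (Set.Ioc 0 κ).indicator (fun _ => ENNReal.ofReal κ) s := by
        apply lintegral_mono; intro s
        by_cases hs : s ∈ Set.Ioc 0 κ
        · rw [Set.indicator_of_mem hs]; exact hb s
        · rw [h0 s hs]; exact zero_le
    _ = _ := by
        rw [lintegral_indicator measurableSet_Ioc, setLIntegral_const, Real.volume_Ioc, sub_zero]

theorem wlFh_lint {g : E → ℝ → ℂ} {κ : ℝ} (hg : wlAdm g κ) :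
    ∫⁻ z : E × ℝ, ‖wlFh g z.1 z.2‖ₑ ≤ ENNReal.ofReal κ * ENNReal.ofReal κ := by
  rw [Measure.volume_eq_prod, lintegral_prod_symm _ (wlFh_meas hg.meas).enorm.aemeasurable]
  apply wl_suppint
  · intro s hs
    simp [wlFh_supp hg hs]
  · exact hg.h2

theorem wlg_lint {g : E → ℝ → ℂ} {κ : ℝ} (hg : wlAdm g κ) :
    ∫⁻ z : E × ℝ, ‖g z.1 z.2‖ₑ ≤ ENNReal.ofReal κ * ENNReal.ofReal κ := by
  rw [Measure.volume_eq_prod, lintegral_prod_symm _ hg.meas.enorm.aemeasurable]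
  apply wl_suppint
  · intro s hs
    simp [hg.supp s hs]
  · exact hg.h1

/-- the solution -/
def wlV (g : E → ℝ → ℂ) (x : E) (t : ℝ) : ℂ :=
  ∫ z : E × ℝ, wlq (t - z.2) ‖z.1‖ * (wle x z.1 * wlFh g z.1 z.2)

theorem wlV_meas {g : E → ℝ → ℂ} (hg : Measurable (fun z : E × ℝ => g z.1 z.2)) :
    Measurable (fun z : ℝ × E => wlV g z.2 z.1) := by
  have h : StronglyMeasurable (fun q : (ℝ × E) × (E × ℝ) => wlq (q.1.1 - q.2.2) ‖q.2.1‖ * (wle q.1.2 q.2.1 * wlFh g q.2.1 q.2.2)) := by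
    have h1 : Measurable (fun q : (ℝ × E) × (E × ℝ) => wlq (q.1.1 - q.2.2) ‖q.2.1‖) :=
      wlq_meas.comp (by fun_prop : Measurable (fun q : (ℝ × E) × (E × ℝ) => (q.1.1 - q.2.2, ‖q.2.1‖)))
    have h2 : Measurable (fun q : (ℝ × E) × (E × ℝ) => wle q.1.2 q.2.1) :=
      (wle_meas (E := E)).comp (by fun_prop : Measurable (fun q : (ℝ × E) × (E × ℝ) => (q.1.2, q.2.1)))
    have h3 : Measurable (fun q : (ℝ × E) × (E × ℝ) => wlFh g q.2.1 q.2.2) :=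
      (wlFh_meas hg).comp measurable_snd
    exact (h1.mul (h2.mul h3)).stronglyMeasurable
  exact h.integral_prod_right'.measurable

theorem wlV_bound {g : E → ℝ → ℂ} {κ : ℝ} (hg : wlAdm g κ) (x : E) (t : ℝ) :
    ‖wlV g x t‖ₑ ≤ ENNReal.ofReal t * (ENNReal.ofReal κ * ENNReal.ofReal κ) := by
  unfold wlV
  refine (enorm_integral_le_lintegral_enorm _).trans ?_
  calc _ ≤ ∫⁻ z : E × ℝ, ENNReal.ofReal t * ‖wlFh g z.1 z.2‖ₑ := by
        apply lintegral_mono; intro z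
        dsimp only
        rw [enorm_mul, enorm_mul, wle_enorm, one_mul]
        by_cases hs : z.2 ∈ Set.Ioc 0 κ
        · apply mul_le_mul' _ le_rfl
          by_cases h : 0 < t - z.2
          · rw [← ofReal_norm]
            apply ENNReal.ofReal_le_ofReal
            refine (wlq_norm h _).trans ?_
            have := hs.1
            linarith
          · rw [wlq_nonpos (not_lt.1 h)]; simp
        · rw [wlFh_supp hg hs]; simp
    _ = ENNReal.ofReal t * ∫⁻ z : E × ℝ, ‖wlFh g z.1 z.2‖ₑ := lintegral_const_mul _ (wlFh_meas hg.meas).enorm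
    _ ≤ _ := mul_le_mul' le_rfl (wlFh_lint hg)

theorem wlPhi_int {g : E → ℝ → ℂ} {κ : ℝ} (hg : wlAdm g κ) (x : E) {ε : ℝ} {η : ℂ} (hε : 0 < ε) (hη : η.re = ε) :
    Integrable (fun q : ℝ × (E × ℝ) => cexp (-η * q.1) * (wlq (q.1 - q.2.2) ‖q.2.1‖ * (wle x q.2.1 * wlFh g q.2.1 q.2.2)))
      (volume.prod volume) := by
  have hm : Measurable (fun q : ℝ × (E × ℝ) => cexp (-η * q.1) * (wlq (q.1 - q.2.2) ‖q.2.1‖ * (wle x q.2.1 * wlFh g q.2.1 q.2.2))) := by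
    have h1 : Measurable (fun q : ℝ × (E × ℝ) => wlq (q.1 - q.2.2) ‖q.2.1‖) :=
      wlq_meas.comp (by fun_prop : Measurable (fun q : ℝ × (E × ℝ) => (q.1 - q.2.2, ‖q.2.1‖)))
    have h2 : Measurable (fun q : ℝ × (E × ℝ) => wle x q.2.1) :=
      (wle_meas (E := E)).comp (by fun_prop : Measurable (fun q : ℝ × (E × ℝ) => (x, q.2.1)))
    have h3 : Measurable (fun q : ℝ × (E × ℝ) => wlFh g q.2.1 q.2.2) :=
      (wlFh_meas hg.meas).comp measurable_snd
    have h4 : Measurable (fun q : ℝ × (E × ℝ) => cexp (-η * q.1)) := by fun_prop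
    exact h4.mul (h1.mul (h2.mul h3))
  refine ⟨hm.aestronglyMeasurable, ?_⟩
  rw [hasFiniteIntegral_iff_enorm, lintegral_prod_symm _ hm.enorm.aemeasurable]
  calc _ ≤ ∫⁻ z : E × ℝ, wlDD ε * ‖wlFh g z.1 z.2‖ₑ := by
        apply lintegral_mono; intro z
        dsimp only
        by_cases hs : z.2 ∈ Set.Ioc 0 κ
        · have : ∀ t : ℝ, ‖cexp (-η * t) * (wlq (t - z.2) ‖z.1‖ * (wle x z.1 * wlFh g z.1 z.2))‖ₑ =
              ‖cexp (-η * t) * wlq (t - z.2) ‖z.1‖‖ₑ * ‖wlFh g z.1 z.2‖ₑ := by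
            intro t
            simp only [enorm_mul, wle_enorm, one_mul, mul_assoc]
          simp_rw [this]
          rw [lintegral_mul_const']
          · exact mul_le_mul' (wlq_lint hη hs.1.le hε _) le_rfl
          · exact enorm_ne_top
        · simp [wlFh_supp hg hs]
    _ = wlDD ε * ∫⁻ z : E × ℝ, ‖wlFh g z.1 z.2‖ₑ := lintegral_const_mul _ (wlFh_meas hg.meas).enorm
    _ ≤ wlDD ε * (ENNReal.ofReal κ * ENNReal.ofReal κ) := mul_le_mul' le_rfl (wlFh_lint hg)
    _ < ⊤ := by
      have := wlDD_ne_top hε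
      finiteness

/-- Laplace transform of the source in time -/
def wlL (g : E → ℝ → ℂ) (η : ℂ) (x : E) : ℂ := ∫ s : ℝ, cexp (-η * s) * g x s

theorem wlV_laplace [Nontrivial E] {g : E → ℝ → ℂ} {κ : ℝ} (hg : wlAdm g κ) (x : E) {ε : ℝ} {η : ℂ} (hε : 0 < ε) (hη : η.re = ε) :
    ∫ t : ℝ, cexp (-η * t) * wlV g x t =
      ∫ ξ, wle x ξ * (wlL (wlFh g) η ξ / ((‖ξ‖ : ℂ) ^ 2 + η ^ 2)) := by
  have hI := wlPhi_int hg x hε hη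
  have h1 : ∫ t : ℝ, cexp (-η * t) * wlV g x t = ∫ t : ℝ, ∫ z : E × ℝ,
      cexp (-η * t) * (wlq (t - z.2) ‖z.1‖ * (wle x z.1 * wlFh g z.1 z.2)) := by
    congr 1; ext t
    rw [wlV, integral_const_mul]
  rw [h1, integral_integral_swap hI]
  have hz : ∀ᵐ z : E × ℝ, z.1 ≠ 0 := by
    rw [Measure.volume_eq_prod]
    have : ∀ᵐ ξ : E, ξ ≠ 0 := by
      rw [ae_iff]; simp
    exact Measure.quasiMeasurePreserving_fst.ae this
  have h2 : (fun z : E × ℝ => ∫ t : ℝ, cexp (-η * t) * (wlq (t - z.2) ‖z.1‖ * (wle x z.1 * wlFh g z.1 z.2)))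
      =ᵐ[volume] fun z : E × ℝ => cexp (-η * z.2) * (1 / ((‖z.1‖ : ℂ) ^ 2 + η ^ 2)) * (wle x z.1 * wlFh g z.1 z.2) := by
    filter_upwards [hz] with z hz
    rw [← wlq_int_shift (by rw [hη]; exact hε) z.2 (norm_ne_zero_iff.2 hz), ← integral_mul_const]
    congr 1; ext t; ring
  have hI2 := (hI.integral_prod_right).congr h2
  rw [integral_congr_ae h2, Measure.volume_eq_prod, integral_prod _ hI2]
  congr 1; ext ξ
  rw [wlL, div_eq_mul_one_div, ← integral_mul_const, ← integral_const_mul]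
  congr 1; ext s; ring

theorem wl_exp_norm {ε : ℝ} {η : ℂ} (hε : 0 < ε) (hη : η.re = ε) {s : ℝ} (hs : 0 ≤ s) : ‖cexp (-η * s)‖ₑ ≤ 1 := by
  rw [← ofReal_norm, Complex.norm_exp]
  rw [ENNReal.ofReal_le_one]
  apply Real.exp_le_one_iff.2
  simp [hη]
  positivity

theorem wlL_int {G : E → ℝ → ℂ} {κ : ℝ} (hm : Measurable (fun z : E × ℝ => G z.1 z.2))
    (h0 : ∀ s ∉ Set.Ioc 0 κ, ∀ x, G x s = 0)
    (hK : ∫⁻ z : E × ℝ, ‖G z.1 z.2‖ₑ ≤ ENNReal.ofReal κ * ENNReal.ofReal κ)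
    {ε : ℝ} {η : ℂ} (hε : 0 < ε) (hη : η.re = ε) :
    Integrable (fun z : E × ℝ => cexp (-η * z.2) * G z.1 z.2) (volume.prod volume) := by
  refine ⟨Measurable.aestronglyMeasurable (Measurable.mul (by fun_prop) hm), ?_⟩
  rw [hasFiniteIntegral_iff_enorm]
  refine lt_of_le_of_lt ((lintegral_mono ?_).trans hK) (by finiteness)
  intro z
  dsimp only
  by_cases hs : z.2 ∈ Set.Ioc 0 κ
  · rw [enorm_mul]
    exact (mul_le_mul' (wl_exp_norm hε hη hs.1.le) le_rfl).trans (by rw [one_mul])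
  · simp [h0 _ hs]

theorem wlL_meas {g : E → ℝ → ℂ} (hm : Measurable (fun z : E × ℝ => g z.1 z.2)) (η : ℝ → ℂ) (hη : Measurable η) :
    Measurable (fun z : ℝ × E => wlL g (η z.1) z.2) := by
  have h : StronglyMeasurable (fun q : (ℝ × E) × ℝ => cexp (-(η q.1.1) * q.2) * g q.1.2 q.2) := by
    apply Measurable.stronglyMeasurable
    apply Measurable.mul
    · fun_prop
    · exact hm.comp (by fun_prop : Measurable (fun q : (ℝ × E) × ℝ => (q.1.2, q.2)))
  exact h.integral_prod_right'.measurable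

theorem wlL_fourier {g : E → ℝ → ℂ} {κ : ℝ} (hg : wlAdm g κ)
    {ε : ℝ} {η : ℂ} (hε : 0 < ε) (hη : η.re = ε) (ξ : E) :
    𝓕 (wlL g η) ξ = wlL (wlFh g) η ξ := by
  have hI := wlL_int hg.meas hg.supp (wlg_lint hg) hε hη
  have hI2 : Integrable (fun z : E × ℝ => ((Real.fourierChar (-(inner ℝ z.1 ξ : ℝ)) : Circle) : ℂ) * (cexp (-η * z.2) * g z.1 z.2)) (volume.prod volume) := by
    refine hI.bdd_mul (c := 1) ?_ ?_
    · have h1 := Real.continuous_fourierChar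
      have : Continuous (fun z : E × ℝ => ((Real.fourierChar (-(inner ℝ z.1 ξ : ℝ)) : Circle) : ℂ)) := by fun_prop
      exact this.aestronglyMeasurable
    · filter_upwards with z
      exact (Circle.norm_coe _).le
  rw [Real.fourier_eq]
  have h1 : ∀ x : E, Real.fourierChar (-(inner ℝ x ξ : ℝ)) • wlL g η x = ∫ s : ℝ, ((Real.fourierChar (-(inner ℝ x ξ : ℝ)) : Circle) : ℂ) * (cexp (-η * s) * g x s) := by
    intro x
    rw [wlL, integral_const_mul]
    rfl
  simp_rw [h1]
  rw [integral_integral_swap hI2, wlL]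
  congr 1; ext s
  rw [wlFh, Real.fourier_eq, ← integral_const_mul]
  congr 1; ext x
  rw [Circle.smul_def, smul_eq_mul]
  ring
end


section
variable {E : Type*} [NormedAddCommGroup E] [InnerProductSpace ℝ E] [FiniteDimensional ℝ E]
  [MeasurableSpace E] [BorelSpace E]

/-- complex frequency -/
def wleta (ε τ : ℝ) : ℂ := ε + 2 * Real.pi * τ * I

theorem wleta_re (ε τ : ℝ) : (wleta ε τ).re = ε := by simp [wleta]

theorem wleta_im {ε τ : ℝ} (hε : 0 < ε) (hτ : τ ≠ 0) : (-(wleta ε τ) ^ 2).im ≠ 0 := by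
  have : (-(wleta ε τ) ^ 2).im = -(4 * Real.pi * ε * τ) := by
    simp [wleta, pow_two]; ring
  rw [this]
  have := Real.pi_pos
  simp [hτ, hε.ne', this.ne']

theorem wl_fourier_exp (ε τ : ℝ) (v : ℝ → ℂ) :
    𝓕 (fun t : ℝ => cexp (-(ε:ℂ) * t) * v t) τ = ∫ t : ℝ, cexp (-wleta ε τ * t) * v t := by
  rw [Real.fourier_real_eq_integral_exp_smul]
  congr 1; ext t
  rw [smul_eq_mul, ← mul_assoc, ← Complex.exp_add]
  congr 2
  simp only [wleta]
  push_cast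
  ring

theorem wl_exp_bd {ε t : ℝ} (hε : 0 < ε) : Real.exp (-ε * t) * t ≤ 1 / ε := by
  rw [le_div_iff₀ hε, show -ε * t = -(ε * t) by ring, Real.exp_neg, inv_mul_eq_div, div_mul_eq_mul_div,
    div_le_one (Real.exp_pos _)]
  have := Real.add_one_le_exp (ε * t)
  nlinarith

theorem wl_norm_exp_real (ε t : ℝ) : ‖cexp (-(ε:ℂ) * t)‖ₑ = ENNReal.ofReal (Real.exp (-ε * t)) := by
  rw [← ofReal_norm, Complex.norm_exp]
  simp

theorem wlVe_planch {g : E → ℝ → ℂ} {κ : ℝ} (hg : wlAdm g κ) (x : E) {ε : ℝ} (hε : 0 < ε) :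
    ∫⁻ t : ℝ, ‖cexp (-(ε:ℂ) * t) * wlV g x t‖ₑ ^ 2 = ∫⁻ τ : ℝ, ‖∫ t : ℝ, cexp (-wleta ε τ * t) * wlV g x t‖ₑ ^ 2 := by
  have hI : Integrable (fun t : ℝ => cexp (-(ε:ℂ) * t) * wlV g x t) := by
    have h := (wlPhi_int hg x (η := ε) hε (by simp)).integral_prod_left
    refine h.congr ?_
    filter_upwards with t
    rw [integral_const_mul]
    rfl
  have hb : ∀ t : ℝ, ‖cexp (-(ε:ℂ) * t) * wlV g x t‖ₑ ≤ ENNReal.ofReal (1 / ε) * (ENNReal.ofReal κ * ENNReal.ofReal κ) := by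
    intro t
    rw [enorm_mul, wl_norm_exp_real]
    refine (mul_le_mul' le_rfl (wlV_bound hg x t)).trans ?_
    rw [← mul_assoc, ← ENNReal.ofReal_mul (Real.exp_pos _).le]
    exact mul_le_mul' (ENNReal.ofReal_le_ofReal (wl_exp_bd hε)) le_rfl
  have h2 : MemLp (fun t : ℝ => cexp (-(ε:ℂ) * t) * wlV g x t) 2 := by
    apply wl_memLp_two hI.1
    have h1 := hI.2
    rw [hasFiniteIntegral_iff_enorm] at h1
    refine ne_top_of_le_ne_top ?_ (lintegral_mono (g := fun t : ℝ => (ENNReal.ofReal (1 / ε) * (ENNReal.ofReal κ * ENNReal.ofReal κ)) * ‖cexp (-(ε:ℂ) * t) * wlV g x t‖ₑ) ?_)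
    · rw [lintegral_const_mul' _ _ (by finiteness)]
      have := h1.ne
      finiteness
    · intro t
      dsimp only
      rw [pow_two]
      exact mul_le_mul' (hb t) le_rfl
  rw [← wl_plancherel hI h2]
  simp_rw [wl_fourier_exp]

theorem wlL_planch {g : E → ℝ → ℂ} {κ : ℝ} (hg : wlAdm g κ) (x : E) {ε : ℝ} (hε : 0 < ε) :
    ∫⁻ τ : ℝ, ‖wlL g (wleta ε τ) x‖ₑ ^ 2 ≤ ∫⁻ s : ℝ, ‖g x s‖ₑ ^ 2 := by
  obtain ⟨M, hM⟩ := hg.h3 x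
  have hm : Measurable (fun s : ℝ => g x s) := hg.meas.comp (by fun_prop : Measurable (fun s : ℝ => (x, s)))
  have hle : ∀ s : ℝ, ‖cexp (-(ε:ℂ) * s) * g x s‖ₑ ≤ ‖g x s‖ₑ := by
    intro s
    by_cases hs : s ∈ Set.Ioc 0 κ
    · rw [enorm_mul]
      exact (mul_le_mul' (wl_exp_norm hε (by simp) hs.1.le) le_rfl).trans (by rw [one_mul])
    · simp [hg.supp s hs]
  have hfin : ∀ c : ℝ≥0∞, c ≠ ⊤ → ∀ Φ : ℝ → ℝ≥0∞, (∀ s, Φ s ≤ c) → (∀ s ∉ Set.Ioc 0 κ, Φ s = 0) → ∫⁻ s, Φ s ≠ ⊤ := by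
    intro c hc Φ h1 h2
    refine ne_top_of_le_ne_top ?_ (lintegral_mono (g := (Set.Ioc 0 κ).indicator (fun _ => c)) ?_)
    · rw [lintegral_indicator measurableSet_Ioc, setLIntegral_const, Real.volume_Ioc]
      finiteness
    · intro s
      dsimp only
      by_cases hs : s ∈ Set.Ioc 0 κ
      · rw [Set.indicator_of_mem hs]; exact h1 s
      · rw [h2 s hs]; exact zero_le
  have hMe : ∀ s, ‖g x s‖ₑ ≤ ENNReal.ofReal M := fun s => by
    rw [← ofReal_norm]; exact ENNReal.ofReal_le_ofReal (hM s)
  have hms : AEStronglyMeasurable (fun s : ℝ => cexp (-(ε:ℂ) * s) * g x s) :=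
    (Measurable.mul (by fun_prop) hm).aestronglyMeasurable
  have hI : Integrable (fun s : ℝ => cexp (-(ε:ℂ) * s) * g x s) := by
    refine ⟨hms, ?_⟩
    rw [hasFiniteIntegral_iff_enorm]
    refine (hfin (ENNReal.ofReal M) (by finiteness) _ (fun s => (hle s).trans (hMe s)) ?_).lt_top
    intro s hs
    simp [hg.supp s hs]
  have h2 : MemLp (fun s : ℝ => cexp (-(ε:ℂ) * s) * g x s) 2 := by
    apply wl_memLp_two hms
    refine hfin (ENNReal.ofReal M ^ 2) (by finiteness) _ (fun s => pow_le_pow_left' ((hle s).trans (hMe s)) 2) ?_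
    intro s hs
    simp [hg.supp s hs]
  have := wl_plancherel hI h2
  simp_rw [wl_fourier_exp] at this
  rw [show (∫⁻ τ : ℝ, ‖wlL g (wleta ε τ) x‖ₑ ^ 2) = _ from this]
  exact lintegral_mono fun s => pow_le_pow_left' (hle s) 2

set_option maxHeartbeats 1000000 in
theorem wl_bdd (hd3 : 3 ≤ Module.finrank ℝ E) (p : ℝ) (hp : 1 < p) (hp1 : ((Module.finrank ℝ E : ℝ) - 1) / 2 < p) :
    ∃ C : ℝ≥0∞, C ≠ ⊤ ∧ ∀ w : E → ℝ≥0∞, Measurable w → (∀ x, w x ≠ ⊤) → wlH p w →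
      ∀ (g : E → ℝ → ℂ) (κ : ℝ), wlAdm g κ →
      ∫⁻ t : ℝ, ∫⁻ x : E, w x * ‖wlV g x t‖ₑ ^ 2 ≤ C * ∫⁻ s : ℝ, ∫⁻ x : E, ‖g x s‖ₑ ^ 2 * (w x)⁻¹ := by
  obtain ⟨C, hC, H⟩ := wl_thmR (E := E) hd3 p hp hp1
  refine ⟨C, hC, ?_⟩
  intro w hw hwt hwH g κ hg
  have : Nontrivial E := Module.nontrivial_of_finrank_pos (R := ℝ) (by omega)
  have hVm := wlV_meas hg.meas
  have hge : Measurable (fun z : E × ℝ => ‖g z.1 z.2‖ₑ ^ 2 * (w z.1)⁻¹) :=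
    (hg.meas.enorm.pow_const 2).mul (hw.comp measurable_fst).inv
  -- the estimate for positive ε
  have key : ∀ ε : ℝ, 0 < ε → ∫⁻ t : ℝ, ∫⁻ x : E, w x * ‖cexp (-(ε:ℂ) * t) * wlV g x t‖ₑ ^ 2 ≤ C * ∫⁻ s : ℝ, ∫⁻ x : E, ‖g x s‖ₑ ^ 2 * (w x)⁻¹ := by
    intro ε hε
    have hη : Measurable (wleta ε) := by unfold wleta; fun_prop
    have hm1 : Measurable (fun z : ℝ × E => w z.2 * ‖cexp (-(ε:ℂ) * z.1) * wlV g z.2 z.1‖ₑ ^ 2) := by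
      have h1 : Measurable (fun z : ℝ × E => cexp (-(ε:ℂ) * z.1)) := by fun_prop
      exact (hw.comp measurable_snd).mul ((h1.mul hVm).enorm.pow_const 2)
    have hm3 : Measurable (fun z : ℝ × E => ∫ t : ℝ, cexp (-wleta ε z.1 * t) * wlV g z.2 t) := by
      have h : StronglyMeasurable (fun q : (ℝ × E) × ℝ => cexp (-(wleta ε q.1.1) * q.2) * wlV g q.1.2 q.2) := by
        have h1 : Measurable (fun q : (ℝ × E) × ℝ => cexp (-(wleta ε q.1.1) * q.2)) := by fun_prop
        have h2 : Measurable (fun q : (ℝ × E) × ℝ => wlV g q.1.2 q.2) :=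
          hVm.comp (by fun_prop : Measurable (fun q : (ℝ × E) × ℝ => (q.2, q.1.2)))
        exact (h1.mul h2).stronglyMeasurable
      exact (h.integral_prod_right' (ν := (volume : Measure ℝ))).measurable
    have hm2 : Measurable (fun z : ℝ × E => w z.2 * ‖∫ t : ℝ, cexp (-wleta ε z.1 * t) * wlV g z.2 t‖ₑ ^ 2) :=
      (hw.comp measurable_snd).mul (hm3.enorm.pow_const 2)
    have hLm := wlL_meas hg.meas (wleta ε) hη
    have hm4 : Measurable (fun z : ℝ × E => ‖wlL g (wleta ε z.1) z.2‖ₑ ^ 2 * (w z.2)⁻¹) :=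
      (hLm.enorm.pow_const 2).mul (hw.comp measurable_snd).inv
    have hstep : ∀ τ : ℝ, τ ≠ 0 → ∫⁻ x : E, w x * ‖∫ t : ℝ, cexp (-wleta ε τ * t) * wlV g x t‖ₑ ^ 2 ≤
        C * ∫⁻ x : E, ‖wlL g (wleta ε τ) x‖ₑ ^ 2 * (w x)⁻¹ := by
      intro τ hτ
      have hre := wleta_re ε τ
      have hF : 𝓕 (wlL g (wleta ε τ)) = wlL (wlFh g) (wleta ε τ) := by
        ext ξ; exact wlL_fourier hg hε hre ξ
      have i1 : Integrable (wlL g (wleta ε τ)) :=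
        (wlL_int hg.meas hg.supp (wlg_lint hg) hε hre).integral_prod_left
      have i2 : Integrable (wlL (wlFh g) (wleta ε τ)) :=
        (wlL_int (wlFh_meas hg.meas) (fun s hs ξ => wlFh_supp hg hs ξ) (wlFh_lint hg) hε hre).integral_prod_left
      have hmm : Measurable (wlL g (wleta ε τ)) := by
        have h := hLm.comp (measurable_prodMk_left (x := τ) : Measurable (fun x : E => (τ, x)))
        exact h
      have hh := H w hw hwt hwH (-(wleta ε τ) ^ 2) (wleta_im hε hτ) (wlL g (wleta ε τ)) hmm i1 (by rw [hF]; exact i2)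
      refine le_trans (le_of_eq ?_) hh
      refine lintegral_congr fun x => ?_
      rw [wlV_laplace hg x hε hre, hF]
      simp only [sub_neg_eq_add, wle]
    calc ∫⁻ t : ℝ, ∫⁻ x : E, w x * ‖cexp (-(ε:ℂ) * t) * wlV g x t‖ₑ ^ 2
        = ∫⁻ x : E, ∫⁻ t : ℝ, w x * ‖cexp (-(ε:ℂ) * t) * wlV g x t‖ₑ ^ 2 :=
          lintegral_lintegral_swap hm1.aemeasurable
      _ = ∫⁻ x : E, ∫⁻ τ : ℝ, w x * ‖∫ t : ℝ, cexp (-wleta ε τ * t) * wlV g x t‖ₑ ^ 2 := by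
          refine lintegral_congr fun x => ?_
          have e1 := lintegral_const_mul' (μ := (volume : Measure ℝ)) (w x) (fun t : ℝ => ‖cexp (-(ε:ℂ) * t) * wlV g x t‖ₑ ^ 2) (hwt x)
          have e2 := lintegral_const_mul' (μ := (volume : Measure ℝ)) (w x) (fun τ : ℝ => ‖∫ t : ℝ, cexp (-wleta ε τ * t) * wlV g x t‖ₑ ^ 2) (hwt x)
          exact e1.trans ((congrArg (fun a => w x * a) (wlVe_planch hg x hε)).trans e2.symm)
      _ = ∫⁻ τ : ℝ, ∫⁻ x : E, w x * ‖∫ t : ℝ, cexp (-wleta ε τ * t) * wlV g x t‖ₑ ^ 2 :=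
          (lintegral_lintegral_swap hm2.aemeasurable).symm
      _ ≤ ∫⁻ τ : ℝ, C * ∫⁻ x : E, ‖wlL g (wleta ε τ) x‖ₑ ^ 2 * (w x)⁻¹ := by
          apply lintegral_mono_ae
          have hz : ∀ᵐ τ : ℝ, τ ≠ 0 := by rw [ae_iff]; simp
          filter_upwards [hz] with τ hτ
          exact hstep τ hτ
      _ = C * ∫⁻ τ : ℝ, ∫⁻ x : E, ‖wlL g (wleta ε τ) x‖ₑ ^ 2 * (w x)⁻¹ := lintegral_const_mul' _ _ hC
      _ = C * ∫⁻ x : E, ∫⁻ τ : ℝ, ‖wlL g (wleta ε τ) x‖ₑ ^ 2 * (w x)⁻¹ := by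
          rw [lintegral_lintegral_swap hm4.aemeasurable]
      _ ≤ C * ∫⁻ x : E, ∫⁻ s : ℝ, ‖g x s‖ₑ ^ 2 * (w x)⁻¹ := by
          apply mul_le_mul' le_rfl
          apply lintegral_mono; intro x
          dsimp only
          have a1 : Measurable (fun τ : ℝ => ‖wlL g (wleta ε τ) x‖ₑ ^ 2) :=
            (hLm.comp (measurable_prodMk_right (y := x) : Measurable (fun τ : ℝ => (τ, x)))).enorm.pow_const 2
          have a2 : Measurable (fun s : ℝ => ‖g x s‖ₑ ^ 2) :=
            (hg.meas.comp (measurable_prodMk_left (x := x) : Measurable (fun s : ℝ => (x, s)))).enorm.pow_const 2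
          rw [lintegral_mul_const _ a1, lintegral_mul_const _ a2]
          exact mul_le_mul' (wlL_planch hg x hε) le_rfl
      _ = C * ∫⁻ s : ℝ, ∫⁻ x : E, ‖g x s‖ₑ ^ 2 * (w x)⁻¹ := by
          rw [lintegral_lintegral_swap (f := fun (x : E) (s : ℝ) => ‖g x s‖ₑ ^ 2 * (w x)⁻¹) hge.aemeasurable]
  have hfin := wl_fatou2 (T := Set.univ) (ν := (volume : Measure ℝ)) (μ := (volume : Measure E)) (B := C * ∫⁻ s : ℝ, ∫⁻ x : E, ‖g x s‖ₑ ^ 2 * (w x)⁻¹)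
    (H := fun m t x => w x * ‖cexp (-((1 / ((m:ℝ) + 1) : ℝ):ℂ) * t) * wlV g x t‖ₑ ^ 2)
    (h := fun t x => w x * ‖wlV g x t‖ₑ ^ 2) ?_ MeasurableSet.univ ?_ ?_
  · simpa only [Measure.restrict_univ] using hfin
  · intro m
    have h1 : Measurable (fun z : ℝ × E => cexp (-((1 / ((m:ℝ) + 1) : ℝ):ℂ) * z.1)) := by fun_prop
    exact (hw.comp measurable_snd).mul ((h1.mul hVm).enorm.pow_const 2)
  · intro m
    simp only [Measure.restrict_univ]
    exact key _ (by positivity)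
  · intro t _ x
    have ht : Filter.Tendsto (fun m : ℕ => w x * ‖cexp (-((1 / ((m:ℝ) + 1) : ℝ):ℂ) * t) * wlV g x t‖ₑ ^ 2) Filter.atTop
        (nhds (w x * ‖cexp (-((0 : ℝ):ℂ) * t) * wlV g x t‖ₑ ^ 2)) := by
      have h0 : Filter.Tendsto (fun m : ℕ => 1 / ((m:ℝ) + 1)) Filter.atTop (nhds 0) := tendsto_one_div_add_atTop_nhds_zero_nat
      have hc : Continuous (fun e : ℝ => w x * ‖cexp (-(e:ℂ) * t) * wlV g x t‖ₑ ^ 2) := by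
        refine (ENNReal.continuous_const_mul (hwt x)).comp ?_
        refine (ENNReal.continuous_pow 2).comp ?_
        fun_prop
      exact (hc.tendsto 0).comp h0
    rw [ht.liminf_eq]
    simp
end


section
variable {E : Type*} [NormedAddCommGroup E] [InnerProductSpace ℝ E] [FiniteDimensional ℝ E]
  [MeasurableSpace E] [BorelSpace E]

theorem wlV_integrable {g : E → ℝ → ℂ} {κ : ℝ} (hg : wlAdm g κ) (x : E) (t : ℝ) :
    Integrable (fun z : E × ℝ => wlq (t - z.2) ‖z.1‖ * (wle x z.1 * wlFh g z.1 z.2)) (volume.prod volume) := by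
  have h1 : Measurable (fun q : E × ℝ => wlq (t - q.2) ‖q.1‖) :=
    wlq_meas.comp (by fun_prop : Measurable (fun q : E × ℝ => (t - q.2, ‖q.1‖)))
  have h2 : Measurable (fun q : E × ℝ => wle x q.1) :=
    (wle_meas (E := E)).comp (by fun_prop : Measurable (fun q : E × ℝ => (x, q.1)))
  have h3 := wlFh_meas hg.meas
  refine ⟨(h1.mul (h2.mul h3)).aestronglyMeasurable, ?_⟩
  rw [hasFiniteIntegral_iff_enorm]
  calc _ ≤ ∫⁻ z : E × ℝ, ENNReal.ofReal t * ‖wlFh g z.1 z.2‖ₑ := by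
        apply lintegral_mono; intro z
        dsimp only
        rw [enorm_mul, enorm_mul, wle_enorm, one_mul]
        by_cases hs : z.2 ∈ Set.Ioc 0 κ
        · apply mul_le_mul' _ le_rfl
          by_cases h : 0 < t - z.2
          · rw [← ofReal_norm]
            apply ENNReal.ofReal_le_ofReal
            refine (wlq_norm h _).trans ?_
            have := hs.1
            linarith
          · rw [wlq_nonpos (not_lt.1 h)]; simp
        · rw [wlFh_supp hg hs]; simp
    _ = ENNReal.ofReal t * ∫⁻ z : E × ℝ, ‖wlFh g z.1 z.2‖ₑ := lintegral_const_mul _ h3.enorm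
    _ ≤ ENNReal.ofReal t * (ENNReal.ofReal κ * ENNReal.ofReal κ) := mul_le_mul' le_rfl (wlFh_lint hg)
    _ < ⊤ := by finiteness

/-- the propagator applied to one time slice -/
def wlM (F : E → ℝ → ℂ) (t s : ℝ) (x : E) : ℂ :=
  𝓕⁻ (fun ξ : E => ((Real.sin ((t - s) * ‖ξ‖) / ‖ξ‖ : ℝ) : ℂ) * 𝓕 (fun y => F y s) ξ) x

theorem wlM_eq (F : E → ℝ → ℂ) {t s : ℝ} (hst : s ≤ t) (x : E) :
    wlM F t s x = ∫ ξ, wlq (t - s) ‖ξ‖ * (wle x ξ * wlFh F ξ s) := by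
  rw [wlM, Real.fourierInv_eq']
  congr 1; ext ξ
  have : wlq (t - s) ‖ξ‖ = ((Real.sin ((t - s) * ‖ξ‖) / ‖ξ‖ : ℝ) : ℂ) := by
    unfold wlq
    split_ifs with h
    · rfl
    · have : t - s = 0 := by linarith
      simp [this]
  rw [this, wle, wlFh, smul_eq_mul]
  push_cast
  ring

/-- good times -/
def wlA (F : E → ℝ → ℂ) (k : ℕ) : Set ℝ :=
  {s | (0 < s ∧ s ≤ k) ∧ (∫⁻ x, ‖F x s‖ₑ ≤ ENNReal.ofReal k ∧ ∫⁻ ξ, ‖wlFh F ξ s‖ₑ ≤ ENNReal.ofReal k)}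

theorem wlA_meas {F : E → ℝ → ℂ} (hF : Measurable (fun z : E × ℝ => F z.1 z.2)) (k : ℕ) : MeasurableSet (wlA F k) := by
  have h1 : Measurable (fun s : ℝ => ∫⁻ x, ‖F x s‖ₑ) := hF.enorm.lintegral_prod_left'
  have h2 : Measurable (fun s : ℝ => ∫⁻ ξ, ‖wlFh F ξ s‖ₑ) := (wlFh_meas hF).enorm.lintegral_prod_left'
  exact (measurableSet_Ioc (a := (0:ℝ)) (b := (k:ℝ))).inter ((measurableSet_le h1 measurable_const).inter (measurableSet_le h2 measurable_const))

open Classical in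
/-- truncated source -/
def wlTr (F : E → ℝ → ℂ) (k : ℕ) (x : E) (s : ℝ) : ℂ := if s ∈ wlA F k then F x s else 0

theorem wlTr_hat (F : E → ℝ → ℂ) (k : ℕ) (ξ : E) (s : ℝ) : wlFh (wlTr F k) ξ s = (wlA F k).indicator (fun s => wlFh F ξ s) s := by
  unfold wlFh wlTr
  by_cases h : s ∈ wlA F k
  · simp [h]
  · simp [h, Real.fourier_eq]

theorem wlTr_adm {F : E → ℝ → ℂ} (hF : Continuous (fun z : E × ℝ => F z.1 z.2)) (k : ℕ) : wlAdm (wlTr F k) k where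
  meas := by
    unfold wlTr
    exact Measurable.ite (measurable_snd (wlA_meas hF.measurable k)) hF.measurable measurable_const
  supp := by
    intro s hs x
    unfold wlTr
    rw [if_neg]
    intro h
    exact hs h.1
  h1 := by
    intro s
    by_cases h : s ∈ wlA F k
    · simp only [wlTr, h, if_true]; exact h.2.1
    · simp [wlTr, h]
  h2 := by
    intro s
    simp only [wlTr_hat]
    by_cases h : s ∈ wlA F k
    · simp only [Set.indicator_of_mem h]; exact h.2.2
    · simp [h]
  h3 := by
    intro x
    have hc : Continuous (fun s : ℝ => F x s) := hF.comp (by fun_prop : Continuous (fun s : ℝ => (x, s)))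
    obtain ⟨M, hM⟩ := (isCompact_Icc (a := (0:ℝ)) (b := (k:ℝ))).exists_bound_of_continuousOn hc.continuousOn
    refine ⟨max M 0, fun s => ?_⟩
    unfold wlTr
    split_ifs with h
    · exact (hM s ⟨h.1.1.le, h.1.2⟩).trans (le_max_left _ _)
    · simp

theorem wlA_ev {F : E → ℝ → ℂ} (h1 : ∀ s, Integrable (fun x => F x s)) (h2 : ∀ s, Integrable (fun ξ => wlFh F ξ s)) {s : ℝ} (hs : 0 < s) :
    ∀ᶠ k : ℕ in Filter.atTop, s ∈ wlA F k := by
  have aux : ∀ b : ℝ≥0∞, b < ⊤ → ∀ᶠ k : ℕ in Filter.atTop, b ≤ ENNReal.ofReal k := by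
    intro b hb
    have := ENNReal.tendsto_nat_nhds_top.eventually (lt_mem_nhds hb)
    filter_upwards [this] with k hk
    simpa using hk.le
  have a1 := (h1 s).2
  have a2 := (h2 s).2
  rw [hasFiniteIntegral_iff_enorm] at a1 a2
  filter_upwards [aux _ a1, aux _ a2, Filter.eventually_ge_atTop ⌈s⌉₊] with k b1 b2 b3
  exact ⟨⟨hs, Nat.ceil_le.1 b3⟩, b1, b2⟩

theorem wlV_tr {F : E → ℝ → ℂ} (hF : Continuous (fun z : E × ℝ => F z.1 z.2)) (k : ℕ) (x : E) (t : ℝ) :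
    wlV (wlTr F k) x t = ∫ s in Set.Ioc 0 t, (wlA F k).indicator (fun s => wlM F t s x) s := by
  rw [wlV, Measure.volume_eq_prod, integral_prod_symm _ (wlV_integrable (wlTr_adm hF k) x t), ← integral_indicator measurableSet_Ioc]
  congr 1; ext s
  by_cases hs : s ∈ wlA F k
  · by_cases hst : s ≤ t
    · rw [Set.indicator_of_mem (show s ∈ Set.Ioc 0 t from ⟨hs.1.1, hst⟩), Set.indicator_of_mem hs, wlM_eq F hst]
      simp only [wlTr_hat, Set.indicator_of_mem hs]
    · rw [Set.indicator_of_notMem (fun h => hst h.2)]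
      have : t - s ≤ 0 := by linarith
      simp [wlq_nonpos this]
  · simp [wlTr_hat, hs, Set.indicator]

theorem wl_half (hd3 : 3 ≤ Module.finrank ℝ E) (p : ℝ) (hp : 1 < p) (hp1 : ((Module.finrank ℝ E : ℝ) - 1) / 2 < p) :
    ∃ C : ℝ≥0∞, C ≠ ⊤ ∧ ∀ w : E → ℝ≥0∞, Measurable w → (∀ x, w x ≠ ⊤) → wlH p w →
      ∀ F : E → ℝ → ℂ, Continuous (fun z : E × ℝ => F z.1 z.2) → (∀ s, Integrable (fun x => F x s)) →
      (∀ s, Integrable (fun ξ => wlFh F ξ s)) →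
      ∫⁻ t : ℝ in Set.Ioi 0, ∫⁻ x : E, w x * ‖∫ s in (0:ℝ)..t, wlM F t s x‖ₑ ^ 2 ≤ C * ∫⁻ s : ℝ, ∫⁻ x : E, ‖F x s‖ₑ ^ 2 * (w x)⁻¹ := by
  obtain ⟨C, hC, H⟩ := wl_bdd (E := E) hd3 p hp hp1
  refine ⟨C, hC, ?_⟩
  intro w hw hwt hwH F hF h1 h2
  refine wl_fatou2 (H := fun k t x => w x * ‖wlV (wlTr F k) x t‖ₑ ^ 2) ?_ measurableSet_Ioi ?_ ?_
  · intro k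
    exact (hw.comp measurable_snd).mul ((wlV_meas (wlTr_adm hF k).meas).enorm.pow_const 2)
  · intro k
    refine (setLIntegral_le_lintegral _ _).trans ((H w hw hwt hwH _ _ (wlTr_adm hF k)).trans ?_)
    apply mul_le_mul' le_rfl
    apply lintegral_mono; intro s
    apply lintegral_mono; intro x
    apply mul_le_mul' _ le_rfl
    apply pow_le_pow_left'
    unfold wlTr
    split_ifs <;> simp
  · intro t ht x
    have ht0 : (0:ℝ) ≤ t := le_of_lt ht
    rw [intervalIntegral.integral_of_le ht0]
    by_cases hI : IntegrableOn (fun s => wlM F t s x) (Set.Ioc 0 t)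
    · have hlim : Filter.Tendsto (fun k : ℕ => wlV (wlTr F k) x t) Filter.atTop (nhds (∫ s in Set.Ioc 0 t, wlM F t s x)) := by
        simp_rw [wlV_tr hF]
        refine tendsto_integral_of_dominated_convergence (fun s => ‖wlM F t s x‖) ?_ hI.norm ?_ ?_
        · intro k
          exact hI.1.indicator (wlA_meas hF.measurable k)
        · intro k
          filter_upwards with s
          exact norm_indicator_le_norm_self _ _
        · rw [ae_restrict_iff' measurableSet_Ioc]
          filter_upwards with s hs
          apply tendsto_const_nhds.congr'
          filter_upwards [wlA_ev h1 h2 hs.1] with k hk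
          rw [Set.indicator_of_mem hk]
      have hc : Continuous (fun e : ℂ => w x * ‖e‖ₑ ^ 2) := by
        refine (ENNReal.continuous_const_mul (hwt x)).comp ?_
        refine (ENNReal.continuous_pow 2).comp ?_
        fun_prop
      have := (hc.tendsto _).comp hlim
      exact this.liminf_eq.ge
    · rw [integral_undef hI]
      simp

theorem wlM_neg (F : E → ℝ → ℂ) (t : ℝ) (x : E) :
    ∫ s in (0:ℝ)..(-t), wlM F (-t) s x = ∫ s in (0:ℝ)..t, wlM (fun y s => F y (-s)) t s x := by
  have h := intervalIntegral.integral_comp_neg (a := 0) (b := t) (fun s => wlM F (-t) s x)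
  rw [neg_zero] at h
  rw [intervalIntegral.integral_symm, ← h, ← intervalIntegral.integral_neg]
  congr 1; ext s
  have : (fun ξ : E => ((Real.sin ((-t - -s) * ‖ξ‖) / ‖ξ‖ : ℝ) : ℂ) * 𝓕 (fun y => F y (-s)) ξ) =
      fun ξ : E => -(((Real.sin ((t - s) * ‖ξ‖) / ‖ξ‖ : ℝ) : ℂ) * 𝓕 (fun y => F y (-s)) ξ) := by
    ext ξ
    rw [show (-t - -s) * ‖ξ‖ = -((t - s) * ‖ξ‖) by ring, Real.sin_neg]
    push_cast
    ring
  unfold wlM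
  rw [this, Real.fourierInv_eq, Real.fourierInv_eq, ← integral_neg]
  congr 1; ext v
  simp

theorem wl_full (hd3 : 3 ≤ Module.finrank ℝ E) (p : ℝ) (hp : 1 < p) (hp1 : ((Module.finrank ℝ E : ℝ) - 1) / 2 < p) :
    ∃ C : ℝ≥0∞, C ≠ ⊤ ∧ ∀ w : E → ℝ≥0∞, Measurable w → (∀ x, w x ≠ ⊤) → wlH p w →
      ∀ F : E → ℝ → ℂ, Continuous (fun z : E × ℝ => F z.1 z.2) → (∀ s, Integrable (fun x => F x s)) →
      (∀ s, Integrable (fun ξ => wlFh F ξ s)) →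
      ∫⁻ t : ℝ, ∫⁻ x : E, w x * ‖∫ s in (0:ℝ)..t, wlM F t s x‖ₑ ^ 2 ≤ C * ∫⁻ s : ℝ, ∫⁻ x : E, ‖F x s‖ₑ ^ 2 * (w x)⁻¹ := by
  obtain ⟨C, hC, H⟩ := wl_half (E := E) hd3 p hp hp1
  refine ⟨2 * C, by finiteness, ?_⟩
  intro w hw hwt hwH F hF h1 h2
  have e1 := H w hw hwt hwH F hF h1 h2
  have hF' : Continuous (fun z : E × ℝ => (fun y s => F y (-s)) z.1 z.2) :=
    hF.comp (by fun_prop : Continuous (fun z : E × ℝ => (z.1, -z.2)))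
  have e2 := H w hw hwt hwH (fun y s => F y (-s)) hF' (fun s => h1 (-s)) (fun s => h2 (-s))
  have e3 : ∫⁻ s : ℝ, ∫⁻ x : E, ‖F x (-s)‖ₑ ^ 2 * (w x)⁻¹ = ∫⁻ s : ℝ, ∫⁻ x : E, ‖F x s‖ₑ ^ 2 * (w x)⁻¹ :=
    lintegral_neg_eq_self (fun s => ∫⁻ x : E, ‖F x s‖ₑ ^ 2 * (w x)⁻¹) 
  have e4 := (Measure.measurePreserving_neg (volume : Measure ℝ)).setLIntegral_comp_preimage_emb
    (MeasurableEquiv.neg ℝ).measurableEmbedding (fun t : ℝ => ∫⁻ x : E, w x * ‖∫ s in (0:ℝ)..t, wlM F t s x‖ₑ ^ 2) (Set.Iio 0)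
  simp only [wlM_neg] at e4
  rw [show (Neg.neg ⁻¹' (Set.Iio (0:ℝ))) = Set.Ioi 0 by ext; simp] at e4
  rw [e3, e4] at e2
  rw [← lintegral_add_compl _ (measurableSet_Ioi (a := (0:ℝ))), Set.compl_Ioi, ← setLIntegral_congr Iio_ae_eq_Iic, two_mul, add_mul]
  exact add_le_add e1 e2
end
theorem wl_fp_wlH {n : ℕ} {p : ℝ} (hp : 0 < p) {V : EuclideanSpace ℝ (Fin n) → ℂ}
    (h0 : fpNorm n p V ≠ 0) (hT : fpNorm n p V ≠ ⊤) :
    wlH p (fun x : EuclideanSpace ℝ (Fin n) => ‖V x‖ₑ * (fpNorm n p V)⁻¹) := by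
  intro x r hr
  have hle : ENNReal.ofReal (r ^ (2 - n / p)) *
      (∫⁻ y in ball x r, ENNReal.ofReal (‖V y‖ ^ p)) ^ (1 / p) ≤ fpNorm n p V := by
    unfold fpNorm
    exact le_iSup_of_le x (le_iSup_of_le r (le_iSup_of_le hr le_rfl))
  set N := fpNorm n p V with hN
  have e1 : ∀ y, (‖V y‖ₑ * N⁻¹) ^ p = ENNReal.ofReal (‖V y‖ ^ p) * (N⁻¹) ^ p := by
    intro y
    rw [ENNReal.mul_rpow_of_nonneg _ _ hp.le, ← ofReal_norm, ENNReal.ofReal_rpow_of_nonneg (norm_nonneg _) hp.le]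
  simp_rw [e1]
  have hNi : (N⁻¹) ^ p ≠ ⊤ := ENNReal.rpow_ne_top_of_nonneg hp.le (ENNReal.inv_ne_top.2 h0)
  rw [lintegral_mul_const' _ _ hNi]
  set J := ∫⁻ y in ball x r, ENNReal.ofReal (‖V y‖ ^ p) with hJ
  have h2 := ENNReal.rpow_le_rpow hle hp.le
  rw [ENNReal.mul_rpow_of_nonneg _ _ hp.le, ← ENNReal.rpow_mul, one_div, inv_mul_cancel₀ hp.ne', ENNReal.rpow_one,
    ENNReal.ofReal_rpow_of_nonneg (by positivity) hp.le, ← Real.rpow_mul hr.le] at h2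
  have hd : Module.finrank ℝ (EuclideanSpace ℝ (Fin n)) = n := by simp
  rw [hd]
  have e3 : (2 - (n:ℝ) / p) * p = -((n:ℝ) - 2 * p) := by field_simp; ring
  rw [e3] at h2
  calc J * (N⁻¹) ^ p = ENNReal.ofReal (r ^ ((n:ℝ) - 2 * p)) * (ENNReal.ofReal (r ^ (-((n:ℝ) - 2 * p))) * J) * (N⁻¹) ^ p := by
        rw [← mul_assoc (ENNReal.ofReal _), ← ENNReal.ofReal_mul (by positivity), ← Real.rpow_add hr]
        simp
    _ ≤ ENNReal.ofReal (r ^ ((n:ℝ) - 2 * p)) * N ^ p * (N⁻¹) ^ p :=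
        mul_le_mul' (mul_le_mul' le_rfl h2) le_rfl
    _ = ENNReal.ofReal (r ^ ((n:ℝ) - 2 * p)) := by
        rw [mul_assoc, ← ENNReal.mul_rpow_of_nonneg _ _ hp.le, ENNReal.mul_inv_cancel h0 hT, ENNReal.one_rpow, mul_one]

theorem wl_fp_zero {n : ℕ} {p : ℝ} (hp : 0 < p) {V : EuclideanSpace ℝ (Fin n) → ℂ} (hV : Measurable V)
    (h0 : fpNorm n p V = 0) : ∀ᵐ x, V x = 0 := by
  have hb : ∀ k : ℕ, ∀ᵐ y ∂(volume.restrict (ball (0 : EuclideanSpace ℝ (Fin n)) ((k:ℝ) + 1))), V y = 0 := by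
    intro k
    have hr : (0:ℝ) < (k:ℝ) + 1 := by positivity
    have hle : ENNReal.ofReal (((k:ℝ) + 1) ^ (2 - n / p)) *
        (∫⁻ y in ball (0 : EuclideanSpace ℝ (Fin n)) ((k:ℝ) + 1), ENNReal.ofReal (‖V y‖ ^ p)) ^ (1 / p) ≤ fpNorm n p V := by
      unfold fpNorm
      exact le_iSup_of_le 0 (le_iSup_of_le _ (le_iSup_of_le hr le_rfl))
    rw [h0, nonpos_iff_eq_zero, mul_eq_zero] at hle
    have h1 : ENNReal.ofReal (((k:ℝ) + 1) ^ (2 - n / p)) ≠ 0 := by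
      rw [Ne, ENNReal.ofReal_eq_zero, not_le]; positivity
    have h2 := hle.resolve_left h1
    rw [ENNReal.rpow_eq_zero_iff_of_pos (by positivity), lintegral_eq_zero_iff (by fun_prop)] at h2
    filter_upwards [h2] with y hy
    have hy' : ‖V y‖ ^ p ≤ 0 := ENNReal.ofReal_eq_zero.1 hy
    have h3 : ‖V y‖ ^ p = 0 := le_antisymm hy' (by positivity)
    rw [Real.rpow_eq_zero (norm_nonneg _) hp.ne'] at h3
    exact norm_eq_zero.1 h3
  rw [← ae_restrict_iUnion_iff, iUnion_ball_nat_succ, Measure.restrict_univ] at hb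
  exact hb

theorem wl_schwartz_int {n : ℕ} {h : EuclideanSpace ℝ (Fin n) → ℂ} (hh : IsSchwartz h) : Integrable h ∧ Integrable (𝓕 h) := by
  obtain ⟨φ, hφ⟩ := hh
  have : h = φ := funext hφ
  subst this
  refine ⟨φ.integrable, ?_⟩
  rw [← SchwartzMap.fourier_coe]
  exact (𝓕 φ).integrable

/-- Weighted space-time `L²` estimate for the Duhamel term. -/
theorem weighted_L2_duhamel (n : ℕ) (hn : 3 ≤ n) (p : ℝ) (hp : ((n : ℝ) - 1) / 2 < p) :
    ∃ C > (0 : ℝ), ∀ V : EuclideanSpace ℝ (Fin n) → ℂ, Measurable V →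
      fpNorm n p V < ⊤ →
      ∀ F : EuclideanSpace ℝ (Fin n) → ℝ → ℂ,
        (∀ s : ℝ, IsSchwartz (fun x => F x s)) →
        Continuous (fun z : EuclideanSpace ℝ (Fin n) × ℝ => F z.1 z.2) →
        wtNorm n (fun x => (‖V x‖₊ : ℝ≥0∞))
            (fun x t => ∫ s in (0 : ℝ)..t, mOp n (sincMult (t - s)) (fun y => F y s) x) ≤
          ENNReal.ofReal C * fpNorm n p V * wtNorm n (fun x => (‖V x‖₊ : ℝ≥0∞)⁻¹) F := by
  have hn' : (3:ℝ) ≤ n := by exact_mod_cast hn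
  have hp1 : 1 < p := by linarith
  have hp0 : 0 < p := by linarith
  have hd : Module.finrank ℝ (EuclideanSpace ℝ (Fin n)) = n := by simp
  obtain ⟨C, hC, H⟩ := wl_full (E := EuclideanSpace ℝ (Fin n)) (by rw [hd]; exact hn) p hp1 (by rw [hd]; exact hp)
  have hCs : C ^ ((1:ℝ) / 2) ≠ ⊤ := ENNReal.rpow_ne_top_of_nonneg (by norm_num) hC
  refine ⟨(C ^ ((1:ℝ) / 2)).toReal + 1, by positivity, ?_⟩
  intro V hV hT F hS hF
  have hCle : C ^ ((1:ℝ) / 2) ≤ ENNReal.ofReal ((C ^ ((1:ℝ) / 2)).toReal + 1) := by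
    rw [← ENNReal.ofReal_toReal hCs]
    exact ENNReal.ofReal_le_ofReal (by rw [ENNReal.toReal_ofReal ENNReal.toReal_nonneg]; linarith)
  by_cases h0 : fpNorm n p V = 0
  · have hz := wl_fp_zero hp0 hV h0
    have : wtNorm n (fun x => (‖V x‖₊ : ℝ≥0∞))
        (fun x t => ∫ s in (0 : ℝ)..t, mOp n (sincMult (t - s)) (fun y => F y s) x) = 0 := by
      unfold wtNorm
      have : ∀ t : ℝ, ∫⁻ x : EuclideanSpace ℝ (Fin n), (‖∫ s in (0 : ℝ)..t, mOp n (sincMult (t - s)) (fun y => F y s) x‖₊ : ℝ≥0∞) ^ (2 : ℝ) * (‖V x‖₊ : ℝ≥0∞) = 0 := by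
        intro t
        rw [← lintegral_zero (μ := (volume : Measure (EuclideanSpace ℝ (Fin n))))]
        apply lintegral_congr_ae
        filter_upwards [hz] with x hx
        simp [hx]
      rw [lintegral_congr this, lintegral_zero, ENNReal.zero_rpow_of_pos (by norm_num)]
    rw [this]
    exact zero_le
  · set N := fpNorm n p V with hN
    have hNi : N⁻¹ ≠ ⊤ := ENNReal.inv_ne_top.2 h0
    have key := H (fun x => ‖V x‖ₑ * N⁻¹) (hV.enorm.mul_const _) (fun x => by finiteness) (wl_fp_wlH hp0 h0 hT.ne)
      F hF (fun s => (wl_schwartz_int (hS s)).1) (fun s => (wl_schwartz_int (hS s)).2)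
    set L := ∫⁻ t : ℝ, ∫⁻ x : EuclideanSpace ℝ (Fin n), (‖∫ s in (0 : ℝ)..t, mOp n (sincMult (t - s)) (fun y => F y s) x‖₊ : ℝ≥0∞) ^ (2 : ℝ) * (‖V x‖₊ : ℝ≥0∞) with hL
    set R := ∫⁻ t : ℝ, ∫⁻ x : EuclideanSpace ℝ (Fin n), (‖F x t‖₊ : ℝ≥0∞) ^ (2 : ℝ) * (‖V x‖₊ : ℝ≥0∞)⁻¹ with hR
    have eL : ∫⁻ t : ℝ, ∫⁻ x : EuclideanSpace ℝ (Fin n), ‖V x‖ₑ * N⁻¹ * ‖∫ s in (0:ℝ)..t, wlM F t s x‖ₑ ^ 2 = N⁻¹ * L := by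
      rw [hL, ← lintegral_const_mul' _ _ hNi]
      refine lintegral_congr fun t => ?_
      rw [← lintegral_const_mul' _ _ hNi]
      refine lintegral_congr fun x => ?_
      rw [ENNReal.rpow_two]
      change ‖V x‖ₑ * N⁻¹ * ‖∫ s in (0:ℝ)..t, wlM F t s x‖ₑ ^ 2 = N⁻¹ * (‖∫ s in (0:ℝ)..t, wlM F t s x‖ₑ ^ 2 * ‖V x‖ₑ)
      ring
    have eR : ∫⁻ s : ℝ, ∫⁻ x : EuclideanSpace ℝ (Fin n), ‖F x s‖ₑ ^ 2 * (‖V x‖ₑ * N⁻¹)⁻¹ = N * R := by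
      rw [hR, ← lintegral_const_mul' _ _ hT.ne]
      refine lintegral_congr fun t => ?_
      rw [← lintegral_const_mul' _ _ hT.ne]
      refine lintegral_congr fun x => ?_
      rw [ENNReal.rpow_two, ENNReal.mul_inv (Or.inr hNi) (Or.inl enorm_ne_top), inv_inv]
      change ‖F x t‖ₑ ^ 2 * (‖V x‖ₑ⁻¹ * N) = N * (‖F x t‖ₑ ^ 2 * ‖V x‖ₑ⁻¹)
      ring
    rw [eL, eR] at key
    have hLR : L ≤ C * N ^ (2:ℝ) * R := by
      calc L = N * (N⁻¹ * L) := by rw [← mul_assoc, ENNReal.mul_inv_cancel h0 hT.ne, one_mul]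
        _ ≤ N * (C * (N * R)) := mul_le_mul' le_rfl key
        _ = C * N ^ (2:ℝ) * R := by rw [ENNReal.rpow_two]; ring
    change L ^ ((1:ℝ) / 2) ≤ ENNReal.ofReal ((C ^ ((1:ℝ) / 2)).toReal + 1) * N * R ^ ((1:ℝ) / 2)
    calc L ^ ((1:ℝ) / 2) ≤ (C * N ^ (2:ℝ) * R) ^ ((1:ℝ) / 2) := ENNReal.rpow_le_rpow hLR (by norm_num)
      _ = C ^ ((1:ℝ) / 2) * N * R ^ ((1:ℝ) / 2) := by
          rw [ENNReal.mul_rpow_of_nonneg _ _ (by norm_num), ENNReal.mul_rpow_of_nonneg _ _ (by norm_num), ← ENNReal.rpow_mul]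
          norm_num
      _ ≤ _ := mul_le_mul' (mul_le_mul' hCle le_rfl) le_rfl

end
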